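/- arXiv:1910.05058 — 2 statements merged into one kernel-verified Lean document; each statement's English description precedes it below -/
import Mathlib

section
/- Every finite loopless graph (parallel edges allowed) that contains a spanning triangle-tree and has at most three vertices of degree 3 admits a nowhere-zero 3-flow. -/
open scoped Classical

/-- A finite loopless multigraph: finite vertex and edge types, each edge has an
unordered pair of distinct endpoints (parallel edges allowed, loops forbidden). -/
structure Multigraph where
  V : Type
  E : Type
  fintypeV : Fintype V
  fintypeE : Fintype E
  ends : E → Sym2 V
  loopless : ∀ e, ¬ (ends e).IsDiag

attribute [instance] Multigraph.fintypeV Multigraph.fintypeE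

namespace Multigraph

/-- `D` is an orientation of `G`: each edge is assigned an ordered pair (tail, head)
compatible with its endpoints. -/
def IsOrientation (G : Multigraph) (D : G.E → G.V × G.V) : Prop :=
  ∀ e, G.ends e = s((D e).1, (D e).2)

/-- Out-degree of `v` under the orientation `D` (tail = first component). -/
noncomputable def outDeg (G : Multigraph) (D : G.E → G.V × G.V) (v : G.V) : ℕ :=
  {e : G.E | (D e).1 = v}.ncard

/-- In-degree of `v` under the orientation `D` (head = second component). -/
noncomputable def inDeg (G : Multigraph) (D : G.E → G.V × G.V) (v : G.V) : ℕ :=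
  {e : G.E | (D e).2 = v}.ncard

/-- Flow conservation: at every vertex the sum of `f` over outgoing arcs equals the sum
over incoming arcs. -/
def IsConserving (G : Multigraph) (D : G.E → G.V × G.V) (f : G.E → ℤ) : Prop :=
  ∀ v : G.V,
    (∑ e : G.E, if (D e).1 = v then f e else 0) =
      ∑ e : G.E, if (D e).2 = v then f e else 0

/-- `G` has a nowhere-zero 3-flow. -/
def HasNZ3Flow (G : Multigraph) : Prop :=
  ∃ (D : G.E → G.V × G.V) (f : G.E → ℤ),
    G.IsOrientation D ∧ (∀ e, 1 ≤ |f e| ∧ |f e| ≤ 2) ∧ G.IsConserving D f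

/-- `G` is `Z3`-connected: every `Z3`-boundary is realized by some orientation. -/
def Z3Connected (G : Multigraph) : Prop :=
  ∀ β : G.V → ZMod 3, (∑ v : G.V, β v) = 0 →
    ∃ D : G.E → G.V × G.V, G.IsOrientation D ∧
      ∀ v : G.V, ((G.outDeg D v : ZMod 3) - (G.inDeg D v : ZMod 3)) = β v

/-- Degree of a vertex: number of edges incident with it. -/
noncomputable def degree (G : Multigraph) (v : G.V) : ℕ :=
  {e : G.E | v ∈ G.ends e}.ncard

/-- `(S, F)` is a triangle-tree subgraph of `G`: start from a triangle and repeatedly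
add a new vertex joined to the two endpoints of an existing edge. -/
inductive IsTriangleTree (G : Multigraph) : Set G.V → Set G.E → Prop
  | base (x y z : G.V) (e1 e2 e3 : G.E)
      (hxy : x ≠ y) (hxz : x ≠ z) (hyz : y ≠ z)
      (h1 : G.ends e1 = s(x, y)) (h2 : G.ends e2 = s(y, z)) (h3 : G.ends e3 = s(x, z)) :
      IsTriangleTree G {x, y, z} {e1, e2, e3}
  | grow (S : Set G.V) (F : Set G.E) (hT : IsTriangleTree G S F)
      (v a b : G.V) (hv : v ∉ S) (e : G.E) (he : e ∈ F) (hab : G.ends e = s(a, b))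
      (e1 e2 : G.E) (h1 : G.ends e1 = s(v, a)) (h2 : G.ends e2 = s(v, b)) :
      IsTriangleTree G (insert v S) (insert e1 (insert e2 F))

/-- `G` contains a spanning triangle-tree. -/
def HasSpanningTriangleTree (G : Multigraph) : Prop :=
  ∃ F : Set G.E, G.IsTriangleTree Set.univ F

/-- Degree of `v` inside the edge set `F`. -/
noncomputable def degIn (G : Multigraph) (F : Set G.E) (v : G.V) : ℕ :=
  {e : G.E | e ∈ F ∧ v ∈ G.ends e}.ncard

/-- `(S, F)` is a triangle-path subgraph: a triangle-tree which is either a single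
triangle or has exactly two leaves (vertices of degree 2). -/
def IsTrianglePath (G : Multigraph) (S : Set G.V) (F : Set G.E) : Prop :=
  G.IsTriangleTree S F ∧ (S.ncard = 3 ∨ {v ∈ S | G.degIn F v = 2}.ncard = 2)

/-- `(S, F)` is a subgraph of `G`: endpoints of every chosen edge are chosen vertices. -/
def Subgraph (G : Multigraph) (S : Set G.V) (F : Set G.E) : Prop :=
  ∀ e ∈ F, ∀ v, v ∈ G.ends e → v ∈ S

/-- `G` is isomorphic to the complete (simple) graph on `n` vertices. -/
def IsCompleteGraphOn (G : Multigraph) (n : ℕ) : Prop :=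
  ∃ (φ : G.V ≃ Fin n) (ψ : G.E ≃ {p : Sym2 (Fin n) // ¬ p.IsDiag}),
    ∀ e, Sym2.map (⇑φ) (G.ends e) = (ψ e).1

def IsK3 (G : Multigraph) : Prop := G.IsCompleteGraphOn 3

def IsK4 (G : Multigraph) : Prop := G.IsCompleteGraphOn 4

/-- `G` is a bull-growing of `H` (equivalently, `H` is the bull-reduction of `G`):
`u, v` are adjacent vertices of degree 3 in `G` with common neighbour `w`, the remaining
neighbours of `u`, `v` are `a`, `b`, and `H = G - u - v + ab` (with a loop deleted when
`a = b`). -/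
def IsBullGrowing (G H : Multigraph) : Prop :=
  ∃ (u v w a b : G.V) (euv euw evw eua evb : G.E),
    G.ends euv = s(u, v) ∧ G.ends euw = s(u, w) ∧ G.ends evw = s(v, w) ∧
    G.ends eua = s(u, a) ∧ G.ends evb = s(v, b) ∧
    a ≠ v ∧ b ≠ u ∧
    euv ≠ euw ∧ euv ≠ eua ∧ euw ≠ eua ∧
    euv ≠ evw ∧ euv ≠ evb ∧ evw ≠ evb ∧
    {e : G.E | u ∈ G.ends e} = {euv, euw, eua} ∧
    {e : G.E | v ∈ G.ends e} = {euv, evw, evb} ∧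
    ∃ φ : H.V → G.V, Function.Injective φ ∧
      Set.range φ = {x : G.V | x ≠ u ∧ x ≠ v} ∧
      ((a = b → ∃ ψ : H.E → G.E, Function.Injective ψ ∧
          Set.range ψ = {e : G.E | e ∉ ({euv, euw, evw, eua, evb} : Set G.E)} ∧
          ∀ e, G.ends (ψ e) = Sym2.map φ (H.ends e)) ∧
       (a ≠ b → ∃ (e0 : H.E) (ψ : H.E → G.E),
          Sym2.map φ (H.ends e0) = s(a, b) ∧
          Set.InjOn ψ {e : H.E | e ≠ e0} ∧
          ψ '' {e : H.E | e ≠ e0} = {e : G.E | e ∉ ({euv, euw, evw, eua, evb} : Set G.E)} ∧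
          ∀ e, e ≠ e0 → G.ends (ψ e) = Sym2.map φ (H.ends e)))

/-- `(S, F)` is a triangle (a `K3` subgraph) of `G`. -/
def IsTriangleSub (G : Multigraph) (S : Set G.V) (F : Set G.E) : Prop :=
  ∃ (x y z : G.V) (e1 e2 e3 : G.E),
    x ≠ y ∧ x ≠ z ∧ y ≠ z ∧
    G.ends e1 = s(x, y) ∧ G.ends e2 = s(y, z) ∧ G.ends e3 = s(x, z) ∧
    S = {x, y, z} ∧ F = {e1, e2, e3}

/-- The subgraph `(S, F)` of `G` is `Z3`-connected (as a graph in its own right). -/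
def SubZ3Connected (G : Multigraph) (S : Set G.V) (F : Set G.E) : Prop :=
  ∀ β : G.V → ZMod 3, (∀ v, v ∉ S → β v = 0) → (∑ v : G.V, β v) = 0 →
    ∃ D : G.E → G.V × G.V, G.IsOrientation D ∧
      ∀ v ∈ S, (({e : G.E | e ∈ F ∧ (D e).1 = v}.ncard : ZMod 3)
        - ({e : G.E | e ∈ F ∧ (D e).2 = v}.ncard : ZMod 3)) = β v

/-- `G` is the 2-sum of its subgraphs `(SA, FA)` and `(SB, FB)`:
`E(G) = E(A) ∪ E(B)`, `|E(A) ∩ E(B)| = 1` and `|V(A) ∩ V(B)| = 2`. -/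
def IsTwoSum (G : Multigraph) (SA : Set G.V) (FA : Set G.E)
    (SB : Set G.V) (FB : Set G.E) : Prop :=
  G.Subgraph SA FA ∧ G.Subgraph SB FB ∧
  FA ∪ FB = Set.univ ∧ (FA ∩ FB).ncard = 1 ∧ (SA ∩ SB).ncard = 2

/-- All vertices of `G` are joined by walks using only edges from `F`. -/
def ConnOn (G : Multigraph) (F : Set G.E) : Prop :=
  ∀ u v : G.V, Relation.ReflTransGen (fun x y => ∃ e ∈ F, G.ends e = s(x, y)) u v

/-- The spanning subgraph with edge set `F` is 2-edge-connected:
connected and with no cut edge. -/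
def TwoEdgeConnOn (G : Multigraph) (F : Set G.E) : Prop :=
  G.ConnOn F ∧ ∀ e ∈ F, G.ConnOn (F \ {e})

/-- The orientation `D` is strongly connected. -/
def StronglyConnected (G : Multigraph) (D : G.E → G.V × G.V) : Prop :=
  ∀ u v : G.V, Relation.ReflTransGen (fun x y => ∃ e : G.E, D e = (x, y)) u v

/-- `G` belongs to the class `S3`: every `Z3`-boundary is realized by a strongly
connected orientation. -/
def InS3 (G : Multigraph) : Prop :=
  ∀ β : G.V → ZMod 3, (∑ v : G.V, β v) = 0 →
    ∃ D : G.E → G.V × G.V, G.IsOrientation D ∧ G.StronglyConnected D ∧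
      ∀ v : G.V, ((G.outDeg D v : ZMod 3) - (G.inDeg D v : ZMod 3)) = β v

/-- `G` has a cycle (of length ≥ 2, so possibly a pair of parallel edges) all of whose
edges lie in `A`. -/
def HasCycleIn (G : Multigraph) (A : Set G.E) : Prop :=
  ∃ (vs : List G.V) (es : List G.E),
    2 ≤ vs.length ∧ vs.Nodup ∧ es.Nodup ∧ es.length = vs.length ∧
    (∀ e ∈ es, e ∈ A) ∧
    ∀ (i : ℕ) (h1 : i < es.length) (h2 : i < vs.length)
      (h3 : (i + 1) % vs.length < vs.length),
      G.ends (es.get ⟨i, h1⟩) = s(vs.get ⟨i, h2⟩, vs.get ⟨(i + 1) % vs.length, h3⟩)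

/-- `(vs, es)` is a path from `u` to `v` in `G`. -/
def IsPath (G : Multigraph) (u v : G.V) (vs : List G.V) (es : List G.E) : Prop :=
  vs.Nodup ∧ es.Nodup ∧ vs.head? = some u ∧ vs.getLast? = some v ∧
  vs.length = es.length + 1 ∧
  ∀ (i : ℕ) (h1 : i < es.length) (h2 : i < vs.length) (h3 : i + 1 < vs.length),
    G.ends (es.get ⟨i, h1⟩) = s(vs.get ⟨i, h2⟩, vs.get ⟨i + 1, h3⟩)

/-- `H` is isomorphic to the subgraph `(S, F)` of `G`. -/
def IsIsoToSub (H G : Multigraph) (S : Set G.V) (F : Set G.E) : Prop :=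
  ∃ (φ : H.V → G.V) (ψ : H.E → G.E),
    Function.Injective φ ∧ Set.range φ = S ∧
    Function.Injective ψ ∧ Set.range ψ = F ∧
    ∀ e, G.ends (ψ e) = Sym2.map φ (H.ends e)

/-- `G'` is (isomorphic to) the graph obtained from `G` by adding two new edges with
endpoint pairs `p` and `q`. -/
def IsAddTwoEdges (G : Multigraph) (p q : Sym2 G.V) (G' : Multigraph) : Prop :=
  ∃ (φ : G.V ≃ G'.V) (e1 e2 : G'.E), e1 ≠ e2 ∧
    G'.ends e1 = Sym2.map (⇑φ) p ∧ G'.ends e2 = Sym2.map (⇑φ) q ∧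
    ∃ ψ : G.E → G'.E, Function.Injective ψ ∧
      Set.range ψ = {e : G'.E | e ≠ e1 ∧ e ≠ e2} ∧
      ∀ e, G'.ends (ψ e) = Sym2.map (⇑φ) (G.ends e)

/-- `G'` is (isomorphic to) the graph obtained from `G` by deleting the edges in `X`
and adding one new edge with endpoint pair `p`. -/
def IsDeleteAddEdge (G : Multigraph) (X : Set G.E) (p : Sym2 G.V) (G' : Multigraph) : Prop :=
  ∃ (φ : G.V ≃ G'.V) (e0 : G'.E),
    G'.ends e0 = Sym2.map (⇑φ) p ∧
    ∃ ψ : {e : G.E // e ∉ X} → G'.E, Function.Injective ψ ∧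
      Set.range ψ = {e : G'.E | e ≠ e0} ∧
      ∀ e : {e : G.E // e ∉ X}, G'.ends (ψ e) = Sym2.map (⇑φ) (G.ends e.1)

/-- `G` is a crystal: a spanning triangle-path plus one extra edge joining its two
leaves. -/
def IsCrystal (G : Multigraph) : Prop :=
  ∃ (F : Set G.E) (u v : G.V) (e0 : G.E),
    G.IsTrianglePath Set.univ F ∧ u ≠ v ∧
    G.degIn F u = 2 ∧ G.degIn F v = 2 ∧
    e0 ∉ F ∧ G.ends e0 = s(u, v) ∧ insert e0 F = Set.univ

/-- The subgraph with edge set `F` is triangularly connected: any two of its edges lie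
on a common triangle-path inside it. -/
def TriangularlyConnectedOn (G : Multigraph) (F : Set G.E) : Prop :=
  ∀ e1 ∈ F, ∀ e2 ∈ F, ∃ (S : Set G.V) (F' : Set G.E),
    F' ⊆ F ∧ G.IsTrianglePath S F' ∧ e1 ∈ F' ∧ e2 ∈ F'

/-- `G` is triangularly connected. -/
def TriangularlyConnected (G : Multigraph) : Prop :=
  G.TriangularlyConnectedOn Set.univ

/-- `G` contains a spanning triangularly-connected subgraph. -/
def HasSpanningTriangularlyConnected (G : Multigraph) : Prop :=
  ∃ F : Set G.E, G.TriangularlyConnectedOn F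

/-- `G` admits a circular `t/s`-flow. -/
def HasCircularFlow (G : Multigraph) (t s : ℤ) : Prop :=
  ∃ (D : G.E → G.V × G.V) (f : G.E → ℤ),
    G.IsOrientation D ∧ (∀ e, s ≤ |f e| ∧ |f e| ≤ t - s) ∧ G.IsConserving D f

end Multigraph

/-- `G` can be obtained from `K4` by a (possibly empty) series of bull-growing
operations. -/
inductive FromK4ByBull : Multigraph → Prop
  | base (G : Multigraph) : G.IsK4 → FromK4ByBull G
  | grow (G H : Multigraph) : FromK4ByBull H → G.IsBullGrowing H → FromK4ByBull G

namespace TT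

set_option linter.unusedSectionVars false

variable {V E : Type} [Fintype V] [Fintype E]

/-- Kronecker delta in `ZMod 3`. -/
noncomputable def kd (a x : V) : ZMod 3 := if a = x then 1 else 0

/-- Boundary coefficient of an arc at a vertex. -/
noncomputable def dl (p : V × V) (x : V) : ZMod 3 := kd p.1 x - kd p.2 x

/-- Boundary of a `ZMod 3`-valued function. -/
noncomputable def Bd (D : E → V × V) (f : E → ZMod 3) (x : V) : ZMod 3 :=
  ∑ e, f e * dl (D e) x

/-- Unordered ends of an arc. -/
def pr (p : V × V) : Sym2 V := s(p.1, p.2)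

/-- Nowhere-zero `ZMod 3`-flow on the edge set `A`. -/
def Flow (D : E → V × V) (A : Finset E) : Prop :=
  ∃ f : E → ZMod 3, (∀ e, f e ≠ 0 ↔ e ∈ A) ∧ ∀ x, Bd D f x = 0

/-- Simple 2-trees, a single edge being allowed. -/
inductive ET : Finset V → Set (Sym2 V) → Prop
  | edge (x y : V) (h : x ≠ y) : ET {x, y} {s(x, y)}
  | grow (S : Finset V) (P : Set (Sym2 V)) (v a b : V) (h : ET S P) (hv : v ∉ S)
      (hab : s(a, b) ∈ P) : ET (insert v S) (insert s(v, a) (insert s(v, b) P))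

lemma Bd_add (D : E → V × V) (f g : E → ZMod 3) (x : V) :
    Bd D (fun e => f e + g e) x = Bd D f x + Bd D g x := by
  simp [Bd, add_mul, Finset.sum_add_distrib]

lemma Bd_smul (D : E → V × V) (c : ZMod 3) (f : E → ZMod 3) (x : V) :
    Bd D (fun e => c * f e) x = c * Bd D f x := by
  simp [Bd, mul_assoc, Finset.mul_sum]

lemma sum_kd (a : V) : ∑ x, kd a x = 1 := by
  simp [kd]

lemma sum_Bd (D : E → V × V) (f : E → ZMod 3) : ∑ x, Bd D f x = 0 := by
  unfold Bd
  rw [Finset.sum_comm]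
  apply Finset.sum_eq_zero
  intro e _
  rw [← Finset.mul_sum]
  simp [dl, Finset.sum_sub_distrib, sum_kd]

lemma unit_edge (D : E → V × V) (e : E) (a b : V) (h : pr (D e) = s(a, b)) :
    ∃ σ : ZMod 3, σ ≠ 0 ∧ ∀ x, Bd D (fun e' => if e' = e then σ else 0) x = kd a x - kd b x := by
  simp only [pr, Sym2.eq_iff] at h
  rcases h with ⟨h1, h2⟩ | ⟨h1, h2⟩
  · refine ⟨1, by decide, fun x => ?_⟩
    simp [Bd, dl, h1, h2]
  · refine ⟨-1, by decide, fun x => ?_⟩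
    simp [Bd, dl, h1, h2]

lemma ET.ne {S : Finset V} {P : Set (Sym2 V)} (h : ET S P) :
    ∀ a b, s(a, b) ∈ P → a ∈ S ∧ b ∈ S ∧ a ≠ b := by
  induction h with
  | edge x y h =>
    intro a b hab
    simp only [Set.mem_singleton_iff, Sym2.eq_iff] at hab
    rcases hab with ⟨rfl, rfl⟩ | ⟨rfl, rfl⟩ <;> simp [h, Ne.symm h]
  | grow S P v a b h hv hab ih =>
    intro c d hcd
    have := ih a b hab
    simp only [Set.mem_insert_iff, Sym2.eq_iff] at hcd
    rcases hcd with (⟨rfl, rfl⟩ | ⟨rfl, rfl⟩) | (⟨rfl, rfl⟩ | ⟨rfl, rfl⟩) | hcd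
    all_goals first
      | (have := ih c d hcd; simp [this])
      | (simp [this]; grind)

lemma z3_two (c : ZMod 3) : ∃ x y : ZMod 3, x ≠ 0 ∧ y ≠ 0 ∧ x + y = c := by
  revert c; decide

lemma z3_shift (c σ : ZMod 3) : σ ≠ 0 → ∃ t : ZMod 3, t ≠ 0 ∧ c + t * σ ≠ 0 := by
  revert c σ; decide

lemma lemmaZ (D : E → V × V) (r : Sym2 V → E) {S : Finset V} {P : Set (Sym2 V)} (h : ET S P) :
    (∀ p ∈ P, pr (D (r p)) = p) →
    ∀ p0 ∈ P, ∀ β : V → ZMod 3, (∑ x, β x = 0) → (∀ x, x ∉ S → β x = 0) →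
    ∃ f : E → ZMod 3, (∀ e, f e ≠ 0 → ∃ p ∈ P, e = r p) ∧ (∀ p ∈ P, p ≠ p0 → f (r p) ≠ 0) ∧
      ∀ x, Bd D f x = β x := by
  induction h with
  | edge x y h =>
    intro hr p0 hp0 β hs hS
    obtain ⟨σ, hσ, hb⟩ := unit_edge D (r s(x, y)) x y (hr _ rfl)
    refine ⟨fun e => β x * (if e = r s(x, y) then σ else 0), ?_, ?_, ?_⟩
    · intro e he
      refine ⟨s(x, y), rfl, ?_⟩
      by_contra hne
      simp [hne] at he
    · intro p hp hne
      simp at hp hp0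
      exact absurd (hp.trans hp0.symm) hne
    · intro z
      rw [Bd_smul, hb]
      have h2 : β x + β y = 0 := by
        rw [← hs, ← Finset.sum_pair h]
        apply Finset.sum_subset (Finset.subset_univ _)
        intro z _ hz
        exact hS z hz
      by_cases hx : x = z
      · subst hx; simp [kd, Ne.symm h]
      · by_cases hy : y = z
        · subst hy
          simp [kd, h]
          exact (eq_neg_of_add_eq_zero_right h2).symm
        · have := hS z (by simp; tauto)
          simp [kd, hx, hy, this]
  | grow S P v a b hT hv hab ih =>
    have key : ∀ a b, s(a, b) ∈ P → (∀ p ∈ insert s(v, a) (insert s(v, b) P), pr (D (r p)) = p) →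
        ∀ β : V → ZMod 3, (∑ x, β x = 0) → (∀ x, x ∉ insert v S → β x = 0) →
        ∃ f : E → ZMod 3, (∀ e, f e ≠ 0 → ∃ p ∈ insert s(v, a) (insert s(v, b) P), e = r p) ∧
        (∀ p ∈ insert s(v, a) (insert s(v, b) P), p ≠ s(v, a) → f (r p) ≠ 0) ∧
        ∀ x, Bd D f x = β x := by
      intro a b hab hr β hs hS
      have hn := hT.ne a b hab
      have hinj : ∀ p ∈ insert s(v, a) (insert s(v, b) P), ∀ q ∈ insert s(v, a) (insert s(v, b) P),
          r p = r q → p = q := by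
        intro p hp q hq h
        rw [← hr p hp, ← hr q hq, h]
      have hva : s(v, a) ∉ P := fun h => hv (hT.ne _ _ h).1
      have hvb : s(v, b) ∉ P := fun h => hv (hT.ne _ _ h).1
      have hvab : s(v, a) ≠ s(v, b) := by
        simp only [ne_eq, Sym2.eq_iff]; grind
      have ma : s(v, a) ∈ insert s(v, a) (insert s(v, b) P) := by simp
      have mb : s(v, b) ∈ insert s(v, a) (insert s(v, b) P) := by simp
      have mP : ∀ p ∈ P, p ∈ insert s(v, a) (insert s(v, b) P) := by
        intro p hp; simp [hp]
      obtain ⟨σ1, hσ1, hb1⟩ := unit_edge D (r s(v, a)) v a (hr _ ma)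
      obtain ⟨σ2, hσ2, hb2⟩ := unit_edge D (r s(v, b)) b v ((hr _ mb).trans Sym2.eq_swap)
      obtain ⟨σ0, hσ0, hb0⟩ := unit_edge D (r s(a, b)) a b (hr _ (mP _ hab))
      obtain ⟨f, hf1, hf2, hf3⟩ := ih (fun p hp => hr p (mP p hp)) s(a, b) hab
        (fun x => β x - β v * (kd v x - kd a x))
        (by simp [Finset.sum_sub_distrib, ← Finset.mul_sum, sum_kd, hs])
        (by
          intro x hx
          by_cases hxv : v = x
          · subst hxv
            have : a ≠ v := fun h => hx (h ▸ hn.1)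
            simp [kd, this]
          · have h1 : a ≠ x := fun h => hx (h ▸ hn.1)
            simp [kd, hxv, h1]
            exact hS x (by simp [hx, Ne.symm hxv]))
      obtain ⟨t, ht, ht2⟩ := z3_shift (f (r s(a, b))) σ0 hσ0
      refine ⟨fun e => f e + (β v * (if e = r s(v, a) then σ1 else 0) +
        t * ((if e = r s(a, b) then σ0 else 0) + ((if e = r s(v, b) then σ2 else 0) +
          (if e = r s(v, a) then σ1 else 0)))), ?_, ?_, ?_⟩
      · intro e he
        by_cases h1 : e = r s(v, a)
        · exact ⟨_, ma, h1⟩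
        by_cases h2 : e = r s(v, b)
        · exact ⟨_, mb, h2⟩
        by_cases h3 : e = r s(a, b)
        · exact ⟨_, mP _ hab, h3⟩
        simp [h1, h2, h3] at he
        obtain ⟨p, hp, h⟩ := hf1 e he
        exact ⟨p, mP p hp, h⟩
      · intro p hp hpa
        have n1 : r p ≠ r s(v, a) := fun h => hpa (hinj _ hp _ ma h)
        by_cases h2 : p = s(v, b)
        · subst h2
          have n3 : r s(v, b) ≠ r s(a, b) := fun h => hvb (hinj _ hp _ (mP _ hab) h ▸ hab)
          have hf0 : f (r s(v, b)) = 0 := by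
            by_contra hne
            obtain ⟨q, hq, hq2⟩ := hf1 _ hne
            exact hvb (hinj _ mb _ (mP _ hq) hq2 ▸ hq)
          simp [n1, n3, hf0, ht, hσ2]
        · have hpP : p ∈ P := by
            simp only [Set.mem_insert_iff] at hp; tauto
          have n2 : r p ≠ r s(v, b) := fun h => h2 (hinj _ hp _ mb h)
          by_cases h3 : p = s(a, b)
          · subst h3
            simp [n1, n2, ht2]
          · have n3 : r p ≠ r s(a, b) := fun h => h3 (hinj _ hp _ (mP _ hab) h)
            simp [n1, n2, n3]
            exact hf2 p hpP h3
      · intro x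
        rw [Bd_add, Bd_add, Bd_smul, Bd_smul, Bd_add, Bd_add, hf3, hb1, hb2, hb0]
        ring
    intro hr p0 hp0 β hs hS
    by_cases h1 : p0 = s(v, a)
    · subst h1; exact key a b hab hr β hs hS
    by_cases h2 : p0 = s(v, b)
    · subst h2
      have := key b a (Sym2.eq_swap ▸ hab) (by rw [Set.insert_comm]; exact hr) β hs hS
      rw [Set.insert_comm] at this
      exact this
    have hpP : p0 ∈ P := by
      simp only [Set.mem_insert_iff] at hp0; tauto
    have hn := hT.ne a b hab
    have hinj : ∀ p ∈ insert s(v, a) (insert s(v, b) P), ∀ q ∈ insert s(v, a) (insert s(v, b) P),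
        r p = r q → p = q := by
      intro p hp q hq h
      rw [← hr p hp, ← hr q hq, h]
    have hva : s(v, a) ∉ P := fun h => hv (hT.ne _ _ h).1
    have hvb : s(v, b) ∉ P := fun h => hv (hT.ne _ _ h).1
    have hvab : s(v, a) ≠ s(v, b) := by
      simp only [ne_eq, Sym2.eq_iff]; grind
    have ma : s(v, a) ∈ insert s(v, a) (insert s(v, b) P) := by simp
    have mb : s(v, b) ∈ insert s(v, a) (insert s(v, b) P) := by simp
    have mP : ∀ p ∈ P, p ∈ insert s(v, a) (insert s(v, b) P) := by
      intro p hp; simp [hp]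
    obtain ⟨σ1, hσ1, hb1⟩ := unit_edge D (r s(v, a)) v a (hr _ ma)
    obtain ⟨σ2, hσ2, hb2⟩ := unit_edge D (r s(v, b)) v b (hr _ mb)
    obtain ⟨c1, c2, hc1, hc2, hc⟩ := z3_two (β v)
    obtain ⟨f, hf1, hf2, hf3⟩ := ih (fun p hp => hr p (mP p hp)) p0 hpP
        (fun x => β x - c1 * (kd v x - kd a x) - c2 * (kd v x - kd b x))
        (by simp [Finset.sum_sub_distrib, ← Finset.mul_sum, sum_kd, hs])
        (by
          intro x hx
          by_cases hxv : v = x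
          · subst hxv
            have h1 : a ≠ v := fun h => hx (h ▸ hn.1)
            have h2 : b ≠ v := fun h => hx (h ▸ hn.2.1)
            simp [kd, h1, h2, ← hc]
          · have h1 : a ≠ x := fun h => hx (h ▸ hn.1)
            have h2 : b ≠ x := fun h => hx (h ▸ hn.2.1)
            simp [kd, hxv, h1, h2]
            exact hS x (by simp [hx, Ne.symm hxv]))
    have hz : ∀ p ∈ insert s(v, a) (insert s(v, b) P), p ∉ P → f (r p) = 0 := by
      intro p hp hpn
      by_contra hne
      obtain ⟨q, hq, hq2⟩ := hf1 _ hne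
      exact hpn (hinj _ hp _ (mP _ hq) hq2 ▸ hq)
    refine ⟨fun e => f e + (c1 * (if e = r s(v, a) then σ1 else 0) +
        c2 * (if e = r s(v, b) then σ2 else 0)), ?_, ?_, ?_⟩
    · intro e he
      by_cases h1 : e = r s(v, a)
      · exact ⟨_, ma, h1⟩
      by_cases h2 : e = r s(v, b)
      · exact ⟨_, mb, h2⟩
      simp [h1, h2] at he
      obtain ⟨p, hp, h⟩ := hf1 e he
      exact ⟨p, mP p hp, h⟩
    · intro p hp hp0
      by_cases h1 : p = s(v, a)
      · subst h1
        have n2 : r s(v, a) ≠ r s(v, b) := fun h => hvab (hinj _ ma _ mb h)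
        simp [hz _ ma hva, n2, hc1, hσ1]
      by_cases h2 : p = s(v, b)
      · subst h2
        have n2 : r s(v, b) ≠ r s(v, a) := fun h => hvab (hinj _ mb _ ma h).symm
        simp [hz _ mb hvb, n2, hc2, hσ2]
      have n1 : r p ≠ r s(v, a) := fun h => h1 (hinj _ hp _ ma h)
      have n2 : r p ≠ r s(v, b) := fun h => h2 (hinj _ hp _ mb h)
      have hpP : p ∈ P := by
        simp only [Set.mem_insert_iff] at hp; tauto
      simp [n1, n2]
      exact hf2 p hpP hp0
    · intro x
      rw [Bd_add, Bd_add, Bd_smul, Bd_smul, hf3, hb1, hb2]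
      ring

/-- Generic completion: a free edge of the tree absorbs the boundary. -/
lemma complete (D : E → V × V) (A : Finset E) (r : Sym2 V → E) {S : Finset V} {P : Set (Sym2 V)}
    (h : ET S P) (hr : ∀ p ∈ P, r p ∈ A ∧ pr (D (r p)) = p) (w x : V) (hwx : s(w, x) ∈ P)
    (g d : E → ZMod 3) (hg0 : ∀ e, e ∉ A → g e = 0 ∧ d e = 0)
    (hg1 : ∀ p ∈ P, g (r p) = 0 ∧ d (r p) = 0)
    (hg2 : ∀ e ∈ A, (∀ p ∈ P, e ≠ r p) → (g e ≠ 0 ∧ d e = 0) ∨ (g e = 0 ∧ d e ≠ 0))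
    (hgS : ∀ y, y ∉ S → Bd D g y = 0) (hd : ∀ y, Bd D d y = kd w y - kd x y) : Flow D A := by
  obtain ⟨f, hf1, hf2, hf3⟩ := lemmaZ D r h (fun p hp => (hr p hp).2) s(w, x) hwx
    (fun y => - Bd D g y) (by simp [sum_Bd]) (fun y hy => by simp [hgS y hy])
  obtain ⟨σ, hσ, hb⟩ := unit_edge D (r s(w, x)) x w ((hr _ hwx).2.trans Sym2.eq_swap)
  obtain ⟨t, ht, ht2⟩ := z3_shift (f (r s(w, x))) σ hσ
  refine ⟨fun e => g e + (f e + t * (d e + if e = r s(w, x) then σ else 0)), ?_, ?_⟩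
  · intro e
    by_cases hp : ∃ p ∈ P, e = r p
    · obtain ⟨p, hp, rfl⟩ := hp
      simp only [(hr p hp).1, iff_true]
      by_cases h0 : p = s(w, x)
      · subst h0
        simpa [hg1 _ hp] using ht2
      · have : r p ≠ r s(w, x) := by
          intro h
          apply h0
          rw [← (hr p hp).2, ← (hr _ hwx).2, h]
        simpa [hg1 _ hp, this] using hf2 p hp h0
    · have h1 : f e = 0 := by
        by_contra hne
        exact hp (hf1 e hne)
      have h2 : e ≠ r s(w, x) := fun h => hp ⟨_, hwx, h⟩
      by_cases hA : e ∈ A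
      · simp only [hA, iff_true]
        rcases hg2 e hA (fun p hp' h => hp ⟨p, hp', h⟩) with h | h
        · simp [h, h1, h2]
        · simp [h, h1, h2, ht]
      · simp [hg0 e hA, h1, h2, hA]
  · intro y
    rw [Bd_add, Bd_add, Bd_smul, Bd_add, hf3, hd, hb]
    ring

/-- Degree within the edge set `A`. -/
noncomputable def deg (D : E → V × V) (A : Finset E) (x : V) : ℕ :=
  (A.filter (fun e => x ∈ pr (D e))).card

/-- All edges of `A` are non-loops inside `S`. -/
def Good (D : E → V × V) (A : Finset E) (S : Finset V) : Prop :=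
  ∀ e ∈ A, (D e).1 ≠ (D e).2 ∧ (D e).1 ∈ S ∧ (D e).2 ∈ S

lemma digon (D : E → V × V) (A : Finset E) {S : Finset V} {P : Set (Sym2 V)}
    (h : ET S P) (hG : Good D A S) (hr : ∀ p ∈ P, ∃ e ∈ A, pr (D e) = p)
    (e1 e2 : E) (h1 : e1 ∈ A) (h2 : e2 ∈ A) (hne : e1 ≠ e2) (w x : V) (hwx : s(w, x) ∈ P)
    (hp1 : pr (D e1) = s(w, x)) (hp2 : pr (D e2) = s(w, x)) : Flow D A := by
  have hE : Nonempty E := ⟨e1⟩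
  choose! r hr using hr
  -- the edge not selected
  obtain ⟨e, heA, her, hep⟩ : ∃ e ∈ A, e ≠ r s(w, x) ∧ pr (D e) = s(w, x) := by
    by_cases h : e1 = r s(w, x)
    · exact ⟨e2, h2, fun h' => hne (h.trans h'.symm), hp2⟩
    · exact ⟨e1, h1, h, hp1⟩
  have hnr : ∀ p ∈ P, e ≠ r p := by
    intro p hp hee
    have : p = s(w, x) := by rw [← (hr p hp).2, ← hee, hep]
    exact her (this ▸ hee)
  obtain ⟨σ, hσ, hb⟩ := unit_edge D e w x hep
  refine complete D A r h hr w x hwx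
    (fun e' => if e' ∈ A ∧ (∀ p ∈ P, e' ≠ r p) ∧ e' ≠ e then 1 else 0)
    (fun e' => if e' = e then σ else 0) ?_ ?_ ?_ ?_ hb
  · intro e' he'
    have : e' ≠ e := fun h => he' (h ▸ heA)
    simp [he', this]
  · intro p hp
    constructor
    · simp only [ite_eq_right_iff]
      intro hh
      exact absurd rfl (hh.2.1 p hp)
    · simp [Ne.symm (hnr p hp)]
  · intro e' hA hh
    by_cases hee : e' = e
    · simp [hee, hσ]
    · left
      refine ⟨?_, by simp [hee]⟩
      rw [if_pos ⟨hA, hh, hee⟩]; decide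
  · intro y hy
    apply Finset.sum_eq_zero
    intro e' _
    by_cases hA : e' ∈ A
    · have := hG e' hA
      have n1 : (D e').1 ≠ y := fun h => hy (h ▸ this.2.1)
      have n2 : (D e').2 ≠ y := fun h => hy (h ▸ this.2.2)
      simp [dl, kd, n1, n2]
    · simp [hA]

lemma z3_sum (N : Finset E) (hN : 2 ≤ N.card) : ∀ c : ZMod 3,
    ∃ h : E → ZMod 3, (∀ e, h e ≠ 0) ∧ ∑ e ∈ N, h e = c := by
  induction N using Finset.induction_on with
  | empty => simp at hN
  | insert a N ha ih =>
    intro c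
    by_cases h2 : 2 ≤ N.card
    · obtain ⟨h, h1, hs⟩ := ih h2 (c - 1)
      refine ⟨Function.update h a 1, ?_, ?_⟩
      · intro e
        by_cases he : e = a
        · subst he; simp
        · simp [he, h1]
      · rw [Finset.sum_insert ha]
        have : ∑ e ∈ N, Function.update h a 1 e = ∑ e ∈ N, h e := by
          apply Finset.sum_congr rfl
          intro e he
          have : e ≠ a := fun h => ha (h ▸ he)
          simp [this]
        rw [this, hs]; simp
    · rw [Finset.card_insert_of_notMem ha] at hN
      have : N.card = 1 := by omega
      obtain ⟨b, rfl⟩ := Finset.card_eq_one.mp this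
      obtain ⟨p, q, hp, hq, hpq⟩ := z3_two c
      have hab : b ≠ a := by simpa [eq_comm] using ha
      refine ⟨fun e => if e = a then p else q, ?_, ?_⟩
      · intro e; by_cases he : e = a <;> simp [he, hp, hq]
      · rw [Finset.sum_insert ha]; simp [hab, hpq]

end TT

namespace TT

set_option linter.unusedSectionVars false

variable {V E : Type} [Fintype V] [Fintype E]

lemma star (D : E → V × V) (A : Finset E) {S0 : Finset V} {P0 : Set (Sym2 V)} (v w x : V)
    (L : Finset V) (h : ET S0 P0) (hG : Good D A (insert v (S0 ∪ L)))
    (hr : ∀ p ∈ P0, ∃ e ∈ A, pr (D e) = p) (hv : v ∉ S0) (hvL : v ∉ L)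
    (hL : ∀ u ∈ L, u ∉ S0) (hwx : s(w, x) ∈ P0) (ew ex : E) (hew : ew ∈ A) (hex : ex ∈ A)
    (hpw : pr (D ew) = s(v, w)) (hpx : pr (D ex) = s(v, x))
    (hLdeg : ∀ u ∈ L, deg D A u = 3)
    (hLe : ∀ u ∈ L, ∃ eu ∈ A, pr (D eu) = s(u, v) ∧ ∀ e ∈ A, pr (D e) = s(u, v) → e = eu)
    (hLL : ∀ e ∈ A, ¬ ((D e).1 ∈ L ∧ (D e).2 ∈ L)) (hdv : deg D A v ≠ 3) : Flow D A := by
  have hE : Nonempty E := ⟨ew⟩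
  choose! r hr using hr
  choose! eu heuA heup heuu using hLe
  have hn := h.ne w x hwx
  have hewx : ew ≠ ex := by
    intro hh
    rw [hh, hpx, Sym2.eq_iff] at hpw
    grind
  have hrS : ∀ p ∈ P0, (D (r p)).1 ∈ S0 ∧ (D (r p)).2 ∈ S0 := by
    intro p hp
    have h1 := (hr p hp).2
    have h2 := h.ne (D (r p)).1 (D (r p)).2 (by unfold pr at h1; rw [h1]; exact hp)
    exact ⟨h2.1, h2.2.1⟩
  set N : Finset E := ((A.filter (fun e => v ∈ pr (D e))).erase ew).erase ex with hNdef
  have hNcard : N.card + 2 = deg D A v := by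
    have m1 : ew ∈ A.filter (fun e => v ∈ pr (D e)) := by simp [hew, hpw]
    have m2 : ex ∈ (A.filter (fun e => v ∈ pr (D e))).erase ew := by
      simp [hex, hpx, Ne.symm hewx]
    have c1 := Finset.card_erase_add_one m1
    have c2 := Finset.card_erase_add_one m2
    rw [hNdef, deg]; omega
  have hmN : ∀ e, e ∈ N ↔ e ≠ ex ∧ e ≠ ew ∧ e ∈ A ∧ v ∈ pr (D e) := by
    intro e; simp [hNdef]
  obtain ⟨k, hk0, hks⟩ : ∃ k : E → ZMod 3, (∀ e, k e ≠ 0) ∧ ∑ e ∈ N, k e = 0 := by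
    by_cases h2 : 2 ≤ N.card
    · exact z3_sum N h2 0
    · have : N.card = 0 := by omega
      rw [Finset.card_eq_zero] at this
      exact ⟨fun _ => 1, fun _ => one_ne_zero, by simp [this]⟩
  obtain ⟨σ1, hσ1, hb1⟩ := unit_edge D ew w v (hpw.trans Sym2.eq_swap)
  obtain ⟨σ2, hσ2, hb2⟩ := unit_edge D ex v x hpx
  set g0 : E → ZMod 3 := fun e => if (D e).1 ∈ L then - k (eu (D e).1) else
    if (D e).2 ∈ L then k (eu (D e).2) else
    if e ∈ N then k e * dl (D e) v else 1 with hg0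
  set Q : E → Prop := fun e => e ∈ A ∧ (∀ p ∈ P0, e ≠ r p) ∧ e ≠ ew ∧ e ≠ ex with hQ
  have hvpr : ∀ e ∈ A, v ∈ pr (D e) → (v = (D e).1 ∧ v ≠ (D e).2) ∨ (v ≠ (D e).1 ∧ v = (D e).2) := by
    intro e he hve
    have := (hG e he).1
    simp only [pr, Sym2.mem_iff] at hve
    grind
  have hg0ne : ∀ e ∈ A, g0 e ≠ 0 := by
    intro e he
    simp only [hg0]
    split_ifs with h1 h2 h3
    · simpa using hk0 _
    · exact hk0 _
    · have h4 := ((hmN e).1 h3).2.2.2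
      rcases hvpr e he h4 with ⟨h5, h6⟩ | ⟨h5, h6⟩
      · have : dl (D e) v = 1 := by simp [dl, kd, ← h5, Ne.symm h6]
        rw [this]; simpa using hk0 e
      · have : dl (D e) v = -1 := by simp [dl, kd, ← h6, Ne.symm h5]
        rw [this]; simpa using hk0 e
    · decide
  refine complete D A r h hr w x hwx (fun e => if Q e then g0 e else 0)
    (fun e => (if e = ew then σ1 else 0) + (if e = ex then σ2 else 0)) ?_ ?_ ?_ ?_ ?_
  · intro e he
    have h1 : e ≠ ew := fun h => he (h ▸ hew)
    have h2 : e ≠ ex := fun h => he (h ▸ hex)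
    simp [h1, h2, hQ, he]
  · intro p hp
    have hs := hrS p hp
    have h1 : r p ≠ ew := by
      intro hh
      have := (hr p hp).2
      rw [hh, hpw] at this
      exact hv (h.ne v w (this ▸ hp)).1
    have h2 : r p ≠ ex := by
      intro hh
      have := (hr p hp).2
      rw [hh, hpx] at this
      exact hv (h.ne v x (this ▸ hp)).1
    refine ⟨?_, by simp [h1, h2]⟩
    rw [if_neg]
    intro hq
    exact hq.2.1 p hp rfl
  · intro e he hp
    by_cases h1 : e = ew
    · right
      subst h1
      simp [hewx, hσ1, hQ]
    by_cases h2 : e = ex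
    · right
      subst h2
      simp [h1, hσ2, hQ]
    left
    refine ⟨?_, by simp [h1, h2]⟩
    rw [if_pos ⟨he, hp, h1, h2⟩]
    exact hg0ne e he
  · intro y hy
    by_cases hyv : y = v
    · subst hyv
      have : Bd D (fun e => if Q e then g0 e else 0) y = ∑ e, if e ∈ N then k e else 0 := by
        apply Finset.sum_congr rfl
        intro e _
        by_cases hN : e ∈ N
        · have hm := (hmN e).1 hN
          have hQe : Q e := by
            refine ⟨hm.2.2.1, ?_, hm.2.1, hm.1⟩
            intro p hp hh
            have hs := hrS p hp
            rcases hvpr e hm.2.2.1 hm.2.2.2 with ⟨h5, h6⟩ | ⟨h5, h6⟩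
            · rw [hh] at h5; exact hy (h5 ▸ hs.1)
            · rw [hh] at h6; exact hy (h6 ▸ hs.2)
          simp only [hQe, hN, if_true, hg0]
          rcases hvpr e hm.2.2.1 hm.2.2.2 with ⟨h5, h6⟩ | ⟨h5, h6⟩
          · have hd : dl (D e) y = 1 := by simp [dl, kd, ← h5, Ne.symm h6]
            rw [if_neg (by rw [← h5]; exact hvL), hd]
            split_ifs with h7
            · rw [← heuu _ h7 e hm.2.2.1 (by rw [pr, ← h5]; exact Sym2.eq_swap)]; simp
            · simp
          · have hd : dl (D e) y = -1 := by simp [dl, kd, ← h6, Ne.symm h5]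
            rw [hd]
            split_ifs with h7 h8
            · rw [← heuu _ h7 e hm.2.2.1 (by rw [pr, ← h6])]; simp
            · exact absurd h8 (by rw [← h6]; exact hvL)
            · simp
        · simp only [hN, if_false]
          by_cases hQe : Q e
          · have : y ∉ pr (D e) := by
              intro hh
              exact hN ((hmN e).2 ⟨hQe.2.2.2, hQe.2.2.1, hQe.1, hh⟩)
            simp only [pr, Sym2.mem_iff, not_or] at this
            simp [dl, kd, Ne.symm this.1, Ne.symm this.2]
          · simp [hQe]
      rw [this, Finset.sum_ite_mem, Finset.univ_inter, hks]
    by_cases hyL : y ∈ L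
    · have : Bd D (fun e => if Q e then g0 e else 0) y =
          ∑ e, if e ∈ A.filter (fun e => y ∈ pr (D e)) then - k (eu y) else 0 := by
        apply Finset.sum_congr rfl
        intro e _
        by_cases hm : e ∈ A.filter (fun e => y ∈ pr (D e))
        · rw [if_pos hm]
          simp only [Finset.mem_filter] at hm
          have hQe : Q e := by
            refine ⟨hm.1, ?_, ?_, ?_⟩
            · intro p hp hh
              have hs := hrS p hp
              have h2 := hm.2
              simp only [pr, Sym2.mem_iff, hh] at h2
              rcases h2 with h2 | h2
              · exact hy (h2 ▸ hs.1)
              · exact hy (h2 ▸ hs.2)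
            · intro hh
              have h2 := hm.2
              rw [hh, hpw, Sym2.mem_iff] at h2
              rcases h2 with h2 | h2
              · exact hyv h2
              · exact hy (h2 ▸ hn.1)
            · intro hh
              have h2 := hm.2
              rw [hh, hpx, Sym2.mem_iff] at h2
              rcases h2 with h2 | h2
              · exact hyv h2
              · exact hy (h2 ▸ hn.2.1)
          simp only [hQe, if_true, hg0]
          have h2 := hm.2
          have h3 := (hG e hm.1).1
          have h4 := hLL e hm.1
          simp only [pr, Sym2.mem_iff] at h2
          rcases h2 with h2 | h2
          · have hd : dl (D e) y = 1 := by
              simp only [dl, kd]; rw [if_pos h2.symm, if_neg (by rw [h2]; exact h3.symm)]; simp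
            rw [if_pos (h2 ▸ hyL), hd, ← h2]; simp
          · have hd : dl (D e) y = -1 := by
              simp only [dl, kd]; rw [if_pos h2.symm, if_neg (by rw [h2]; exact h3)]; simp
            have h5 : (D e).2 ∈ L := h2 ▸ hyL
            rw [if_neg (fun h6 => h4 ⟨h6, h5⟩), if_pos h5, hd, ← h2]; simp
        · rw [if_neg hm]
          simp only [Finset.mem_filter, not_and] at hm
          by_cases hA : e ∈ A
          · have := hm hA
            simp only [pr, Sym2.mem_iff, not_or] at this
            simp [dl, kd, Ne.symm this.1, Ne.symm this.2]
          · simp [hQ, hA]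
      rw [this, Finset.sum_ite_mem, Finset.univ_inter, Finset.sum_const]
      have h3 := hLdeg y hyL
      unfold deg at h3
      rw [h3]
      generalize - k (eu y) = c
      revert c; decide
    · apply Finset.sum_eq_zero
      intro e _
      by_cases hA : e ∈ A
      · have := hG e hA
        have n1 : (D e).1 ≠ y := by
          intro hh; have := this.2.1; rw [hh] at this; simp [hyv, hy, hyL] at this
        have n2 : (D e).2 ≠ y := by
          intro hh; have := this.2.2; rw [hh] at this; simp [hyv, hy, hyL] at this
        simp [dl, kd, n1, n2]
      · simp [hQ, hA]
  · intro y
    rw [Bd_add, hb1, hb2]; ring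

/-- Weight of a degree. -/
def om (d : ℕ) : ℕ := if d = 1 then 2 else if d = 3 then 1 else 0

lemma deg_insert (D : E → V × V) (A : Finset E) (e : E) (he : e ∉ A) (x : V) :
    deg D (insert e A) x = (if x ∈ pr (D e) then 1 else 0) + deg D A x := by
  unfold deg
  rw [Finset.filter_insert]
  split_ifs with h
  · rw [Finset.card_insert_of_notMem (by simp [he])]; omega
  · simp

lemma om_eq (i j d : ℕ) (hi : i ≤ 1) (hj : j ≤ 1) :
    om d ≤ om (0 + (i + (i + (j + (j + d))))) + (i + j) := by
  unfold om
  interval_cases i <;> interval_cases j <;> split_ifs <;> omega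

lemma om_ne (i j d : ℕ) (hi : i ≤ 1) :
    om (j + d) ≤ om (0 + (i + (i + (j + d)))) + i := by
  unfold om
  interval_cases i <;> split_ifs <;> omega

lemma ite_le_one (p : Prop) [Decidable p] : (if p then 1 else 0 : ℕ) ≤ 1 := by
  split_ifs <;> omega

set_option maxHeartbeats 1000000 in
lemma bull (D : E → V × V) (A : Finset E) (S : Finset V) (P0 : Set (Sym2 V))
    (u v w a b : V) (euv euw evw eua evb : E)
    (m1 : euv ∈ A) (m2 : euw ∈ A) (m3 : evw ∈ A) (m4 : eua ∈ A) (m5 : evb ∈ A)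
    (p1 : pr (D euv) = s(u, v)) (p2 : pr (D euw) = s(u, w)) (p3 : pr (D evw) = s(v, w))
    (p4 : pr (D eua) = s(u, a)) (p5 : pr (D evb) = s(v, b))
    (huv : u ≠ v) (hwu : w ≠ u) (hwv : w ≠ v) (hau : a ≠ u) (hav : a ≠ v) (hbu : b ≠ u)
    (hbv : b ≠ v) (n1 : euw ≠ eua) (n2 : evw ≠ evb)
    (hu : ∀ e ∈ A, u ∈ pr (D e) → e = euv ∨ e = euw ∨ e = eua)
    (hv : ∀ e ∈ A, v ∈ pr (D e) → e = euv ∨ e = evw ∨ e = evb)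
    (hG : Good D A S) (huS : u ∈ S) (hvS : v ∈ S)
    (hom : ∑ x ∈ S, om (deg D A x) ≤ 3)
    (hT : ET ((S.erase u).erase v) P0)
    (hr : ∀ p ∈ P0, ∃ e ∈ A, pr (D e) = p)
    (IH : ∀ (D' : E → V × V) (A' : Finset E), Good D' A' ((S.erase u).erase v) →
      (∀ p ∈ P0, ∃ e ∈ A', pr (D' e) = p) →
      ∑ x ∈ (S.erase u).erase v, om (deg D' A' x) ≤ 3 → Flow D' A') : Flow D A := by
  have d12 : euv ≠ euw := by
    intro h; rw [h, p2, Sym2.eq_iff] at p1; grind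
  have d13 : euv ≠ evw := by
    intro h; rw [h, p3, Sym2.eq_iff] at p1; grind
  have d14 : euv ≠ eua := by
    intro h; rw [h, p4, Sym2.eq_iff] at p1; grind
  have d15 : euv ≠ evb := by
    intro h; rw [h, p5, Sym2.eq_iff] at p1; grind
  have d23 : euw ≠ evw := by
    intro h; rw [h, p3, Sym2.eq_iff] at p2; grind
  have d25 : euw ≠ evb := by
    intro h; rw [h, p5, Sym2.eq_iff] at p2; grind
  have d34 : evw ≠ eua := by
    intro h; rw [h, p4, Sym2.eq_iff] at p3; grind
  have d45 : eua ≠ evb := by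
    intro h; rw [h, p5, Sym2.eq_iff] at p4; grind
  set A5 : Finset E := A \ {euv, euw, evw, eua, evb} with hA5
  have hm5 : ∀ e, e ∈ A5 ↔ e ∈ A ∧ e ≠ euv ∧ e ≠ euw ∧ e ≠ evw ∧ e ≠ eua ∧ e ≠ evb := by
    intro e; simp [hA5]
  have hA : A = insert euv (insert euw (insert evw (insert eua (insert evb A5)))) := by
    ext e
    simp only [Finset.mem_insert, hm5]
    constructor
    · intro h; tauto
    · rintro (rfl | rfl | rfl | rfl | rfl | h)
      all_goals first | assumption | exact h.1
  set D' : E → V × V := Function.update D eua (a, b) with hD'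
  have hD'e : ∀ e, e ≠ eua → D' e = D e := by
    intro e he; simp [hD', he]
  have hD'a : D' eua = (a, b) := by simp [hD']
  set A' : Finset E := if a = b then A5 else insert eua A5 with hA'
  have hA'1 : a = b → A' = A5 := fun h => if_pos h
  have hA'2 : a ≠ b → A' = insert eua A5 := fun h => if_neg h
  have hdeg5 : ∀ x, deg D' A5 x = deg D A5 x := by
    intro x
    unfold deg
    congr 1
    apply Finset.filter_congr
    intro e he
    rw [hD'e e ((hm5 e).1 he).2.2.2.2.1]
  have hdegA : ∀ x, deg D A x = (if x ∈ s(u, v) then 1 else 0) + ((if x ∈ s(u, w) then 1 else 0) +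
      ((if x ∈ s(v, w) then 1 else 0) + ((if x ∈ s(u, a) then 1 else 0) +
      ((if x ∈ s(v, b) then 1 else 0) + deg D A5 x)))) := by
    intro x
    rw [hA, deg_insert, deg_insert, deg_insert, deg_insert, deg_insert, p1, p2, p3, p4, p5]
    all_goals simp [hm5, d12, d13, d14, d15, d23, d25, d34, d45, n1, n2]
  have h5u : deg D A5 u = 0 := by
    unfold deg
    rw [Finset.card_eq_zero, Finset.filter_eq_empty_iff]
    intro e he hue
    have := (hm5 e).1 he
    rcases hu e this.1 hue with h | h | h <;> tauto
  have h5v : deg D A5 v = 0 := by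
    unfold deg
    rw [Finset.card_eq_zero, Finset.filter_eq_empty_iff]
    intro e he hue
    have := (hm5 e).1 he
    rcases hv e this.1 hue with h | h | h <;> tauto
  have hdu : deg D A u = 3 := by
    rw [hdegA, h5u]; simp [huv, hwu.symm, hbu.symm]
  have hdv : deg D A v = 3 := by
    rw [hdegA, h5v]; simp [huv.symm, hwv.symm, hav.symm]
  have hdeg' : ∀ x, x ≠ u → x ≠ v → om (deg D' A' x) ≤ om (deg D A x) +
      ((if x = w then 1 else 0) + (if x = a then 1 else 0)) := by
    intro x hxu hxv
    rw [hdegA]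
    simp only [Sym2.mem_iff, hxu, hxv, false_or, or_false]
    by_cases hab : a = b
    · have h := om_eq (if x = w then 1 else 0) (if x = a then 1 else 0) (deg D A5 x)
        (ite_le_one _) (ite_le_one _)
      rw [hA'1 hab, hdeg5, ← hab]
      simpa only [if_false] using h
    · have h := om_ne (if x = w then 1 else 0) ((if x = a then 1 else 0) + (if x = b then 1 else 0))
        (deg D A5 x) (ite_le_one _)
      have h2 : (if x = a ∨ x = b then 1 else 0 : ℕ) =
          (if x = a then 1 else 0) + (if x = b then 1 else 0) := by
        by_cases h3 : x = a
        · have h4 : x ≠ b := fun h4 => hab (h3 ▸ h4)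
          simp [h3, hab]
        · simp [h3]
      rw [hA'2 hab, deg_insert _ _ _ (by simp [hm5]), hdeg5, hD'a]
      simp only [pr, Sym2.mem_iff, if_false]
      rw [h2]
      simp only [add_assoc] at h ⊢
      omega
  have hsum : ∑ x ∈ (S.erase u).erase v, om (deg D' A' x) ≤ 3 := by
    have e1 := Finset.add_sum_erase S (fun x => om (deg D A x)) huS
    have e2 := Finset.add_sum_erase (S.erase u) (fun x => om (deg D A x))
      (show v ∈ S.erase u by simp [hvS, huv.symm])
    have e3 : ∑ x ∈ (S.erase u).erase v, om (deg D' A' x) ≤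
        ∑ x ∈ (S.erase u).erase v, (om (deg D A x) +
        ((if x = w then 1 else 0) + (if x = a then 1 else 0))) := by
      apply Finset.sum_le_sum
      intro x hx
      simp only [Finset.mem_erase] at hx
      exact hdeg' x hx.2.1 hx.1
    rw [Finset.sum_add_distrib, Finset.sum_add_distrib, Finset.sum_ite_eq',
      Finset.sum_ite_eq'] at e3
    simp only [hdu, hdv] at e1 e2
    have o3 : om 3 = 1 := rfl
    rw [o3] at e1 e2
    have e4 : (if w ∈ (S.erase u).erase v then 1 else 0) ≤ 1 := by split_ifs <;> omega
    have e5 : (if a ∈ (S.erase u).erase v then 1 else 0) ≤ 1 := by split_ifs <;> omega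
    omega
  have haS : a ∈ S := by
    have h1 := hG eua m4
    have h2 : a ∈ pr (D eua) := by rw [p4]; simp
    simp only [pr, Sym2.mem_iff] at h2
    rcases h2 with h2 | h2 <;> rw [h2] <;> tauto
  have hbS : b ∈ S := by
    have h1 := hG evb m5
    have h2 : b ∈ pr (D evb) := by rw [p5]; simp
    simp only [pr, Sym2.mem_iff] at h2
    rcases h2 with h2 | h2 <;> rw [h2] <;> tauto
  have hG5 : ∀ e ∈ A5, (D' e).1 ≠ (D' e).2 ∧ (D' e).1 ∈ (S.erase u).erase v ∧
      (D' e).2 ∈ (S.erase u).erase v := by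
    intro e he
    have h5 := (hm5 e).1 he
    rw [hD'e e h5.2.2.2.2.1]
    have h1 := hG e h5.1
    have h2 : u ∉ pr (D e) := by
      intro hh; rcases hu e h5.1 hh with h | h | h <;> tauto
    have h3 : v ∉ pr (D e) := by
      intro hh; rcases hv e h5.1 hh with h | h | h <;> tauto
    simp only [pr, Sym2.mem_iff, not_or] at h2 h3
    simp only [Finset.mem_erase]
    refine ⟨h1.1, ⟨Ne.symm h3.1, Ne.symm h2.1, h1.2.1⟩, Ne.symm h3.2, Ne.symm h2.2, h1.2.2⟩
  have hA5' : A5 ⊆ A' := by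
    rw [hA']; split_ifs
    · exact Finset.Subset.refl _
    · exact Finset.subset_insert _ _
  obtain ⟨f, hf1, hf2⟩ : Flow D' A' := by
    refine IH D' A' ?_ ?_ hsum
    · intro e he
      by_cases hab : a = b
      · rw [hA'1 hab] at he
        exact hG5 e he
      · rw [hA'2 hab, Finset.mem_insert] at he
        rcases he with rfl | he
        · rw [hD'a]
          simp [hab, hau, hav, hbu, hbv, haS, hbS]
        · exact hG5 e he
    · intro p hp
      obtain ⟨e, he, hep⟩ := hr p hp
      have h1 := hT.ne (D e).1 (D e).2 (by unfold pr at hep; rw [hep]; exact hp)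
      simp only [Finset.mem_erase] at h1
      have h2 : u ∉ pr (D e) := by
        simp only [pr, Sym2.mem_iff, not_or]
        exact ⟨Ne.symm h1.1.2.1, Ne.symm h1.2.1.2.1⟩
      have h3 : v ∉ pr (D e) := by
        simp only [pr, Sym2.mem_iff, not_or]
        exact ⟨Ne.symm h1.1.1, Ne.symm h1.2.1.1⟩
      have h5 : e ∈ A5 := by
        rw [hm5]
        refine ⟨he, ?_, ?_, ?_, ?_, ?_⟩
        · rintro rfl; rw [p1] at h2; simp at h2
        · rintro rfl; rw [p2] at h2; simp at h2
        · rintro rfl; rw [p3] at h3; simp at h3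
        · rintro rfl; rw [p4] at h2; simp at h2
        · rintro rfl; rw [p5] at h3; simp at h3
      exact ⟨e, hA5' h5, by rw [hD'e e ((hm5 e).1 h5).2.2.2.2.1]; exact hep⟩
  have hnA' : ∀ e, e ≠ eua → (e ∈ A' ↔ e ∈ A5) := by
    intro e he
    rw [hA']; split_ifs <;> simp [he]
  have hzero : ∀ e, e ≠ eua → e ∉ A5 → f e = 0 := by
    intro e he h5
    by_contra hne
    exact h5 ((hnA' e he).1 ((hf1 e).1 hne))
  obtain ⟨c, hc, hcab⟩ : ∃ c : ZMod 3, c ≠ 0 ∧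
      ∀ x, f eua * (kd a x - kd b x) = c * (kd a x - kd b x) := by
    by_cases hab : a = b
    · exact ⟨1, by decide, fun x => by simp [hab]⟩
    · exact ⟨f eua, (hf1 eua).2 (by simp [hA'2 hab]), fun x => rfl⟩
  obtain ⟨σ1, hσ1, hb1⟩ := unit_edge D euv v u (p1.trans Sym2.eq_swap)
  obtain ⟨σ2, hσ2, hb2⟩ := unit_edge D euw w u (p2.trans Sym2.eq_swap)
  obtain ⟨σ3, hσ3, hb3⟩ := unit_edge D evw v w p3
  obtain ⟨σ4, hσ4, hb4⟩ := unit_edge D eua a u (p4.trans Sym2.eq_swap)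
  obtain ⟨σ5, hσ5, hb5⟩ := unit_edge D evb v b p5
  have hBf : ∀ x, Bd D (fun e => if e = eua then 0 else f e) x = - (c * (kd a x - kd b x)) := by
    intro x
    have h1 := hf2 x
    unfold Bd at h1 ⊢
    rw [← Finset.add_sum_erase _ _ (Finset.mem_univ eua)] at h1 ⊢
    rw [hD'a] at h1
    have h2 : dl (a, b) x = kd a x - kd b x := rfl
    rw [h2, hcab] at h1
    have h3 : ∑ e ∈ Finset.univ.erase eua, (if e = eua then 0 else f e) * dl (D e) x =
        ∑ e ∈ Finset.univ.erase eua, f e * dl (D' e) x := by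
      apply Finset.sum_congr rfl
      intro e he
      have : e ≠ eua := (Finset.mem_erase.1 he).1
      rw [hD'e e this, if_neg this]
    rw [h3]
    simp only [if_true, zero_mul, zero_add]
    exact eq_neg_of_add_eq_zero_right h1
  refine ⟨fun e => (if e = eua then 0 else f e) + c * ((if e = euv then σ1 else 0) +
    ((if e = euw then σ2 else 0) + ((if e = evw then σ3 else 0) + ((if e = eua then σ4 else 0) +
    (if e = evb then σ5 else 0))))), ?_, ?_⟩
  · intro e
    by_cases h1 : e = euv
    · subst h1
      simp [d12, d13, d14, d15, hzero e d14 (by simp [hm5]), hc, hσ1, m1]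
    by_cases h2 : e = euw
    · subst h2
      simp [h1, d23, n1, d25, hzero e n1 (by simp [hm5]), hc, hσ2, m2]
    by_cases h3 : e = evw
    · subst h3
      simp [h1, h2, d34, n2, hzero e d34 (by simp [hm5]), hc, hσ3, m3]
    by_cases h4 : e = eua
    · subst h4
      simp [h1, h2, h3, d45, hc, hσ4, m4]
    by_cases h5 : e = evb
    · subst h5
      simp [h1, h2, h3, h4, hzero e h4 (by simp [hm5]), hc, hσ5, m5]
    simp only [h1, h2, h3, h4, h5, if_false, add_zero, mul_zero]
    rw [hf1, hnA' e h4, hm5]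
    simp [h1, h2, h3, h4, h5]
  · intro x
    rw [Bd_add, Bd_smul, Bd_add, Bd_add, Bd_add, Bd_add, hBf, hb1, hb2, hb3, hb4, hb5]
    have h3 : (3 : ZMod 3) = 0 := by decide
    linear_combination c * (kd v x - kd u x) * h3

end TT

namespace TT

set_option linter.unusedSectionVars false

variable {V E : Type} [Fintype V] [Fintype E]

lemma build {S1 : Finset V} {P1 : Set (Sym2 V)} (hT : ET S1 P1) (L : Finset V) (a b : V → V) :
    (∀ u ∈ L, u ∉ S1) → (∀ u ∈ L, s(a u, b u) ∈ P1) →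
    ∃ P2, ET (S1 ∪ L) P2 ∧ P1 ⊆ P2 ∧ (∀ u ∈ L, s(u, a u) ∈ P2 ∧ s(u, b u) ∈ P2) ∧
      ∀ z ∈ P2, z ∈ P1 ∨ ∃ u ∈ L, z = s(u, a u) ∨ z = s(u, b u) := by
  induction L using Finset.induction_on with
  | empty =>
    intro _ _
    exact ⟨P1, by simpa using hT, subset_rfl, by simp, fun z hz => Or.inl hz⟩
  | insert u L hu ih =>
    intro h1 h2
    obtain ⟨P2, hT2, hs, hm, hz⟩ := ih (fun w hw => h1 w (by simp [hw])) (fun w hw => h2 w (by simp [hw]))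
    refine ⟨insert s(u, a u) (insert s(u, b u) P2), ?_, ?_, ?_, ?_⟩
    · rw [Finset.union_insert]
      exact ET.grow _ _ u (a u) (b u) hT2 (by simp [hu, h1 u]) (hs (h2 u (by simp)))
    · intro z hz
      simp [hs hz]
    · intro w hw
      rcases Finset.mem_insert.1 hw with rfl | hw
      · simp
      · have := hm w hw
        simp [this]
    · intro z hz'
      simp only [Set.mem_insert_iff] at hz'
      rcases hz' with h | h | h
      · right; exact ⟨u, by simp, Or.inl h⟩
      · right; exact ⟨u, by simp, Or.inr h⟩
      · rcases hz z h with h | ⟨w, hw, h⟩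
        · exact Or.inl h
        · right; exact ⟨w, by simp [hw], h⟩

/-- All other vertices are attached to one edge. -/
def KCase (S : Finset V) (P : Set (Sym2 V)) : Prop :=
  ∃ (p q : V) (L : Finset V), p ≠ q ∧ p ∉ L ∧ q ∉ L ∧ S = {p, q} ∪ L ∧ s(p, q) ∈ P ∧
    (∀ u ∈ L, s(u, p) ∈ P ∧ s(u, q) ∈ P) ∧
    ∀ z ∈ P, z = s(p, q) ∨ ∃ u ∈ L, z = s(u, p) ∨ z = s(u, q)

/-- A second level leaf `v` with all its kids `L`. -/
def CCase (S : Finset V) (P : Set (Sym2 V)) : Prop :=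
  ∃ (S0 : Finset V) (P0 : Set (Sym2 V)) (v w x : V) (L : Finset V) (c : V → V),
    ET S0 P0 ∧ v ∉ S0 ∧ s(w, x) ∈ P0 ∧ L.Nonempty ∧ v ∉ L ∧ (∀ u ∈ L, u ∉ S0) ∧
    (∀ u ∈ L, c u = w ∨ c u = x) ∧ S = insert v S0 ∪ L ∧ P0 ⊆ P ∧ s(v, w) ∈ P ∧ s(v, x) ∈ P ∧
    (∀ u ∈ L, s(u, v) ∈ P ∧ s(u, c u) ∈ P) ∧
    ∀ z ∈ P, z ∈ P0 ∨ z = s(v, w) ∨ z = s(v, x) ∨ ∃ u ∈ L, z = s(u, v) ∨ z = s(u, c u)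

/-- Growing at a pair `s(u, y)` where `u` is a kid. -/
lemma ccase_new {S1 : Finset V} {P1 P : Set (Sym2 V)} {S : Finset V} (hT : ET S1 P1)
    (L : Finset V) (a : V) (b : V → V) (hd : ∀ u ∈ L, u ∉ S1) (hab : ∀ u ∈ L, s(a, b u) ∈ P1)
    (hS : S = S1 ∪ L) (hP1 : P1 ⊆ P) (hLP : ∀ u ∈ L, s(u, a) ∈ P ∧ s(u, b u) ∈ P)
    (hP : ∀ z ∈ P, z ∈ P1 ∨ ∃ u ∈ L, z = s(u, a) ∨ z = s(u, b u))
    (v' : V) (hv' : v' ∉ S) (u : V) (hu : u ∈ L) (y : V) (hy : y = a ∨ y = b u) :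
    CCase (insert v' S) (insert s(v', u) (insert s(v', y) P)) := by
  obtain ⟨P2, hT2, hs, hm, hz⟩ := build hT (L.erase u) (fun _ => a) b
    (fun w hw => hd w (Finset.mem_of_mem_erase hw)) (fun w hw => hab w (Finset.mem_of_mem_erase hw))
  refine ⟨S1 ∪ L.erase u, P2, u, a, b u, {v'}, fun _ => y, hT2, ?_, hs (hab u hu), by simp, ?_,
    ?_, ?_, ?_, ?_, ?_, ?_, ?_, ?_⟩
  · simp [hd u hu]
  · simp only [Finset.mem_singleton]
    rintro rfl
    exact hv' (by simp [hS, hu])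
  · intro w hw
    simp only [Finset.mem_singleton] at hw
    subst hw
    simp only [hS, Finset.mem_union, not_or] at hv'
    simp [hv'.1, hv'.2]
  · intro _ _; exact hy
  · subst hS
    ext z
    simp only [Finset.mem_insert, Finset.mem_union, Finset.mem_erase, Finset.mem_singleton]
    by_cases hzu : z = u
    · subst hzu; simp [hu]
    · simp [hzu]; tauto
  · intro z hzP
    simp only [Set.mem_insert_iff]
    right; right
    rcases hz z hzP with h | ⟨w, hw, h | h⟩
    · exact hP1 h
    · rw [h]; exact (hLP w (Finset.mem_of_mem_erase hw)).1
    · rw [h]; exact (hLP w (Finset.mem_of_mem_erase hw)).2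
  · simp [(hLP u hu).1]
  · simp [(hLP u hu).2]
  · intro w hw
    simp only [Finset.mem_singleton] at hw
    subst hw
    simp
  · intro z hzP
    simp only [Set.mem_insert_iff] at hzP
    rcases hzP with h | h | h
    · right; right; right; exact ⟨v', by simp, Or.inl h⟩
    · right; right; right; exact ⟨v', by simp, Or.inr h⟩
    · rcases hP z h with h | ⟨w, hw, h⟩
      · exact Or.inl (hs h)
      · by_cases hwu : w = u
        · subst hwu; tauto
        · have := hm w (Finset.mem_erase.2 ⟨hwu, hw⟩)
          left
          rcases h with h | h
          · rw [h]; exact this.1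
          · rw [h]; exact this.2

lemma structure_lemma {S : Finset V} {P : Set (Sym2 V)} (hT : ET S P) : KCase S P ∨ CCase S P := by
  induction hT with
  | edge x y h =>
    left
    exact ⟨x, y, ∅, h, by simp, by simp, by simp, by simp, by simp, by simp⟩
  | grow S P v' a b hT hv' hab ih =>
    rcases ih with ⟨p, q, L, hpq, hpL, hqL, hS, hpqP, hLP, hP⟩ |
      ⟨S0, P0, v, w, x, L, c, hT0, hv, hwx, hLne, hvL, hLS, hc, hS, hP0, hvw, hvx, hLP, hP⟩
    · have hv'S : v' ≠ p ∧ v' ≠ q ∧ v' ∉ L := by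
        simp only [hS, Finset.mem_union, Finset.mem_insert, Finset.mem_singleton] at hv'
        tauto
      have hnew : ∀ u ∈ L, ∀ y, y = p ∨ y = q →
          CCase (insert v' S) (insert s(v', u) (insert s(v', y) P)) := by
        intro u hu y hy
        refine ccase_new (ET.edge p q hpq) L p (fun _ => q) ?_ (by simp) hS (by simpa using hpqP)
          hLP (by simpa using hP) v' hv' u hu y hy
        intro z hz
        simp only [Finset.mem_insert, Finset.mem_singleton, not_or]
        exact ⟨fun h => hpL (h ▸ hz), fun h => hqL (h ▸ hz)⟩
      have hKK : KCase (insert v' S) (insert s(v', p) (insert s(v', q) P)) := by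
        refine ⟨p, q, insert v' L, hpq, ?_, ?_, ?_, ?_, ?_, ?_⟩
        · simp [hpL, Ne.symm hv'S.1]
        · simp [hqL, Ne.symm hv'S.2.1]
        · rw [hS, Finset.union_insert]
        · simp [hpqP]
        · intro u hu
          rcases Finset.mem_insert.1 hu with rfl | hu
          · simp
          · simp [hLP u hu]
        · intro z hz
          simp only [Set.mem_insert_iff] at hz
          rcases hz with h | h | h
          · right; exact ⟨v', by simp, Or.inl h⟩
          · right; exact ⟨v', by simp, Or.inr h⟩
          · rcases hP z h with h | ⟨u, hu, h⟩
            · exact Or.inl h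
            · right; exact ⟨u, by simp [hu], h⟩
      rcases hP _ hab with h | ⟨u, hu, h | h⟩
      · left
        rcases Sym2.eq_iff.1 h with ⟨rfl, rfl⟩ | ⟨rfl, rfl⟩
        · exact hKK
        · rw [Set.insert_comm]; exact hKK
      · right
        rcases Sym2.eq_iff.1 h with ⟨rfl, rfl⟩ | ⟨rfl, rfl⟩
        · exact hnew _ hu _ (Or.inl rfl)
        · rw [Set.insert_comm]; exact hnew _ hu _ (Or.inl rfl)
      · right
        rcases Sym2.eq_iff.1 h with ⟨rfl, rfl⟩ | ⟨rfl, rfl⟩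
        · exact hnew _ hu _ (Or.inr rfl)
        · rw [Set.insert_comm]; exact hnew _ hu _ (Or.inr rfl)
    · right
      have hv'S : v' ≠ v ∧ v' ∉ S0 ∧ v' ∉ L := by
        simp only [hS, Finset.mem_union, Finset.mem_insert] at hv'
        tauto
      have hnew : ∀ u ∈ L, ∀ y, y = v ∨ y = c u →
          CCase (insert v' S) (insert s(v', u) (insert s(v', y) P)) := by
        intro u hu y hy
        refine ccase_new (ET.grow S0 P0 v w x hT0 hv hwx) L v c ?_ ?_ hS ?_
          hLP ?_ v' hv' u hu y hy
        · intro z hz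
          simp only [Finset.mem_insert, not_or]
          exact ⟨fun h => hvL (h ▸ hz), hLS z hz⟩
        · intro z hz
          rcases hc z hz with h | h <;> simp [h]
        · intro z hz
          simp only [Set.mem_insert_iff] at hz
          rcases hz with h | h | h
          · rw [h]; exact hvw
          · rw [h]; exact hvx
          · exact hP0 h
        · intro z hz
          simp only [Set.mem_insert_iff]
          rcases hP z hz with h | h | h | h
          · exact Or.inl (Or.inr (Or.inr h))
          · exact Or.inl (Or.inl h)
          · exact Or.inl (Or.inr (Or.inl h))
          · exact Or.inr h
      have hadd : ∀ y, y = w ∨ y = x →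
          CCase (insert v' S) (insert s(v', v) (insert s(v', y) P)) := by
        intro y hy
        refine ⟨S0, P0, v, w, x, insert v' L, Function.update c v' y, hT0, hv, hwx, by simp, ?_,
          ?_, ?_, ?_, ?_, ?_, ?_, ?_, ?_⟩
        · simp [hvL, Ne.symm hv'S.1]
        · intro u hu
          rcases Finset.mem_insert.1 hu with rfl | hu
          · exact hv'S.2.1
          · exact hLS u hu
        · intro u hu
          by_cases huv : u = v'
          · subst huv; simpa using hy
          · simp only [Finset.mem_insert, huv, false_or] at hu
            simpa [huv] using hc u hu
        · rw [hS, Finset.union_insert]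
        · intro z hz; simp [hP0 hz]
        · simp [hvw]
        · simp [hvx]
        · intro u hu
          by_cases huv : u = v'
          · subst huv; simp
          · simp only [Finset.mem_insert, huv, false_or] at hu
            simp [huv, hLP u hu]
        · intro z hz
          simp only [Set.mem_insert_iff] at hz
          rcases hz with h | h | h
          · right; right; right; exact ⟨v', by simp, Or.inl h⟩
          · right; right; right; exact ⟨v', by simp, Or.inr (by simpa using h)⟩
          · rcases hP z h with h | h | h | ⟨u, hu, h⟩
            · tauto
            · tauto
            · tauto
            · right; right; right
              have huv : u ≠ v' := fun h => hv'S.2.2 (h ▸ hu)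
              exact ⟨u, by simp [hu], by simpa [huv] using h⟩
      rcases hP _ hab with h | h | h | ⟨u, hu, h | h⟩
      · refine ⟨insert v' S0, insert s(v', a) (insert s(v', b) P0), v, w, x, L, c,
          ET.grow _ _ _ _ _ hT0 hv'S.2.1 h, ?_, by simp [hwx], hLne, hvL, ?_, hc, ?_, ?_, ?_, ?_,
          ?_, ?_⟩
        · simp [hv, Ne.symm hv'S.1]
        · intro u hu
          have huv : u ≠ v' := fun h => hv'S.2.2 (h ▸ hu)
          simp [huv, hLS u hu]
        · rw [hS, Finset.insert_comm, Finset.insert_union v']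
        · intro z hz
          simp only [Set.mem_insert_iff] at hz ⊢
          rcases hz with h | h | h
          · tauto
          · tauto
          · right; right; exact hP0 h
        · simp [hvw]
        · simp [hvx]
        · intro u hu; simp [hLP u hu]
        · intro z hz
          simp only [Set.mem_insert_iff] at hz ⊢
          rcases hz with h | h | h
          · tauto
          · tauto
          · rcases hP z h with h | h
            · exact Or.inl (Or.inr (Or.inr h))
            · exact Or.inr h
      · rcases Sym2.eq_iff.1 h with ⟨rfl, rfl⟩ | ⟨rfl, rfl⟩
        · exact hadd _ (Or.inl rfl)
        · rw [Set.insert_comm]; exact hadd _ (Or.inl rfl)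
      · rcases Sym2.eq_iff.1 h with ⟨rfl, rfl⟩ | ⟨rfl, rfl⟩
        · exact hadd _ (Or.inr rfl)
        · rw [Set.insert_comm]; exact hadd _ (Or.inr rfl)
      · rcases Sym2.eq_iff.1 h with ⟨rfl, rfl⟩ | ⟨rfl, rfl⟩
        · exact hnew _ hu _ (Or.inl rfl)
        · rw [Set.insert_comm]; exact hnew _ hu _ (Or.inl rfl)
      · rcases Sym2.eq_iff.1 h with ⟨rfl, rfl⟩ | ⟨rfl, rfl⟩
        · exact hnew _ hu _ (Or.inr rfl)
        · rw [Set.insert_comm]; exact hnew _ hu _ (Or.inr rfl)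

lemma three (D : E → V × V) (A : Finset E) (u : V) (hd : deg D A u = 3) (e1 e2 e3 : E)
    (h1 : e1 ∈ A) (h2 : e2 ∈ A) (h3 : e3 ∈ A) (p1 : u ∈ pr (D e1)) (p2 : u ∈ pr (D e2))
    (p3 : u ∈ pr (D e3)) (n12 : e1 ≠ e2) (n13 : e1 ≠ e3) (n23 : e2 ≠ e3) :
    ∀ e ∈ A, u ∈ pr (D e) → e = e1 ∨ e = e2 ∨ e = e3 := by
  have hsub : ({e1, e2, e3} : Finset E) ⊆ A.filter (fun e => u ∈ pr (D e)) := by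
    intro e he
    simp only [Finset.mem_insert, Finset.mem_singleton] at he
    rcases he with rfl | rfl | rfl <;> simp [*]
  have hc : ({e1, e2, e3} : Finset E).card = 3 := Finset.card_eq_three.2 ⟨e1, e2, e3, n12, n13, n23, rfl⟩
  have heq := Finset.eq_of_subset_of_card_le hsub (by rw [hc]; exact hd.le)
  intro e he hu
  have : e ∈ ({e1, e2, e3} : Finset E) := by rw [heq]; simp [he, hu]
  simpa using this

lemma third (D : E → V × V) (A : Finset E) (S : Finset V) (hG : Good D A S) (u : V)
    (hd : deg D A u = 3) (e1 e2 : E)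
    (h1 : e1 ∈ A) (h2 : e2 ∈ A) (p1 : u ∈ pr (D e1)) (p2 : u ∈ pr (D e2)) (n12 : e1 ≠ e2) :
    ∃ e3 ∈ A, e1 ≠ e3 ∧ e2 ≠ e3 ∧ ∃ z ∈ S, z ≠ u ∧ pr (D e3) = s(u, z) := by
  obtain ⟨e3, he3, hne⟩ : ∃ e3 ∈ A.filter (fun e => u ∈ pr (D e)), e3 ∉ ({e1, e2} : Finset E) := by
    by_contra hcon
    push Not at hcon
    have h := Finset.card_le_card (show A.filter (fun e => u ∈ pr (D e)) ⊆ {e1, e2} from hcon)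
    have h' := Finset.card_le_two (a := e1) (b := e2)
    unfold deg at hd
    omega
  simp only [Finset.mem_insert, Finset.mem_singleton, not_or] at hne
  simp only [Finset.mem_filter] at he3
  have hg := hG e3 he3.1
  refine ⟨e3, he3.1, Ne.symm hne.1, Ne.symm hne.2, ?_⟩
  have hu := he3.2
  simp only [pr, Sym2.mem_iff] at hu
  rcases hu with hu | hu
  · exact ⟨(D e3).2, hg.2.2, by rw [hu]; exact hg.1.symm, by rw [pr, ← hu]⟩
  · exact ⟨(D e3).1, hg.2.1, by rw [hu]; exact hg.1, by rw [pr, ← hu]; exact Sym2.eq_swap⟩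

lemma leaf_deg (D : E → V × V) (A : Finset E) {S1 : Finset V} {P1 : Set (Sym2 V)} (hT : ET S1 P1)
    (u w x : V) (hu : u ∉ S1) (hG : Good D A (insert u S1))
    (hr : ∀ p ∈ P1, ∃ e ∈ A, pr (D e) = p) (hwx : s(w, x) ∈ P1)
    (hw : ∃ e ∈ A, pr (D e) = s(u, w)) (hx : ∃ e ∈ A, pr (D e) = s(u, x)) (hn : ¬ Flow D A) :
    deg D A u = 3 := by
  by_contra hd
  obtain ⟨ew, hew, hpw⟩ := hw
  obtain ⟨ex, hex, hpx⟩ := hx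
  exact hn (star D A u w x ∅ hT (by simpa using hG) hr hu (by simp) (by simp) hwx ew ex hew hex
    hpw hpx (by simp) (by simp) (by simp) hd)

lemma kids (D : E → V × V) (A : Finset E) {S1 : Finset V} {P1 : Set (Sym2 V)} (hT : ET S1 P1)
    (L : Finset V) (a : V) (b : V → V) (hd : ∀ u ∈ L, u ∉ S1) (hab : ∀ u ∈ L, s(a, b u) ∈ P1)
    (hG : Good D A (S1 ∪ L)) (hr : ∀ p ∈ P1, ∃ e ∈ A, pr (D e) = p)
    (hrL : ∀ u ∈ L, (∃ e ∈ A, pr (D e) = s(u, a)) ∧ (∃ e ∈ A, pr (D e) = s(u, b u)))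
    (hom : ∑ x ∈ S1 ∪ L, om (deg D A x) ≤ 3)
    (IH : ∀ (S' : Finset V) (P' : Set (Sym2 V)) (D' : E → V × V) (A' : Finset E),
      S'.card < (S1 ∪ L).card → ET S' P' → Good D' A' S' →
      (∀ p ∈ P', ∃ e ∈ A', pr (D' e) = p) → ∑ x ∈ S', om (deg D' A' x) ≤ 3 → Flow D' A')
    (hn : ¬ Flow D A) :
    ∀ u ∈ L, deg D A u = 3 ∧ ∃ ea ∈ A, ∃ eb ∈ A, ∃ ez ∈ A, ∃ z ∈ S1, z ≠ a ∧ z ≠ b u ∧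
      pr (D ea) = s(u, a) ∧ pr (D eb) = s(u, b u) ∧ pr (D ez) = s(u, z) ∧ eb ≠ ez ∧
      ∀ e ∈ A, u ∈ pr (D e) → e = ea ∨ e = eb ∨ e = ez := by
  have hreal : ∀ L' ⊆ L, ∃ P', ET (S1 ∪ L') P' ∧ P1 ⊆ P' ∧
      (∀ u ∈ L', s(u, a) ∈ P' ∧ s(u, b u) ∈ P') ∧ ∀ p ∈ P', ∃ e ∈ A, pr (D e) = p := by
    intro L' hL'
    obtain ⟨P2, hT2, hs, hm, hz⟩ := build hT L' (fun _ => a) b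
      (fun w hw => hd w (hL' hw)) (fun w hw => hab w (hL' hw))
    refine ⟨P2, hT2, hs, hm, ?_⟩
    intro p hp
    rcases hz p hp with h | ⟨u, hu, h | h⟩
    · exact hr p h
    · rw [h]; exact (hrL u (hL' hu)).1
    · rw [h]; exact (hrL u (hL' hu)).2
  have hdeg : ∀ u ∈ L, deg D A u = 3 := by
    intro u hu
    obtain ⟨P', hT', hs', -, hr'⟩ := hreal (L.erase u) (Finset.erase_subset _ _)
    refine leaf_deg D A hT' u a (b u) ?_ ?_ hr' (hs' (hab u hu)) (hrL u hu).1 (hrL u hu).2 hn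
    · simp [hd u hu]
    · rw [← Finset.union_insert, Finset.insert_erase hu]; exact hG
  intro u hu
  refine ⟨hdeg u hu, ?_⟩
  obtain ⟨⟨ea, hea, hpa⟩, eb, heb, hpb⟩ := hrL u hu
  have hne := hT.ne _ _ (hab u hu)
  have hua : u ≠ a := fun h => hd u hu (h ▸ hne.1)
  have hub : u ≠ b u := fun h => hd u hu (by rw [h]; exact hne.2.1)
  have nab : ea ≠ eb := by
    intro h
    rw [h, hpb, Sym2.eq_iff] at hpa
    rcases hpa with h | h
    · exact hne.2.2 h.2.symm
    · exact hua h.1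
  obtain ⟨ez, hez, n1, n2, z, hzS, hzu, hpz⟩ := third D A _ hG u (hdeg u hu) ea eb hea heb
    (by simp [hpa]) (by simp [hpb]) nab
  obtain ⟨PL, hTL, hsL, hmL, hrPL⟩ := hreal L subset_rfl
  have hza : z ≠ a := by
    rintro rfl
    exact hn (digon D A hTL hG hrPL ea ez hea hez n1 u z (hmL u hu).1 hpa hpz)
  have hzb : z ≠ b u := by
    intro h
    rw [h] at hpz
    exact hn (digon D A hTL hG hrPL eb ez heb hez n2 u (b u) (hmL u hu).2 hpb hpz)
  have hall := three D A u (hdeg u hu) ea eb ez hea heb hez (by simp [hpa]) (by simp [hpb])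
    (by simp [hpz]) nab n1 n2
  by_cases hzS1 : z ∈ S1
  · exact ⟨ea, hea, eb, heb, ez, hez, z, hzS1, hza, hzb, hpa, hpb, hpz, n2, hall⟩
  exfalso
  have hzL : z ∈ L := by
    simp only [Finset.mem_union] at hzS; tauto
  obtain ⟨⟨fa, hfa, hqa⟩, fb, hfb, hqb⟩ := hrL z hzL
  have hne' := hT.ne _ _ (hab z hzL)
  have hzb' : z ≠ b z := fun h => hd z hzL (by rw [h]; exact hne'.2.1)
  have hub' : u ≠ b z := fun h => hd u hu (by rw [h]; exact hne'.2.1)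
  have k1 : fa ≠ fb := by
    intro h
    rw [h, hqb, Sym2.eq_iff] at hqa
    rcases hqa with h | h
    · exact hne'.2.2 h.2.symm
    · exact hza h.1
  have k2 : ez ≠ fa := by
    intro h
    rw [h, hqa, Sym2.eq_iff] at hpz
    grind
  have k3 : ez ≠ fb := by
    intro h
    rw [h, hqb, Sym2.eq_iff] at hpz
    grind
  have hall' := three D A z (hdeg z hzL) ez fa fb hez hfa hfb (by simp [hpz]) (by simp [hqa])
    (by simp [hqb]) k2 k3 k1
  have huz : u ∉ ({z} : Finset V) := by simpa using Ne.symm hzu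
  have hSe : ((S1 ∪ L).erase u).erase z = S1 ∪ (L.erase u).erase z := by
    ext y
    simp only [Finset.mem_erase, Finset.mem_union]
    by_cases hy1 : y = u
    · subst hy1; simp [hd y hu]
    by_cases hy2 : y = z
    · subst hy2; simp [hzS1]
    simp [hy1, hy2]
  obtain ⟨P', hT', hs', -, hr'⟩ := hreal ((L.erase u).erase z)
    ((Finset.erase_subset _ _).trans (Finset.erase_subset _ _))
  apply hn
  refine bull D A (S1 ∪ L) P' u z a (b u) (b z) ez ea fa eb fb hez hea hfa heb hfb hpz hpa hqa hpb
    hqb (Ne.symm hzu) (Ne.symm hua) (Ne.symm hza) (Ne.symm hub) (Ne.symm hzb) (Ne.symm hub')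
    (Ne.symm hzb') nab k1 (fun e he h => by have := hall e he h; tauto) hall' hG (by simp [hu])
    (by simp [hzL]) hom (hSe ▸ hT') hr' ?_
  intro D' A' hG' hr'' hom'
  refine IH _ P' D' A' ?_ (hSe ▸ hT') hG' hr'' hom'
  exact lt_of_le_of_lt (Finset.card_le_card (Finset.erase_subset _ _))
    (Finset.card_erase_lt_of_mem (by simp [hu]))

theorem main_aux : ∀ (n : ℕ) (S : Finset V) (P : Set (Sym2 V)) (D : E → V × V) (A : Finset E),
    S.card = n → ET S P → Good D A S → (∀ p ∈ P, ∃ e ∈ A, pr (D e) = p) →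
    ∑ x ∈ S, om (deg D A x) ≤ 3 → Flow D A := by
  intro n
  induction n using Nat.strong_induction_on with
  | _ n ihn =>
  intro S P D A hSn hT hG hr hom
  have IH : ∀ (S' : Finset V) (P' : Set (Sym2 V)) (D' : E → V × V) (A' : Finset E),
      S'.card < S.card → ET S' P' → Good D' A' S' →
      (∀ p ∈ P', ∃ e ∈ A', pr (D' e) = p) → ∑ x ∈ S', om (deg D' A' x) ≤ 3 → Flow D' A' :=
    fun S' P' D' A' h => ihn S'.card (hSn ▸ h) S' P' D' A' rfl
  by_contra hn
  rcases structure_lemma hT with ⟨p, q, L, hpq, hpL, hqL, hS, hpqP, hLP, -⟩ |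
      ⟨S0, P0, v, w, x, L, c, hT0, hv, hwx, hLne, hvL, hLS, hc, hS, hP0, hvw, hvx, hLP, -⟩
  · subst hS
    have hk := kids D A (ET.edge p q hpq) L p (fun _ => q) ?_ (by simp) hG
      (by simpa using hr _ hpqP) (fun u hu => ⟨hr _ (hLP u hu).1, hr _ (hLP u hu).2⟩) hom IH hn
    · rcases L.eq_empty_or_nonempty with hL | ⟨u, hu⟩
      · subst hL
        obtain ⟨e, heA, hep⟩ := hr _ hpqP
        have hone : ∀ e' ∈ A, e' = e := by
          intro e' he'
          by_contra hne
          have hg := hG e' he'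
          have : pr (D e') = s(p, q) := by
            simp only [Finset.union_empty, Finset.mem_insert, Finset.mem_singleton] at hg
            rw [pr, Sym2.eq_iff]
            grind
          exact hn (digon D A hT hG hr e' e he' heA hne p q hpqP this hep)
        have hA : A = {e} := by
          ext e'; simp only [Finset.mem_singleton]
          exact ⟨hone e', fun h => h ▸ heA⟩
        have hd : ∀ y, y = p ∨ y = q → deg D A y = 1 := by
          intro y hy
          subst hA
          unfold deg
          rw [Finset.filter_singleton, if_pos]
          · simp
          · rw [hep]; simpa using hy
        rw [Finset.union_empty, Finset.sum_pair hpq, hd p (Or.inl rfl), hd q (Or.inr rfl)] at hom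
        exact absurd hom (by decide)
      · obtain ⟨-, ea, -, eb, -, ez, -, z, hz, hzp, hzq, -⟩ := hk u hu
        simp at hz
        tauto
    · intro z hz
      simp only [Finset.mem_insert, Finset.mem_singleton, not_or]
      exact ⟨fun h => hpL (h ▸ hz), fun h => hqL (h ▸ hz)⟩
  · subst hS
    have hwxn := hT0.ne w x hwx
    have hT1 := ET.grow S0 P0 v w x hT0 hv hwx
    have hLS1 : ∀ u ∈ L, u ∉ insert v S0 := by
      intro z hz
      simp only [Finset.mem_insert, not_or]
      exact ⟨fun h => hvL (h ▸ hz), hLS z hz⟩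
    have hk := kids D A hT1 L v c hLS1 ?_ hG ?_ (fun u hu => ⟨hr _ (hLP u hu).1, hr _ (hLP u hu).2⟩)
      hom IH hn
    rotate_left
    · intro z hz
      rcases hc z hz with h | h <;> simp [h]
    · intro z hz
      simp only [Set.mem_insert_iff] at hz
      rcases hz with h | h | h
      · rw [h]; exact hr _ hvw
      · rw [h]; exact hr _ hvx
      · exact hr _ (hP0 h)
    obtain ⟨ew, hew, hpw⟩ := hr _ hvw
    obtain ⟨ex, hex, hpx⟩ := hr _ hvx
    have hr0 : ∀ p ∈ P0, ∃ e ∈ A, pr (D e) = p := fun p hp => hr p (hP0 hp)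
    have hcS : ∀ u ∈ L, c u ∈ S0 := by
      intro u hu
      rcases hc u hu with h | h <;> rw [h]
      · exact hwxn.1
      · exact hwxn.2.1
    by_cases hdv : deg D A v = 3
    · obtain ⟨u, hu⟩ := hLne
      obtain ⟨hdu, ea, hea, eb, heb, ez, hez, z, hz, hzv, hzc, hpa, hpb, hpz, nbz, hall⟩ := hk u hu
      have hzS0 : z ∈ S0 := by
        simp only [Finset.mem_insert] at hz; tauto
      have huv : u ≠ v := fun h => hvL (h ▸ hu)
      have huS0 := hLS u hu
      have hvw' : v ≠ w := fun h => hv (h ▸ hwxn.1)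
      have hvx' : v ≠ x := fun h => hv (h ▸ hwxn.2.1)
      have huw' : u ≠ w := fun h => huS0 (h ▸ hwxn.1)
      have hux' : u ≠ x := fun h => huS0 (h ▸ hwxn.2.1)
      have huz : u ≠ z := fun h => huS0 (h ▸ hzS0)
      have k1 : ew ≠ ex := by
        intro h; rw [h, hpx, Sym2.eq_iff] at hpw; grind
      have k2 : ea ≠ ew := by
        intro h; rw [h, hpw, Sym2.eq_iff] at hpa; grind
      have k3 : ea ≠ ex := by
        intro h; rw [h, hpx, Sym2.eq_iff] at hpa; grind
      have hallv := three D A v hdv ea ew ex hea hew hex (by simp [hpa]) (by simp [hpw])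
        (by simp [hpx]) k2 k3 k1
      have hLu : L = {u} := by
        ext u'
        simp only [Finset.mem_singleton]
        refine ⟨fun hu' => ?_, fun h => h ▸ hu⟩
        obtain ⟨e, he, hep⟩ := hr _ (hLP u' hu').1
        have hu'v : u' ≠ v := fun h => hvL (h ▸ hu')
        have hu'w : u' ≠ w := fun h => hLS u' hu' (h ▸ hwxn.1)
        have hu'x : u' ≠ x := fun h => hLS u' hu' (h ▸ hwxn.2.1)
        rcases hallv e he (by simp [hep]) with h | h | h
        · rw [h, hpa, Sym2.eq_iff] at hep; grind
        · rw [h, hpw, Sym2.eq_iff] at hep; grind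
        · rw [h, hpx, Sym2.eq_iff] at hep; grind
      have hSe : ((insert v S0 ∪ L).erase u).erase v = S0 := by
        rw [hLu]
        ext y
        simp only [Finset.mem_erase, Finset.mem_union, Finset.mem_insert, Finset.mem_singleton]
        by_cases hy1 : y = u
        · subst hy1; simp [huS0]
        by_cases hy2 : y = v
        · subst hy2; simp [hv]
        simp [hy1, hy2]
      have hIH : ∀ (D' : E → V × V) (A' : Finset E), Good D' A' (((insert v S0 ∪ L).erase u).erase v) →
          (∀ p ∈ P0, ∃ e ∈ A', pr (D' e) = p) →
          ∑ x ∈ ((insert v S0 ∪ L).erase u).erase v, om (deg D' A' x) ≤ 3 → Flow D' A' := by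
        intro D' A' hG' hr'' hom'
        refine IH _ P0 D' A' ?_ (hSe.symm ▸ hT0) hG' hr'' hom'
        exact lt_of_le_of_lt (Finset.card_le_card (Finset.erase_subset _ _))
          (Finset.card_erase_lt_of_mem (by simp [hu]))
      apply hn
      rcases hc u hu with hcu | hcu
      · rw [hcu] at hpb
        exact bull D A _ P0 u v w z x ea eb ew ez ex hea heb hew hez hex hpa hpb hpw hpz hpx huv
          huw'.symm hvw'.symm huz.symm hzv hux'.symm hvx'.symm nbz k1 hall hallv hG (by simp [hu])
          (by simp) hom (hSe.symm ▸ hT0) hr0 hIH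
      · rw [hcu] at hpb
        exact bull D A _ P0 u v x z w ea eb ex ez ew hea heb hex hez hew hpa hpb hpx hpz hpw huv
          hux'.symm hvx'.symm huz.symm hzv huw'.symm hvw'.symm nbz k1.symm hall
          (fun e he h => by have := hallv e he h; tauto) hG (by simp [hu])
          (by simp) hom (hSe.symm ▸ hT0) hr0 hIH
    · apply hn
      refine star D A v w x L hT0 (by rw [← Finset.insert_union]; exact hG) hr0 hv hvL hLS hwx ew ex
        hew hex hpw hpx (fun u hu => (hk u hu).1) ?_ ?_ hdv
      · intro u hu
        obtain ⟨hdu, ea, hea, eb, heb, ez, hez, z, hz, hzv, hzc, hpa, hpb, hpz, nbz, hall⟩ := hk u hu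
        have huv : u ≠ v := fun h => hvL (h ▸ hu)
        have hcv : c u ≠ v := fun h => hv (h ▸ hcS u hu)
        refine ⟨ea, hea, hpa, ?_⟩
        intro e he hp
        rcases hall e he (by simp [hp]) with h | h | h
        · exact h
        · rw [h, hpb, Sym2.eq_iff] at hp; grind
        · rw [h, hpz, Sym2.eq_iff] at hp; grind
      · intro e he ⟨h1, h2⟩
        obtain ⟨hdu, ea, hea, eb, heb, ez, hez, z, hz, hzv, hzc, hpa, hpb, hpz, nbz, hall⟩ :=
          hk _ h1
        have hg := hG e he
        have hoth : ∀ y, pr (D e) = s((D e).1, y) → y ∈ insert v S0 → False := by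
          intro y hy hyS
          rw [pr, Sym2.eq_iff] at hy
          rcases hy with ⟨-, h⟩ | ⟨-, h⟩
          · rw [← h] at hyS; exact hLS1 _ h2 hyS
          · exact hg.1 h.symm
        rcases hall e he (by simp [pr]) with h | h | h
        · exact hoth v (by rw [← hpa, ← h]) (by simp)
        · exact hoth _ (by rw [← hpb, ← h]) (by simp [hcS _ h1])
        · exact hoth z (by rw [← hpz, ← h]) hz

end TT

namespace TT

set_option linter.unusedSectionVars false

variable {V E : Type} [Fintype V] [Fintype E]

/-- Integer excess of `f` at a vertex. -/
noncomputable def exc (D : E → V × V) (f : E → ℤ) (x : V) : ℤ :=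
  ∑ e, f e * ((if (D e).1 = x then 1 else 0) - (if (D e).2 = x then 1 else 0))

/-- Simple directed paths avoiding a vertex set. -/
inductive Pth (r : V → V → Prop) : Finset V → V → V → Prop
  | refl (A : Finset V) (x : V) (h : x ∉ A) : Pth r A x x
  | step (A : Finset V) (x z y : V) (h : x ∉ A) (hr : r x z) (hp : Pth r (insert x A) z y) :
      Pth r A x y

lemma Pth.start {r : V → V → Prop} {A : Finset V} {x y : V} (h : Pth r A x y) : x ∉ A := by
  cases h <;> assumption

lemma Pth.weaken {r : V → V → Prop} {A : Finset V} {x y : V} (h : Pth r A x y) :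
    ∀ B ⊆ A, Pth r B x y := by
  induction h with
  | refl A x h => exact fun B hB => Pth.refl _ _ (fun h' => h (hB h'))
  | step A x z y h hr hp ih =>
    exact fun B hB => Pth.step _ _ z _ (fun h' => h (hB h')) hr
      (ih _ (Finset.insert_subset_insert _ hB))

lemma Pth.split {r : V → V → Prop} {A : Finset V} {x y : V} (h : Pth r A x y) :
    ∀ w, w ∉ A → Pth r (insert w A) x y ∨ Pth r A w y := by
  induction h with
  | refl A x h =>
    intro w hw
    by_cases hx : x = w
    · subst hx; exact Or.inr (Pth.refl _ _ h)
    · exact Or.inl (Pth.refl _ _ (by simp [hx, h]))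
  | step A x z y h hr hp ih =>
    intro w hw
    by_cases hx : x = w
    · subst hx; exact Or.inr (Pth.step _ _ z _ h hr hp)
    · rcases ih w (by simp [hw, Ne.symm hx]) with h' | h'
      · left
        refine Pth.step _ _ z _ (by simp [hx, h]) hr ?_
        rwa [Finset.insert_comm]
      · exact Or.inr (h'.weaken _ (Finset.subset_insert _ _))

lemma Pth.of_reach {r : V → V → Prop} {x y : V} (h : Relation.ReflTransGen r x y) :
    Pth r ∅ x y := by
  induction h using Relation.ReflTransGen.head_induction_on with
  | refl => exact Pth.refl _ _ (by simp)
  | head h _ ih =>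
    rename_i a c _
    rcases ih.split a (by simp) with h' | h'
    · exact Pth.step _ _ _ _ (by simp) h h'
    · exact h'

/-- Residual arc relation. -/
def res (D : E → V × V) (f : E → ℤ) (p q : V) : Prop :=
  ∃ e, (D e = (p, q) ∧ 0 < f e) ∨ (D e = (q, p) ∧ f e < 0)

lemma exc_update (D : E → V × V) (f : E → ℤ) (e0 : E) (c : ℤ) (x : V) :
    exc D (Function.update f e0 (f e0 + c)) x = exc D f x +
      c * ((if (D e0).1 = x then 1 else 0) - (if (D e0).2 = x then 1 else 0)) := by
  have : ∀ e, Function.update f e0 (f e0 + c) e = f e + if e = e0 then c else 0 := by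
    intro e
    by_cases h : e = e0
    · subst h; simp
    · simp [h]
  simp only [exc, this, add_mul, Finset.sum_add_distrib]
  simp

lemma augment (D : E → V × V) (f : E → ℤ) (hf : ∀ e, 1 ≤ |f e| ∧ |f e| ≤ 2) {A : Finset V}
    {x y : V} (h : Pth (res D f) A x y) :
    ∃ g : E → ℤ, (∀ e, 1 ≤ |g e| ∧ |g e| ≤ 2) ∧
      (∀ z, exc D g z = exc D f z - 3 * (if x = z then 1 else 0) + 3 * (if y = z then 1 else 0)) ∧
      ∀ e, (D e).1 ∈ A ∨ (D e).2 ∈ A → g e = f e := by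
  induction h with
  | refl A x h => exact ⟨f, hf, by simp, by simp⟩
  | step A x z y h hr hp ih =>
    obtain ⟨g, hg, hex, hA⟩ := ih
    have hz := hp.start
    simp only [Finset.mem_insert, not_or] at hz
    obtain ⟨e0, ⟨h1, h2⟩ | ⟨h1, h2⟩⟩ := hr
    · have hge : g e0 = f e0 := hA e0 (by simp [h1])
      refine ⟨Function.update g e0 (g e0 + (-3)), ?_, ?_, ?_⟩
      · intro e
        by_cases he : e = e0
        · subst he
          have := hf e
          simp only [Function.update_self, hge]
          rw [abs_of_pos h2] at this
          rcases abs_cases (f e + -3) with h | h <;> omega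
        · simpa [he] using hg e
      · intro w
        rw [exc_update, hex, h1]
        ring
      · intro e he
        have : e ≠ e0 := by
          rintro rfl
          rw [h1] at he
          simp [h, hz.2] at he
        rw [Function.update_of_ne this]
        exact hA e (by simp only [Finset.mem_insert]; tauto)
    · have hge : g e0 = f e0 := hA e0 (by simp [h1])
      refine ⟨Function.update g e0 (g e0 + 3), ?_, ?_, ?_⟩
      · intro e
        by_cases he : e = e0
        · subst he
          have := hf e
          simp only [Function.update_self, hge]
          rw [abs_of_neg h2] at this
          rcases abs_cases (f e + 3) with h | h <;> omega
        · simpa [he] using hg e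
      · intro w
        rw [exc_update, hex, h1]
        ring
      · intro e he
        have : e ≠ e0 := by
          rintro rfl
          rw [h1] at he
          simp [h, hz.2] at he
        rw [Function.update_of_ne this]
        exact hA e (by simp only [Finset.mem_insert]; tauto)

lemma sum_exc (D : E → V × V) (f : E → ℤ) (R : Finset V) :
    ∑ x ∈ R, exc D f x =
      ∑ e, f e * ((if (D e).1 ∈ R then 1 else 0) - (if (D e).2 ∈ R then 1 else 0)) := by
  unfold exc
  rw [Finset.sum_comm]
  refine Finset.sum_congr rfl fun e _ => ?_
  rw [← Finset.mul_sum, Finset.sum_sub_distrib]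
  simp

lemma find_neg (D : E → V × V) (f : E → ℤ) (x : V) (hx : 0 < exc D f x) :
    ∃ y, Relation.ReflTransGen (res D f) x y ∧ exc D f y < 0 := by
  by_contra! hcon
  let R : Finset V := Finset.univ.filter (fun y => Relation.ReflTransGen (res D f) x y)
  have hR : ∀ y, y ∈ R ↔ Relation.ReflTransGen (res D f) x y := by simp [R]
  have h1 : 0 < ∑ y ∈ R, exc D f y := by
    refine Finset.sum_pos' (fun y hy => hcon y ((hR y).1 hy)) ⟨x, (hR x).2 .refl, hx⟩
  rw [sum_exc] at h1
  have h2 : ∑ e, f e * ((if (D e).1 ∈ R then 1 else 0) - (if (D e).2 ∈ R then 1 else 0)) ≤ 0 := by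
    refine Finset.sum_nonpos fun e _ => ?_
    by_cases ha : (D e).1 ∈ R <;> by_cases hb : (D e).2 ∈ R
    · simp [ha, hb]
    · simp only [ha, hb, if_true, if_false]
      by_contra hc
      exact hb ((hR _).2 (((hR _).1 ha).tail ⟨e, Or.inl ⟨rfl, by omega⟩⟩))
    · simp only [ha, hb, if_true, if_false]
      by_contra hc
      exact ha ((hR _).2 (((hR _).1 hb).tail ⟨e, Or.inr ⟨rfl, by omega⟩⟩))
    · simp [ha, hb]
  omega

lemma tutte_aux (D : E → V × V) : ∀ n : ℕ, ∀ f : E → ℤ, (∀ e, 1 ≤ |f e| ∧ |f e| ≤ 2) →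
    (∀ x, (3 : ℤ) ∣ exc D f x) → ∑ x, (exc D f x).natAbs = n →
    ∃ g : E → ℤ, (∀ e, 1 ≤ |g e| ∧ |g e| ≤ 2) ∧ ∀ x, exc D g x = 0 := by
  intro n
  induction n using Nat.strong_induction_on with
  | _ n ih =>
    intro f hf h3 hn
    by_cases hall : ∀ x, exc D f x ≤ 0
    · refine ⟨f, hf, fun x => ?_⟩
      have hs : ∑ x, exc D f x = 0 := by rw [sum_exc]; simp
      exact (Finset.sum_eq_zero_iff_of_nonpos (fun x _ => hall x)).1 hs x (Finset.mem_univ _)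
    · push Not at hall
      obtain ⟨x, hx⟩ := hall
      obtain ⟨y, hxy, hy⟩ := find_neg D f x hx
      obtain ⟨g, hg, hex, -⟩ := augment D f hf (Pth.of_reach hxy)
      have hne : x ≠ y := by rintro rfl; omega
      refine ih (∑ x, (exc D g x).natAbs) ?_ g hg ?_ rfl
      · rw [← hn]
        refine Finset.sum_lt_sum (fun z _ => ?_) ⟨x, Finset.mem_univ _, ?_⟩
        · have h3z := h3 z
          rw [hex]
          by_cases hxz : x = z
          · subst hxz
            simp only [Ne.symm hne, if_true, if_false]; omega
          · by_cases hyz : y = z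
            · subst hyz
              simp only [hne, if_true, if_false]; omega
            · simp [hxz, hyz]
        · have h3z := h3 x
          rw [hex]
          simp only [Ne.symm hne, if_true, if_false]; omega
      · intro z
        have h3z := h3 z
        rw [hex]
        split_ifs <;> omega

lemma tutte (D : E → V × V) (h : Flow D Finset.univ) :
    ∃ g : E → ℤ, (∀ e, 1 ≤ |g e| ∧ |g e| ≤ 2) ∧ ∀ x, exc D g x = 0 := by
  obtain ⟨f, hf, hb⟩ := h
  refine tutte_aux D _ (fun e => ((f e).val : ℤ)) ?_ ?_ rfl
  · intro e
    have h0 : f e ≠ 0 := (hf e).2 (Finset.mem_univ _)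
    have h1 : (f e).val ≠ 0 := by rwa [Ne, ZMod.val_eq_zero]
    have h2 : (f e).val < 3 := ZMod.val_lt _
    rw [abs_of_nonneg (by omega)]
    omega
  · intro x
    have := hb x
    have h3 : ((exc D (fun e => ((f e).val : ℤ)) x : ℤ) : ZMod 3) = 0 := by
      rw [← this]
      unfold exc Bd
      push_cast
      refine Finset.sum_congr rfl fun e _ => ?_
      simp [dl, kd]
    exact (ZMod.intCast_zmod_eq_zero_iff_dvd _ 3).1 h3

end TT

namespace TT

lemma tt_aux (G : Multigraph) {S : Set G.V} {F : Set G.E} (h : G.IsTriangleTree S F) :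
    (∃ P, ET S.toFinset P ∧ (∀ p ∈ P, ∃ e, G.ends e = p) ∧ ∀ e ∈ F, G.ends e ∈ P) ∧
      ∀ x ∈ S, ∃ e e', e ≠ e' ∧ x ∈ G.ends e ∧ x ∈ G.ends e' := by
  induction h with
  | base x y z e1 e2 e3 hxy hxz hyz h1 h2 h3 =>
    refine ⟨⟨insert s(z, x) (insert s(z, y) {s(x, y)}), ?_, ?_, ?_⟩, ?_⟩
    · have := ET.grow {x, y} {s(x, y)} z x y (ET.edge x y hxy)
        (by simp [Ne.symm hxz, Ne.symm hyz]) (by simp)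
      convert this using 1
      ext w; simp; tauto
    · intro p hp
      simp only [Set.mem_insert_iff, Set.mem_singleton_iff] at hp
      rcases hp with rfl | rfl | rfl
      · exact ⟨e3, by rw [h3, Sym2.eq_swap]⟩
      · exact ⟨e2, by rw [h2, Sym2.eq_swap]⟩
      · exact ⟨e1, h1⟩
    · intro e he
      simp only [Set.mem_insert_iff, Set.mem_singleton_iff] at he
      rcases he with rfl | rfl | rfl
      · simp [h1]
      · rw [h2, Sym2.eq_swap]; simp
      · rw [h3, Sym2.eq_swap]; simp
    · intro w hw
      have h12 : e1 ≠ e2 := by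
        rintro rfl; rw [h1, Sym2.eq_iff] at h2; grind
      have h13 : e1 ≠ e3 := by
        rintro rfl; rw [h1, Sym2.eq_iff] at h3; grind
      have h23 : e2 ≠ e3 := by
        rintro rfl; rw [h2, Sym2.eq_iff] at h3; grind
      simp only [Set.mem_insert_iff, Set.mem_singleton_iff] at hw
      rcases hw with rfl | rfl | rfl
      · exact ⟨e1, e3, h13, by simp [h1], by simp [h3]⟩
      · exact ⟨e1, e2, h12, by simp [h1], by simp [h2]⟩
      · exact ⟨e2, e3, h23, by simp [h2], by simp [h3]⟩
  | grow S F hT v a b hv e he hab e1 e2 h1 h2 ih =>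
    obtain ⟨⟨P, hP, hr, hF⟩, hd⟩ := ih
    have habP : s(a, b) ∈ P := hab ▸ hF e he
    have hn := hP.ne a b habP
    refine ⟨⟨insert s(v, a) (insert s(v, b) P), ?_, ?_, ?_⟩, ?_⟩
    · have := ET.grow S.toFinset P v a b hP (by simpa using hv) habP
      convert this using 1
      ext w; simp
    · intro p hp
      simp only [Set.mem_insert_iff] at hp
      rcases hp with rfl | rfl | hp
      · exact ⟨e1, h1⟩
      · exact ⟨e2, h2⟩
      · exact hr p hp
    · intro e' he'
      simp only [Set.mem_insert_iff] at he'
      rcases he' with rfl | rfl | he'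
      · simp [h1]
      · simp [h2]
      · simp [hF e' he']
    · intro w hw
      rcases hw with rfl | hw
      · refine ⟨e1, e2, ?_, by simp [h1], by simp [h2]⟩
        rintro rfl
        rw [h1, Sym2.eq_iff] at h2
        grind
      · exact hd w hw

lemma final (G : Multigraph) (hG : G.HasSpanningTriangleTree)
    (h3 : {v : G.V | G.degree v = 3}.ncard ≤ 3) : G.HasNZ3Flow := by
  obtain ⟨F, hF⟩ := hG
  obtain ⟨⟨P, hP, hr, -⟩, hd⟩ := tt_aux G hF
  have hD : ∀ e, ∃ p : G.V × G.V, G.ends e = s(p.1, p.2) := by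
    intro e
    induction h : G.ends e with
    | _ a b => exact ⟨(a, b), rfl⟩
  choose D hD using hD
  have hdeg : ∀ x, deg D Finset.univ x = G.degree x := by
    intro x
    unfold deg Multigraph.degree
    rw [Set.ncard_eq_toFinset_card']
    congr 1
    ext e
    simp [pr, hD]
  have hflow : Flow D Finset.univ := by
    have hP2 : ET (Finset.univ : Finset G.V) P := by
      convert hP using 1
      ext x
      simp
    refine main_aux _ Finset.univ P D Finset.univ rfl hP2 ?_ ?_ ?_
    · intro e _
      refine ⟨?_, by simp, by simp⟩
      have := G.loopless e
      rw [hD e] at this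
      simpa using this
    · intro p hp
      obtain ⟨e, he⟩ := hr p hp
      exact ⟨e, Finset.mem_univ _, by rw [pr, ← hD, he]⟩
    · have : ∀ x, om (deg D Finset.univ x) = if G.degree x = 3 then 1 else 0 := by
        intro x
        rw [hdeg]
        obtain ⟨e, e', hne, h1, h2⟩ := hd x (Set.mem_univ x)
        have h2 : 1 < G.degree x := by
          unfold Multigraph.degree
          rw [Set.one_lt_ncard]
          exact ⟨e, h1, e', h2, hne⟩
        unfold om
        grind
      simp only [this]
      rw [Set.ncard_eq_toFinset_card'] at h3
      simpa [Finset.sum_boole] using h3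
  obtain ⟨g, hg, hex⟩ := tutte D hflow
  refine ⟨D, g, hD, hg, fun x => ?_⟩
  have := hex x
  unfold exc at this
  simp only [mul_sub, Finset.sum_sub_distrib, mul_ite, mul_one, mul_zero] at this
  linarith

end TT

/-- Every graph with a spanning triangle-tree and at most three
vertices of degree 3 admits a nowhere-zero 3-flow. -/
theorem stmt_1 (G : Multigraph) (hG : G.HasSpanningTriangleTree)
    (h3 : {v : G.V | G.degree v = 3}.ncard ≤ 3) :
    G.HasNZ3Flow := by
  exact TT.final G hG h3
end

section
/- Every finite loopless graph (parallel edges allowed) containing two edge-disjoint spanning triangle-trees has flow index strictly less than 3; that is, there exist integers t ≥ 2s > 0 with t/s < 3 such that G admits a circular t/s-flow. -/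
open scoped Classical

namespace TTF

variable {G : Multigraph}

/-- mod 3 boundary of an arc -/
noncomputable def d (p : G.V × G.V) : G.V → ZMod 3 := Pi.single p.1 1 - Pi.single p.2 1

noncomputable def bd (D : G.E → G.V × G.V) (F : Finset G.E) : G.V → ZMod 3 := ∑ e ∈ F, d (D e)

def OrOn (D : G.E → G.V × G.V) (F : Finset G.E) : Prop :=
  ∀ e ∈ F, G.ends e = s((D e).1, (D e).2)

def Rl (F : Finset G.E) (β : G.V → ZMod 3) : Prop := ∃ D, OrOn D F ∧ bd D F = β

def StrOn (D : G.E → G.V × G.V) (S : Finset G.V) (F : Finset G.E) : Prop :=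
  ∀ x ∈ S, ∀ y ∈ S, Relation.ReflTransGen (fun x y => ∃ e ∈ F, D e = (x, y)) x y

noncomputable def dot (c β : G.V → ZMod 3) : ZMod 3 := ∑ v, c v * β v

noncomputable def deg (F : Finset G.E) (v : G.V) : ℕ := (F.filter (fun e => v ∈ G.ends e)).card

inductive TT (G : Multigraph) : Finset G.V → Finset G.E → Prop
  | base (x y z : G.V) (e1 e2 e3 : G.E)
      (hxy : x ≠ y) (hxz : x ≠ z) (hyz : y ≠ z)
      (h1 : G.ends e1 = s(x, y)) (h2 : G.ends e2 = s(y, z)) (h3 : G.ends e3 = s(x, z))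
      (h12 : e1 ≠ e2) (h13 : e1 ≠ e3) (h23 : e2 ≠ e3) :
      TT G {x, y, z} {e1, e2, e3}
  | grow (S : Finset G.V) (F : Finset G.E) (hT : TT G S F)
      (z p q : G.V) (hz : z ∉ S) (hp : p ∈ S) (hq : q ∈ S) (hpq : p ≠ q)
      (e : G.E) (he : e ∈ F) (hee : G.ends e = s(p, q))
      (e1 e2 : G.E) (h1F : e1 ∉ F) (h2F : e2 ∉ F) (h12 : e1 ≠ e2)
      (h1 : G.ends e1 = s(z, p)) (h2 : G.ends e2 = s(z, q)) :
      TT G (insert z S) (insert e1 (insert e2 F))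

theorem ne_of_ends {e : G.E} {x y : G.V} (h : G.ends e = s(x, y)) : x ≠ y := by
  intro hxy
  apply G.loopless e
  rw [h]; simpa using hxy

theorem TT.ends_mem {S F} (h : TT G S F) : ∀ e ∈ F, ∀ v ∈ G.ends e, v ∈ S := by
  induction h with
  | base x y z e1 e2 e3 hxy hxz hyz h1 h2 h3 =>
    intro e he v hv
    simp only [Finset.mem_insert, Finset.mem_singleton] at he
    rcases he with rfl | rfl | rfl <;> simp_all <;> tauto
  | grow S F hT z p q hz hp hq hpq e he hee e1 e2 h1F h2F h12 h1 h2 ih =>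
    intro e' he' v hv
    simp only [Finset.mem_insert] at he'
    rcases he' with rfl | rfl | h'
    · rw [h1, Sym2.mem_iff] at hv
      rcases hv with rfl | rfl <;> simp_all
    · rw [h2, Sym2.mem_iff] at hv
      rcases hv with rfl | rfl <;> simp_all
    · exact Finset.mem_insert_of_mem (ih e' h' v hv)

theorem conv {S : Set G.V} {F : Set G.E} (h : G.IsTriangleTree S F) : TT G S.toFinset F.toFinset := by
  induction h with
  | base x y z e1 e2 e3 hxy hxz hyz h1 h2 h3 =>
    have := TT.base x y z e1 e2 e3 hxy hxz hyz h1 h2 h3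
      (by rintro rfl; rw [h1] at h2; simp at h2; tauto)
      (by rintro rfl; rw [h1] at h3; simp at h3; tauto)
      (by rintro rfl; rw [h2] at h3; simp at h3; tauto)
    convert this using 1 <;> (ext; simp)
  | grow S F hT z p q hz e he hee e1 e2 h1 h2 ih =>
    have hm := ih.ends_mem
    have hp : p ∈ S.toFinset := hm e (by simpa using he) p (by rw [hee]; simp)
    have hq : q ∈ S.toFinset := hm e (by simpa using he) q (by rw [hee]; simp)
    have hz' : z ∉ S.toFinset := by simpa using hz
    have hpq := ne_of_ends hee
    have := TT.grow S.toFinset F.toFinset ih z p q hz' hp hq hpq e (by simpa using he) hee e1 e2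
      (fun h' => hz' (hm e1 h' z (by rw [h1]; simp)))
      (fun h' => hz' (hm e2 h' z (by rw [h2]; simp)))
      (by rintro rfl; rw [h1] at h2; simp at h2; grind) h1 h2
    convert this using 1 <;> (ext; simp)

/-! degrees -/

theorem deg_insert {F : Finset G.E} {e : G.E} (he : e ∉ F) {x y : G.V} (h : G.ends e = s(x, y)) (v : G.V) :
    deg (insert e F) v = deg F v + if v = x ∨ v = y then 1 else 0 := by
  unfold deg
  rw [Finset.filter_insert, h]
  simp only [Sym2.mem_iff]
  split_ifs with hv
  · rw [Finset.card_insert_of_notMem (by simp [he])]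
  · simp

theorem deg_empty (v : G.V) : deg (∅ : Finset G.E) v = 0 := by simp [deg]

theorem deg_disj {A B : Finset G.E} (h : Disjoint A B) (v : G.V) :
    deg (A ∪ B) v = deg A v + deg B v := by
  unfold deg
  rw [Finset.filter_union, Finset.card_union_of_disjoint]
  exact Finset.disjoint_filter_filter h

theorem deg_zero {S F} (h : TT G S F) {z : G.V} (hz : z ∉ S) : deg F z = 0 := by
  unfold deg
  rw [Finset.card_eq_zero, Finset.filter_eq_empty_iff]
  intro e he hv
  exact hz (h.ends_mem e he z hv)

theorem deg_grow {F : Finset G.E} {z p q : G.V} {e1 e2 : G.E} (h1F : e1 ∉ F) (h2F : e2 ∉ F) (h12 : e1 ≠ e2)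
    (h1 : G.ends e1 = s(z, p)) (h2 : G.ends e2 = s(z, q)) (hpq : p ≠ q) (v : G.V) :
    deg (insert e1 (insert e2 F)) v =
      deg F v + (if v = z then 2 else if v = p ∨ v = q then 1 else 0) := by
  have hzp := ne_of_ends h1
  have hzq := ne_of_ends h2
  rw [deg_insert (by simp [h12, h1F]) h1, deg_insert h2F h2]
  by_cases a : v = z
  · subst a; simp
  · by_cases b : v = p
    · subst b; simp [a, hpq]
    · simp [a, b]

theorem TT.two_le {S F} (h : TT G S F) : ∀ v ∈ S, 2 ≤ deg F v := by
  induction h with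
  | base x y z e1 e2 e3 hxy hxz hyz h1 h2 h3 h12 h13 h23 =>
    intro v hv
    rw [deg_insert (by simp [h12, h13]) h1, deg_insert (by simp [h23]) h2,
      ← insert_empty_eq, deg_insert (by simp) h3]
    simp only [Finset.mem_insert, Finset.mem_singleton] at hv
    rcases hv with rfl | rfl | rfl <;> simp_all <;> omega
  | grow S F hT z p q hz hp hq hpq e he hee e1 e2 h1F h2F h12 h1 h2 ih =>
    intro v hv
    rw [deg_grow h1F h2F h12 h1 h2 hpq]
    rcases Finset.mem_insert.1 hv with rfl | hv
    · simp
    · have := ih v hv; omega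

theorem TT.three_le {S F} (h : TT G S F) : 3 ≤ S.card := by
  induction h with
  | base x y z e1 e2 e3 hxy hxz hyz h1 h2 h3 h12 h13 h23 =>
    rw [Finset.card_eq_three.2 ⟨x, y, z, hxy, hxz, hyz, rfl⟩]
  | grow S F hT z p q hz hp hq hpq e he hee e1 e2 h1F h2F h12 h1 h2 ih =>
    rw [Finset.card_insert_of_notMem hz]; omega

theorem TT.deg_three {S F} (h : TT G S F) (hc : S.card = 3) : ∀ v ∈ S, deg F v = 2 := by
  cases h with
  | base x y z e1 e2 e3 hxy hxz hyz h1 h2 h3 h12 h13 h23 =>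
    intro v hv
    rw [deg_insert (by simp [h12, h13]) h1, deg_insert (by simp [h23]) h2,
      ← insert_empty_eq, deg_insert (by simp) h3, deg_empty]
    simp only [Finset.mem_insert, Finset.mem_singleton] at hv
    rcases hv with rfl | rfl | rfl <;> simp_all [eq_comm]
  | grow S F hT z p q hz hp hq hpq e he hee e1 e2 h1F h2F h12 h1 h2 =>
    rw [Finset.card_insert_of_notMem hz] at hc
    have := hT.three_le; omega

theorem four_not {S : Finset G.V} (hc : S.card = 3) {a b c x : G.V} (ha : a ∈ S) (hb : b ∈ S) (hcc : c ∈ S)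
    (hx : x ∈ S) (hab : a ≠ b) (hac : a ≠ c) (hbc : b ≠ c) (h1 : x ≠ a) (h2 : x ≠ b) (h3 : x ≠ c) : False := by
  have h4 : ({x, a, b, c} : Finset G.V).card = 4 := by
    rw [Finset.card_insert_of_notMem (by simp [h1, h2, h3]),
      Finset.card_eq_three.2 ⟨a, b, c, hab, hac, hbc, rfl⟩]
  have : ({x, a, b, c} : Finset G.V) ⊆ S := by
    intro t ht
    simp only [Finset.mem_insert, Finset.mem_singleton] at ht
    rcases ht with rfl | rfl | rfl | rfl <;> assumption
  have := Finset.card_le_card this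
  omega

theorem TT.adj_two {S F} (h : TT G S F) : ∀ e ∈ F, ∀ p q, G.ends e = s(p, q) → deg F p = 2 →
    deg F q = 2 → S.card = 3 := by
  induction h with
  | base x y z e1 e2 e3 hxy hxz hyz h1 h2 h3 h12 h13 h23 =>
    intros
    rw [Finset.card_eq_three.2 ⟨x, y, z, hxy, hxz, hyz, rfl⟩]
  | grow S F hT z p0 q0 hz hp hq hpq e he hee e1 e2 h1F h2F h12 h1 h2 ih =>
    intro e' he' p q hpq' dp dq
    exfalso
    have hd := deg_grow h1F h2F h12 h1 h2 hpq
    have hp0 : 3 ≤ deg (insert e1 (insert e2 F)) p0 := by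
      rw [hd, if_neg (ne_of_ends h1).symm]; have := hT.two_le p0 hp; simp; omega
    have hq0 : 3 ≤ deg (insert e1 (insert e2 F)) q0 := by
      rw [hd, if_neg (ne_of_ends h2).symm]; have := hT.two_le q0 hq; simp; omega
    have npp : p ≠ p0 := by rintro rfl; omega
    have npq : p ≠ q0 := by rintro rfl; omega
    have nqp : q ≠ p0 := by rintro rfl; omega
    have nqq : q ≠ q0 := by rintro rfl; omega
    rcases Finset.mem_insert.1 he' with rfl | he'
    · rw [h1] at hpq'; simp at hpq'; grind
    rcases Finset.mem_insert.1 he' with rfl | he'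
    · rw [h2] at hpq'; simp at hpq'; grind
    have hpS := hT.ends_mem e' he' p (by rw [hpq']; simp)
    have hqS := hT.ends_mem e' he' q (by rw [hpq']; simp)
    have hzp : p ≠ z := by rintro rfl; exact hz hpS
    have hzq : q ≠ z := by rintro rfl; exact hz hqS
    rw [hd] at dp dq
    simp [hzp, hzq, npp, npq, nqp, nqq] at dp dq
    have := ih e' he' p q hpq' dp dq
    exact four_not this hp hq hpS hqS hpq npp.symm npq.symm nqp nqq (ne_of_ends hpq').symm

/-- structural lemma -/
theorem TT.struct {S F} (h : TT G S F) (c : G.V → ZMod 3) (k : ZMod 3) :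
    (∀ e ∈ F, ∀ x y, G.ends e = s(x, y) → c x ≠ c y) →
    (∀ u ∈ S, c u ≠ k → deg F u ≤ 3) →
    (∃ a ∈ S, ∃ b ∈ S, a ≠ b ∧ c a = k ∧ c b = k) →
    S.card = 4 ∧ ∀ u ∈ S, c u ≠ k → deg F u = 3 := by
  induction h with
  | base x y z e1 e2 e3 hxy hxz hyz h1 h2 h3 h12 h13 h23 =>
    intro hc _ hab
    exfalso
    have := hc e1 (by simp) _ _ h1
    have := hc e2 (by simp) _ _ h2
    have := hc e3 (by simp) _ _ h3
    obtain ⟨a, ha, b, hb, hab, hca, hcb⟩ := hab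
    simp only [Finset.mem_insert, Finset.mem_singleton] at ha hb
    grind
  | grow S F hT z p q hz hp hq hpq e he hee e1 e2 h1F h2F h12 h1 h2 ih =>
    intro hc hdeg hab
    have hd := deg_grow h1F h2F h12 h1 h2 hpq
    have hcpq := hc e (by simp [he]) p q hee
    have nzp := (ne_of_ends h1).symm
    have nzq := (ne_of_ends h2).symm
    have hdp : c p ≠ k → deg F p = 2 := by
      intro hk
      have a1 := hdeg p (by simp [hp]) hk
      have a2 := hT.two_le p hp
      rw [hd, if_neg nzp] at a1; simp at a1; omega
    have hdq : c q ≠ k → deg F q = 2 := by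
      intro hk
      have a1 := hdeg q (by simp [hq]) hk
      have a2 := hT.two_le q hq
      rw [hd, if_neg nzq] at a1; simp at a1; omega
    by_cases hS : ∃ a ∈ S, ∃ b ∈ S, a ≠ b ∧ c a = k ∧ c b = k
    · exfalso
      have := ih (fun e he => hc e (by simp [he])) (fun u hu hk => by
        have := hdeg u (by simp [hu]) hk
        rw [hd] at this; omega) hS
      by_cases hk : c p = k
      · have hk' : c q ≠ k := fun h => hcpq (hk.trans h.symm)
        have a1 := this.2 q hq hk'
        have a2 := hdq hk'
        omega
      · have a1 := this.2 p hp hk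
        have a2 := hdp hk
        omega
    · have hcz1 := hc e1 (by simp) _ _ h1
      have hcz2 := hc e2 (by simp) _ _ h2
      have key : c z = k ∧ ∃ a ∈ S, c a = k := by
        obtain ⟨a, ha, b, hb, hab, hca, hcb⟩ := hab
        rcases Finset.mem_insert.1 ha with ha' | ha'
        · rcases Finset.mem_insert.1 hb with hb' | hb'
          · exact absurd (ha'.trans hb'.symm) hab
          · exact ⟨ha' ▸ hca, b, hb', hcb⟩
        · rcases Finset.mem_insert.1 hb with hb' | hb'
          · exact ⟨hb' ▸ hcb, a, ha', hca⟩
          · exact absurd ⟨a, ha', b, hb', hab, hca, hcb⟩ hS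
      obtain ⟨hcz, a, ha, hca⟩ := key
      have kp : c p ≠ k := fun h => hcz1 (hcz.trans h.symm)
      have kq : c q ≠ k := fun h => hcz2 (hcz.trans h.symm)
      have dp := hdp kp
      have dq := hdq kq
      have c3 := hT.adj_two e he p q hee dp dq
      refine ⟨by rw [Finset.card_insert_of_notMem hz, c3], ?_⟩
      intro u hu hk
      have uz : u ≠ z := by rintro rfl; exact hk hcz
      have hu' : u ∈ S := by simpa [uz] using hu
      by_cases up : u = p
      · subst up; rw [hd, if_neg uz, dp]; simp
      by_cases uq : u = q
      · subst uq; rw [hd, if_neg uz, dq]; simp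
      exfalso
      exact four_not c3 hp hq ha hu' hpq (by rintro rfl; exact kp hca) (by rintro rfl; exact kq hca)
        up uq (by rintro rfl; exact hk hca)

/-! mod 3 realisation -/

theorem dot_add (c a b : G.V → ZMod 3) : dot c (a + b) = dot c a + dot c b := by
  simp [dot, mul_add, Finset.sum_add_distrib]

theorem dot_neg (c a : G.V → ZMod 3) : dot c (-a) = - dot c a := by
  simp [dot]

theorem dot_sub (c a b : G.V → ZMod 3) : dot c (a - b) = dot c a - dot c b := by
  rw [sub_eq_add_neg, dot_add, dot_neg, sub_eq_add_neg]

theorem dot_d (c : G.V → ZMod 3) (x y : G.V) : dot c (d (x, y)) = c x - c y := by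
  simp [dot, d, mul_sub, Finset.sum_sub_distrib, Pi.single_apply]

theorem dot_one (β : G.V → ZMod 3) : dot (fun _ => 1) β = ∑ v, β v := by simp [dot]

theorem d_apply (x y v : G.V) : (d (x, y) : G.V → ZMod 3) v = (if v = x then 1 else 0) - (if v = y then 1 else 0) := by
  simp [d, Pi.single_apply]

theorem bd_congr {D D' : G.E → G.V × G.V} {F : Finset G.E} (h : ∀ e ∈ F, D e = D' e) : bd D F = bd D' F :=
  Finset.sum_congr rfl (fun e he => by rw [h e he])

theorem bd_insert (D : G.E → G.V × G.V) {F : Finset G.E} {e : G.E} (he : e ∉ F) :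
    bd D (insert e F) = d (D e) + bd D F := Finset.sum_insert he

theorem bd_union (D : G.E → G.V × G.V) {A B : Finset G.E} (h : Disjoint A B) :
    bd D (A ∪ B) = bd D A + bd D B := Finset.sum_union h

theorem sum_bd (D : G.E → G.V × G.V) (F : Finset G.E) : ∑ v, bd D F v = 0 := by
  rw [← dot_one]
  induction F using Finset.induction_on with
  | empty => simp [bd, dot]
  | insert e F he ih => rw [bd_insert D he, dot_add, ih, ← Prod.mk.eta (p := D e), dot_d]; simp

/-- extend an orientation by one arc -/
theorem ext_or {D : G.E → G.V × G.V} {F : Finset G.E} (hD : OrOn D F) {e : G.E} (he : e ∉ F) {x y : G.V}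
    (h : G.ends e = s(x, y)) : ∃ D', OrOn D' (insert e F) ∧ D' e = (x, y) ∧ (∀ f ∈ F, D' f = D f) ∧
      bd D' (insert e F) = d (x, y) + bd D F := by
  have hF : ∀ f ∈ F, Function.update D e (x, y) f = D f := by
    intro f hf
    rw [Function.update_of_ne]
    rintro rfl; exact he hf
  refine ⟨Function.update D e (x, y), ?_, by simp, hF, ?_⟩
  · intro f hf
    rcases Finset.mem_insert.1 hf with rfl | hf
    · simp [h]
    · rw [hF f hf]; exact hD f hf
  · rw [bd_insert _ he, bd_congr hF]; simp

theorem Rl_insert {F : Finset G.E} {β : G.V → ZMod 3} (h : Rl F β) {e : G.E} (he : e ∉ F) {x y : G.V}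
    (hxy : G.ends e = s(x, y)) : Rl (insert e F) (d (x, y) + β) := by
  obtain ⟨D, hD, hb⟩ := h
  obtain ⟨D', h1, -, -, h4⟩ := ext_or hD he hxy
  exact ⟨D', h1, by rw [h4, hb]⟩

def Adm (S : Finset G.V) (β : G.V → ZMod 3) : Prop := (∀ v, v ∉ S → β v = 0) ∧ ∑ v, β v = 0

def Good (S : Finset G.V) (F : Finset G.E) (c : G.V → ZMod 3) : Prop :=
  ∀ β, Adm S β → dot c β ≠ 0 → Rl F β

theorem z3 (a : ZMod 3) : a = 0 ∨ a = 1 ∨ a = -1 := by revert a; decide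

theorem good_edge {x y : G.V} {e : G.E} (h : G.ends e = s(x, y)) (c : G.V → ZMod 3) :
    Good {x, y} {e} c := by
  intro β hβ hd
  have hxy := ne_of_ends h
  have hb : β = fun v => β x * d (x, y) v := by
    have hs : β x + β y = 0 := by
      rw [← hβ.2, ← Finset.sum_pair hxy]
      apply Finset.sum_subset (Finset.subset_univ _)
      intro v _ hv; exact hβ.1 v hv
    funext v
    rw [d_apply]
    by_cases hx : v = x
    · subst hx; simp [hxy]
    by_cases hy : v = y
    · subst hy; simp [hx]; linear_combination hs
    · simp [hx, hy, hβ.1 v (by simp [hx, hy])]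
  have hemp : Rl (∅ : Finset G.E) 0 := ⟨fun _ => (x, x), by simp [OrOn], by simp [bd]⟩
  rcases z3 (β x) with h0 | h0 | h0
  · exfalso; apply hd; rw [hb, h0]; simp [dot]
  · have := Rl_insert hemp (Finset.notMem_empty e) h
    rw [insert_empty_eq] at this
    convert this using 1
    rw [hb, h0]; funext v; simp
  · have := Rl_insert hemp (Finset.notMem_empty e) (h.trans Sym2.eq_swap)
    rw [insert_empty_eq] at this
    convert this using 1
    rw [hb, h0]; funext v; simp [d_apply]

section grow
variable {S : Finset G.V} {F : Finset G.E} {z p q : G.V} {e1 e2 : G.E}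

theorem adm_sub {β : G.V → ZMod 3} (hβ : Adm (insert z S) β) (hp : p ∈ S) (hq : q ∈ S) {a b : G.V × G.V}
    (ha : a = (z, p) ∨ a = (p, z)) (hb : b = (z, q) ∨ b = (q, z)) (h0 : (β - d a - d b) z = 0) :
    Adm S (β - d a - d b) := by
  constructor
  · intro v hv
    by_cases hz : v = z
    · subst hz; exact h0
    · have hvp : v ≠ p := by rintro rfl; exact hv hp
      have hvq : v ≠ q := by rintro rfl; exact hv hq
      have := hβ.1 v (by simp [hz, hv])
      rcases ha with rfl | rfl <;> rcases hb with rfl | rfl <;> simp [d_apply, hz, hvp, hvq, this]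
  · rw [← dot_one, dot_sub, dot_sub, dot_one, hβ.2]
    rcases ha with rfl | rfl <;> rcases hb with rfl | rfl <;> simp [dot_d]

theorem rl_add {β : G.V → ZMod 3} (h1F : e1 ∉ F) (h2F : e2 ∉ F) (h12 : e1 ≠ e2)
    (h1 : G.ends e1 = s(z, p)) (h2 : G.ends e2 = s(z, q)) {a b : G.V × G.V}
    (ha : a = (z, p) ∨ a = (p, z)) (hb : b = (z, q) ∨ b = (q, z)) (h : Rl F (β - d a - d b)) :
    Rl (insert e1 (insert e2 F)) β := by
  have hA : G.ends e1 = s(a.1, a.2) := by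
    rcases ha with rfl | rfl
    · exact h1
    · exact h1.trans Sym2.eq_swap
  have hB : G.ends e2 = s(b.1, b.2) := by
    rcases hb with rfl | rfl
    · exact h2
    · exact h2.trans Sym2.eq_swap
  have := Rl_insert (Rl_insert h h2F hB) (by simp [h12, h1F] : e1 ∉ insert e2 F) hA
  convert this using 1
  simp

/-- the step when `β z ≠ 0`. -/
theorem step_ne {β : G.V → ZMod 3} (hβ : Adm (insert z S) β) (hz : z ∉ S) (hp : p ∈ S) (hq : q ∈ S)
    (h1F : e1 ∉ F) (h2F : e2 ∉ F) (h12 : e1 ≠ e2)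
    (h1 : G.ends e1 = s(z, p)) (h2 : G.ends e2 = s(z, q)) (h0 : β z ≠ 0) :
    ∃ β', Adm S β' ∧ (∀ v, v ≠ z → v ≠ p → v ≠ q → β' v = β v) ∧
      (∀ c : G.V → ZMod 3, c z + c p + c q = 0 → dot c β' = dot c β) ∧
      (Rl F β' → Rl (insert e1 (insert e2 F)) β) := by
  have zp := ne_of_ends h1
  have zq := ne_of_ends h2
  rcases z3 (β z) with h | h | h
  · exact absurd h h0
  · refine ⟨β - d (p, z) - d (q, z), adm_sub hβ hp hq (Or.inr rfl) (Or.inr rfl) ?_, ?_, ?_,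
      rl_add h1F h2F h12 h1 h2 (Or.inr rfl) (Or.inr rfl)⟩
    · simp [d_apply, zp, zq, h]; decide
    · intro v a b c; simp [d_apply, a, b, c]
    · intro c hc; simp only [dot_sub, dot_d]
      have : (3 : ZMod 3) = 0 := by decide
      linear_combination (-1) * hc + c z * this
  · refine ⟨β - d (z, p) - d (z, q), adm_sub hβ hp hq (Or.inl rfl) (Or.inl rfl) ?_, ?_, ?_,
      rl_add h1F h2F h12 h1 h2 (Or.inl rfl) (Or.inl rfl)⟩
    · simp [d_apply, zp, zq, h]; decide
    · intro v a b c; simp [d_apply, a, b, c]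
    · intro c hc; simp only [dot_sub, dot_d]
      have : (3 : ZMod 3) = 0 := by decide
      linear_combination hc - c z * this

theorem step_zero {β : G.V → ZMod 3} (hβ : Adm (insert z S) β) (hp : p ∈ S) (hq : q ∈ S)
    (h1F : e1 ∉ F) (h2F : e2 ∉ F) (h12 : e1 ≠ e2)
    (h1 : G.ends e1 = s(z, p)) (h2 : G.ends e2 = s(z, q)) (h0 : β z = 0)
    {c : G.V → ZMod 3} (hg : Good S F c) (hc : c p ≠ c q) : Rl (insert e1 (insert e2 F)) β := by
  have zp := ne_of_ends h1
  have zq := ne_of_ends h2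
  by_cases h : dot c (β - d (p, z) - d (z, q)) = 0
  · apply rl_add h1F h2F h12 h1 h2 (a := (z, p)) (b := (q, z)) (Or.inl rfl) (Or.inr rfl)
    apply hg
    · apply adm_sub hβ hp hq (Or.inl rfl) (Or.inr rfl)
      simp [d_apply, zp, zq, h0]
    · simp only [dot_sub, dot_d] at h ⊢
      intro h'
      apply hc
      have : (3 : ZMod 3) = 0 := by decide
      linear_combination h - h' + (c p - c q) * this
  · apply rl_add h1F h2F h12 h1 h2 (a := (p, z)) (b := (z, q)) (Or.inr rfl) (Or.inl rfl)
    apply hg _ _ h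
    apply adm_sub hβ hp hq (Or.inr rfl) (Or.inl rfl)
    simp [d_apply, zp, zq, h0]

theorem good_grow (hz : z ∉ S) (hp : p ∈ S) (hq : q ∈ S)
    (h1F : e1 ∉ F) (h2F : e2 ∉ F) (h12 : e1 ≠ e2)
    (h1 : G.ends e1 = s(z, p)) (h2 : G.ends e2 = s(z, q))
    {c : G.V → ZMod 3} (hg : Good S F c) (hc : c p ≠ c q) (hcz : c z + c p + c q = 0) :
    Good (insert z S) (insert e1 (insert e2 F)) c := by
  intro β hβ hd
  by_cases h0 : β z = 0
  · exact step_zero hβ hp hq h1F h2F h12 h1 h2 h0 hg hc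
  · obtain ⟨β', a, -, b, r⟩ := step_ne hβ hz hp hq h1F h2F h12 h1 h2 h0
    exact r (hg β' a (by rwa [b c hcz]))

end grow

theorem third {a b : ZMod 3} (h : a ≠ b) : -a - b ≠ a ∧ -a - b ≠ b := by revert a b; decide

theorem good_congr {S : Finset G.V} {F : Finset G.E} {c c' : G.V → ZMod 3} (h : ∀ v ∈ S, c v = c' v)
    (hg : Good S F c) : Good S F c' := by
  intro β hβ hd
  apply hg β hβ
  convert hd using 1
  apply Finset.sum_congr rfl
  intro v _
  by_cases hv : v ∈ S
  · rw [h v hv]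
  · rw [hβ.1 v hv]; simp

theorem TT.good {S F} (h : TT G S F) : ∃ c : G.V → ZMod 3,
    (∀ e ∈ F, ∀ x y, G.ends e = s(x, y) → c x ≠ c y) ∧ Good S F c ∧
    (∀ v ∈ S, deg F v = 2 → ∀ β, Adm S β → β v = 0 → Rl F β) := by
  induction h with
  | base x y z e1 e2 e3 hxy hxz hyz h1 h2 h3 h12 h13 h23 =>
    let c : G.V → ZMod 3 := fun v => if v = x then 0 else if v = y then 1 else 2
    have cx : c x = 0 := by simp [c]
    have cy : c y = 1 := by simp [c, hxy.symm]
    have cz : c z = 2 := by simp [c, hxz.symm, hyz.symm]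
    have h01 : (0 : ZMod 3) ≠ 1 := by decide
    have h02 : (0 : ZMod 3) ≠ 2 := by decide
    have h12' : (1 : ZMod 3) ≠ 2 := by decide
    have hx := good_edge h2 c
    have hy := good_edge h3 c
    have hz := good_edge h1 c
    refine ⟨c, ?_, ?_, ?_⟩
    · intro e he a b hab
      simp only [Finset.mem_insert, Finset.mem_singleton] at he
      rcases he with rfl | rfl | rfl
      · rw [h1, Sym2.eq_iff] at hab
        rcases hab with ⟨rfl, rfl⟩ | ⟨rfl, rfl⟩ <;> rw [cx, cy] <;> decide
      · rw [h2, Sym2.eq_iff] at hab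
        rcases hab with ⟨rfl, rfl⟩ | ⟨rfl, rfl⟩ <;> rw [cz, cy] <;> decide
      · rw [h3, Sym2.eq_iff] at hab
        rcases hab with ⟨rfl, rfl⟩ | ⟨rfl, rfl⟩ <;> rw [cx, cz] <;> decide
    · have := good_grow (z := x) (p := y) (q := z) (e1 := e1) (e2 := e3) (by simp [hxy, hxz])
        (by simp) (by simp) (by simp [h12]) (by simp [h23.symm]) h13 h1 h3 hx (by rw [cy, cz]; decide)
        (by rw [cx, cy, cz]; decide)
      rwa [Finset.pair_comm e3 e2] at this
    · intro v hv _ β hβ h0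
      simp only [Finset.mem_insert, Finset.mem_singleton] at hv
      rcases hv with rfl | rfl | rfl
      · have := step_zero (z := v) (p := y) (q := z) (e1 := e1) (e2 := e3) hβ
          (by simp) (by simp) (by simp [h12]) (by simp [h23.symm]) h13 h1 h3 h0 hx (by rw [cy, cz]; decide)
        rwa [Finset.pair_comm e3 e2] at this
      · rw [Finset.insert_comm] at hβ
        have := step_zero (z := v) (p := x) (q := z) (e1 := e1) (e2 := e2) hβ
          (by simp) (by simp) (by simp [h13]) (by simp [h23]) h12 (h1.trans Sym2.eq_swap) h2 h0 hy
          (by rw [cx, cz]; decide)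
        exact this
      · rw [Finset.pair_comm, Finset.insert_comm, Finset.pair_comm, Finset.insert_comm] at hβ
        have e : ({v, x, y} : Finset G.V) = insert v {x, y} := rfl
        have hβ' : Adm (insert v {x, y}) β := by
          convert hβ using 1
          ext; simp; tauto
        have := step_zero (z := v) (p := x) (q := y) (e1 := e3) (e2 := e2) hβ'
          (by simp) (by simp) (by simp [h13.symm]) (by simp [h12.symm]) h23.symm (h3.trans Sym2.eq_swap)
          (h2.trans Sym2.eq_swap) h0 hz
          (by rw [cx, cy]; decide)
        convert this using 1
        ext; simp; tauto
  | grow S F hT z p q hz hp hq hpq e he hee e1 e2 h1F h2F h12 h1 h2 ih =>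
    obtain ⟨c0, hc0, hg0, hl⟩ := ih
    have hpq0 := hc0 e he p q hee
    have nS : ∀ v ∈ S, v ≠ z := by rintro v hv rfl; exact hz hv
    let c := Function.update c0 z (-c0 p - c0 q)
    have hcS : ∀ v ∈ S, c v = c0 v := fun v hv => Function.update_of_ne (nS v hv) _ _
    have hcz : c z = -c0 p - c0 q := by simp [c]
    have hg : Good S F c := good_congr (fun v hv => (hcS v hv).symm) hg0
    have hne := third hpq0
    have hcpq : c p ≠ c q := by rw [hcS p hp, hcS q hq]; exact hpq0
    refine ⟨c, ?_, ?_, ?_⟩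
    · intro f hf x y hxy
      rcases Finset.mem_insert.1 hf with rfl | hf
      · rw [h1, Sym2.eq_iff] at hxy
        rcases hxy with ⟨rfl, rfl⟩ | ⟨rfl, rfl⟩
        · rw [hcz, hcS _ hp]; exact hne.1
        · rw [hcz, hcS _ hp]; exact hne.1.symm
      rcases Finset.mem_insert.1 hf with rfl | hf
      · rw [h2, Sym2.eq_iff] at hxy
        rcases hxy with ⟨rfl, rfl⟩ | ⟨rfl, rfl⟩
        · rw [hcz, hcS _ hq]; exact hne.2
        · rw [hcz, hcS _ hq]; exact hne.2.symm
      rw [hcS x (hT.ends_mem f hf x (by rw [hxy]; simp)), hcS y (hT.ends_mem f hf y (by rw [hxy]; simp))]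
      exact hc0 f hf x y hxy
    · exact good_grow hz hp hq h1F h2F h12 h1 h2 hg hcpq (by rw [hcz, hcS p hp, hcS q hq]; ring)
    · intro v hv hdv β hβ h0
      by_cases hzz : β z = 0
      · exact step_zero hβ hp hq h1F h2F h12 h1 h2 hzz hg hcpq
      have hvz : v ≠ z := by rintro rfl; exact hzz h0
      have hvS : v ∈ S := by simpa [hvz] using hv
      rw [deg_grow h1F h2F h12 h1 h2 hpq, if_neg hvz] at hdv
      have := hT.two_le v hvS
      have hvpq : ¬ (v = p ∨ v = q) := by
        intro h; rw [if_pos h] at hdv; omega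
      rw [if_neg hvpq] at hdv
      obtain ⟨β', a, b, -, r⟩ := step_ne hβ hz hp hq h1F h2F h12 h1 h2 hzz
      push Not at hvpq
      exact r (hl v hvS hdv β' a (by rw [b v hvz hvpq.1 hvpq.2, h0]))

/-! from strongly connected mod 3 orientations to flows -/

theorem lift_flow (D : G.E → G.V × G.V) (hb : bd D Finset.univ = 0) :
    ∃ f : G.E → ℤ, (∀ e, f e = 1 ∨ f e = -2) ∧ G.IsConserving D f := by
  let ou : G.V → ℕ := fun v => ∑ e, if (D e).1 = v then 1 else 0
  let inn : G.V → ℕ := fun v => ∑ e, if (D e).2 = v then 1 else 0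
  have hdiv : ∀ v, 3 ∣ 2 * ou v + inn v := by
    intro v
    rw [← ZMod.natCast_eq_zero_iff]
    have h1 : bd D Finset.univ v = 0 := by rw [hb]; rfl
    have h2 : bd D Finset.univ v = (ou v : ZMod 3) - (inn v : ZMod 3) := by
      simp only [bd, Finset.sum_apply, ou, inn, Nat.cast_sum, ← Finset.sum_sub_distrib]
      apply Finset.sum_congr rfl
      intro e _
      rw [← Prod.mk.eta (p := D e), d_apply]
      simp [eq_comm]
    have h3 : (3 : ZMod 3) = 0 := by decide
    push_cast
    rw [h1] at h2
    linear_combination h2 + (ou v : ZMod 3) * h3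
  choose o ho using hdiv
  -- counting over vertex sets
  have hcount : ∀ S : Finset G.V, 3 * ∑ v ∈ S, o v =
      ∑ e, (2 * (if (D e).1 ∈ S then 1 else 0) + (if (D e).2 ∈ S then 1 else 0)) := by
    intro S
    rw [Finset.mul_sum, Finset.sum_congr rfl (fun v _ => (ho v).symm)]
    simp only [ou, inn, Finset.sum_add_distrib, ← Finset.mul_sum]
    rw [Finset.sum_comm, Finset.sum_comm (s := S)]
    simp
  let t : G.E → Finset (Σ _ : G.V, ℕ) := fun e =>
    (({(D e).1, (D e).2} : Finset G.V)).sigma (fun v => Finset.range (o v))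
  have hall : ∀ A : Finset G.E, A.card ≤ (A.biUnion t).card := by
    intro A
    let S : Finset G.V := A.biUnion (fun e => {(D e).1, (D e).2})
    have hS : A.biUnion t = S.sigma (fun v => Finset.range (o v)) := by
      ext ⟨v, i⟩
      simp only [t, S, Finset.mem_biUnion, Finset.mem_sigma]
      constructor
      · rintro ⟨e, he, h1, h2⟩; exact ⟨⟨e, he, h1⟩, h2⟩
      · rintro ⟨⟨e, he, h1⟩, h2⟩; exact ⟨e, he, h1, h2⟩
    rw [hS, Finset.card_sigma]
    simp only [Finset.card_range]
    have : 3 * A.card ≤ 3 * ∑ v ∈ S, o v := by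
      rw [hcount, Finset.card_eq_sum_ones, Finset.mul_sum]
      calc ∑ e ∈ A, 3 * 1 ≤ ∑ e ∈ A, (2 * (if (D e).1 ∈ S then 1 else 0) + (if (D e).2 ∈ S then 1 else 0)) := by
            apply Finset.sum_le_sum
            intro e he
            have a1 : (D e).1 ∈ S := Finset.mem_biUnion.2 ⟨e, he, by simp⟩
            have a2 : (D e).2 ∈ S := Finset.mem_biUnion.2 ⟨e, he, by simp⟩
            simp [a1, a2]
        _ ≤ _ := Finset.sum_le_sum_of_subset (Finset.subset_univ _)
    omega
  obtain ⟨g, hgi, hg⟩ := (Finset.all_card_le_biUnion_card_iff_exists_injective t).1 hall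
  have hle : ∀ v, (Finset.univ.filter (fun e => (g e).1 = v)).card ≤ o v := by
    intro v
    rw [← Finset.card_range (o v)]
    apply Finset.card_le_card_of_injOn (fun e => (g e).2)
    · intro e he
      simp at he
      have := hg e
      simp only [t, Finset.mem_sigma] at this
      have h2 := this.2
      rw [he] at h2
      simpa using h2
    · intro e he e' he' hee
      simp at he he'
      apply hgi
      exact Sigma.ext (he.trans he'.symm) (by simpa using hee)
  have htot : ∑ v, (Finset.univ.filter (fun e => (g e).1 = v)).card = ∑ v, o v := by
    have hfw := Finset.card_eq_sum_card_fiberwise (f := fun e => (g e).1)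
      (s := (Finset.univ : Finset G.E)) (t := (Finset.univ : Finset G.V)) (by intro e _; simp)
    rw [← hfw]
    have := hcount Finset.univ
    simp at this
    rw [Finset.card_univ]; omega
  have heq : ∀ v, (Finset.univ.filter (fun e => (g e).1 = v)).card = o v := by
    intro v
    exact (Finset.sum_eq_sum_iff_of_le (fun v _ => hle v)).1 htot v (Finset.mem_univ v)
  refine ⟨fun e => if (g e).1 = (D e).1 then 1 else -2, ?_, ?_⟩
  · intro e; dsimp only; split_ifs <;> simp
  · intro v
    have h1 : (3 * (o v : ℤ)) = 2 * ou v + inn v := by exact_mod_cast (ho v).symm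
    rw [← heq v, Finset.card_filter] at h1
    simp only [ou, inn] at h1
    push_cast at h1
    rw [Finset.mul_sum, Finset.mul_sum, ← Finset.sum_add_distrib] at h1
    rw [← sub_eq_zero] at h1 ⊢
    rw [← Finset.sum_sub_distrib] at h1 ⊢
    refine Eq.trans ?_ h1
    apply Finset.sum_congr rfl
    intro e _
    have := hg e
    simp only [t, Finset.mem_sigma, Finset.mem_insert, Finset.mem_singleton] at this
    rcases this.1 with h | h
    · rw [h]; simp only [if_true]; split_ifs <;> norm_num
    · by_cases h' : (D e).2 = (D e).1
      · rw [h, h']; simp only [if_true]; split_ifs <;> norm_num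
      · have hgd : ¬ (g e).1 = (D e).1 := by rw [h]; exact h'
        simp only [hgd, if_false]
        rw [h]
        split_ifs <;> norm_num

theorem path_flow (D : G.E → G.V × G.V) {F : Finset G.E} {x y : G.V}
    (h : Relation.ReflTransGen (fun x y => ∃ e ∈ F, D e = (x, y)) x y) :
    ∃ f : G.E → ℤ, (∀ e, 0 ≤ f e) ∧ ∀ v, (∑ e, if (D e).1 = v then f e else 0) -
      (∑ e, if (D e).2 = v then f e else 0) = (if x = v then 1 else 0) - (if y = v then 1 else 0) := by
  induction h with
  | refl => exact ⟨0, by simp, by simp⟩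
  | @tail b c _ hbc ih =>
    obtain ⟨f, hf, hv⟩ := ih
    obtain ⟨e0, -, he0⟩ := hbc
    refine ⟨fun e => f e + if e = e0 then 1 else 0, ?_, ?_⟩
    · intro e; have := hf e; dsimp only; split_ifs <;> omega
    · intro v
      have key : ∀ P : G.E → Prop, (∑ e, if P e then (f e + if e = e0 then 1 else 0) else 0) =
          (∑ e, if P e then f e else 0) + if P e0 then 1 else 0 := by
        intro P
        have hs1 : (if P e0 then (1 : ℤ) else 0) = ∑ e, if e = e0 then (if P e then 1 else 0) else 0 := by simp
        rw [hs1]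
        rw [← Finset.sum_add_distrib]
        apply Finset.sum_congr rfl
        intro e _
        split_ifs <;> simp
      rw [key (fun e => (D e).1 = v), key (fun e => (D e).2 = v), he0]
      have := hv v
      dsimp only
      linarith

theorem pos_flow (D : G.E → G.V × G.V) (hs : StrOn D Finset.univ Finset.univ) :
    ∃ f : G.E → ℤ, (∀ e, 1 ≤ f e) ∧ G.IsConserving D f := by
  have h : ∀ e0 : G.E, ∃ f : G.E → ℤ, (∀ e, 0 ≤ f e) ∧ 1 ≤ f e0 ∧ G.IsConserving D f := by
    intro e0
    obtain ⟨f, hf, hv⟩ := path_flow D (hs (D e0).2 (Finset.mem_univ _) (D e0).1 (Finset.mem_univ _))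
    refine ⟨fun e => f e + if e = e0 then 1 else 0, ?_, ?_, ?_⟩
    · intro e; have := hf e; dsimp only; split_ifs <;> omega
    · have := hf e0; simp; omega
    · intro v
      have key : ∀ P : G.E → Prop, (∑ e, if P e then (f e + if e = e0 then 1 else 0) else 0) =
          (∑ e, if P e then f e else 0) + if P e0 then 1 else 0 := by
        intro P
        have hs1 : (if P e0 then (1 : ℤ) else 0) = ∑ e, if e = e0 then (if P e then 1 else 0) else 0 := by simp
        rw [hs1]
        rw [← Finset.sum_add_distrib]
        apply Finset.sum_congr rfl
        intro e _
        split_ifs <;> simp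
      rw [key (fun e => (D e).1 = v), key (fun e => (D e).2 = v)]
      have := hv v
      linarith
  choose f h0 h1 hc using h
  refine ⟨fun e => ∑ e0, f e0 e, ?_, ?_⟩
  · intro e
    exact (h1 e).trans (Finset.single_le_sum (f := fun e0 => f e0 e) (fun e0 _ => h0 e0 e) (Finset.mem_univ e))
  · intro v
    have key : ∀ P : G.E → Prop, (∑ e, if P e then (∑ e0, f e0 e) else 0) =
        ∑ e0, ∑ e, if P e then f e0 e else 0 := by
      intro P
      rw [Finset.sum_comm]
      apply Finset.sum_congr rfl
      intro e _
      split_ifs <;> simp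
    dsimp only
    rw [key (fun e => (D e).1 = v), key (fun e => (D e).2 = v)]
    exact Finset.sum_congr rfl (fun e0 _ => hc e0 v)

theorem flow_of_strong (D : G.E → G.V × G.V) (hD : OrOn D Finset.univ)
    (hs : StrOn D Finset.univ Finset.univ) (hb : bd D Finset.univ = 0) :
    ∃ t s : ℤ, 0 < s ∧ 2 * s ≤ t ∧ t < 3 * s ∧ G.HasCircularFlow t s := by
  obtain ⟨f, hf, hfc⟩ := lift_flow D hb
  obtain ⟨g, hg, hgc⟩ := pos_flow D hs
  have hsum : ∀ e, g e ≤ ∑ e, g e := fun e =>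
    Finset.single_le_sum (f := g) (fun e _ => by have := hg e; omega) (Finset.mem_univ e)
  have hnn : 0 ≤ ∑ e, g e := Finset.sum_nonneg (fun e _ => by have := hg e; omega)
  obtain ⟨N, hN⟩ : ∃ N, N = (∑ e, g e) + 2 := ⟨_, rfl⟩
  refine ⟨3 * N, N + 1, by omega, by omega, by omega, D, fun e => N * f e + g e,
    fun e => hD e (Finset.mem_univ e), ?_, ?_⟩
  · intro e
    have a1 := hg e
    have a2 := hsum e
    rcases hf e with h | h
    · simp only [h]; rw [abs_of_nonneg (by omega)]; omega
    · simp only [h]; rw [abs_of_nonpos (by omega)]; omega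
  · intro v
    have key : ∀ P : G.E → Prop, (∑ e, if P e then (N * f e + g e) else 0) =
        N * (∑ e, if P e then f e else 0) + ∑ e, if P e then g e else 0 := by
      intro P
      rw [Finset.mul_sum, ← Finset.sum_add_distrib]
      apply Finset.sum_congr rfl
      intro e _
      split_ifs <;> simp
    dsimp only
    rw [key (fun e => (D e).1 = v), key (fun e => (D e).2 = v), hfc v, hgc v]

/-! strong orientations -/

theorem str_mono {D D' : G.E → G.V × G.V} {S : Finset G.V} {F F' : Finset G.E} (h : StrOn D S F)
    (hF : F ⊆ F') (hD : ∀ e ∈ F, D' e = D e) : StrOn D' S F' := by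
  intro x hx y hy
  have h' := h x hx y hy
  clear hy
  induction h' with
  | refl => exact .refl
  | tail _ hab ih =>
    obtain ⟨e, he, hab⟩ := hab
    exact ih.tail ⟨e, hF he, by rw [hD e he, hab]⟩

theorem str_hub {D : G.E → G.V × G.V} {S : Finset G.V} {F : Finset G.E} (r : G.V)
    (h1 : ∀ x ∈ S, Relation.ReflTransGen (fun x y => ∃ e ∈ F, D e = (x, y)) x r)
    (h2 : ∀ x ∈ S, Relation.ReflTransGen (fun x y => ∃ e ∈ F, D e = (x, y)) r x) : StrOn D S F :=
  fun x hx y hy => (h1 x hx).trans (h2 y hy)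

/-- grow a strong orientation along a path `p → z → q`. -/
theorem str_grow {D : G.E → G.V × G.V} {S : Finset G.V} {F : Finset G.E} (hD : OrOn D F) (h : StrOn D S F)
    {z p q : G.V} {e1 e2 : G.E} (hp : p ∈ S) (hq : q ∈ S)
    (h1F : e1 ∉ F) (h2F : e2 ∉ F) (h12 : e1 ≠ e2)
    (h1 : G.ends e1 = s(z, p)) (h2 : G.ends e2 = s(z, q)) :
    ∃ D', OrOn D' (insert e1 (insert e2 F)) ∧ StrOn D' (insert z S) (insert e1 (insert e2 F)) ∧
      bd D' (insert e1 (insert e2 F)) = d (p, q) + bd D F := by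
  obtain ⟨D1, o1, a1, b1, c1⟩ := ext_or hD h2F h2
  obtain ⟨D2, o2, a2, b2, c2⟩ := ext_or o1 (by simp [h12, h1F] : e1 ∉ insert e2 F) (h1.trans Sym2.eq_swap)
  have hF : ∀ e ∈ F, D2 e = D e := fun e he => by rw [b2 e (by simp [he]), b1 e he]
  have hs := str_mono h (F' := insert e1 (insert e2 F)) (by intro; simp; tauto) hF
  refine ⟨D2, o2, ?_, ?_⟩
  · apply str_hub p
    · intro x hx
      rcases Finset.mem_insert.1 hx with rfl | hx
      · exact (Relation.ReflTransGen.single ⟨e2, by simp, by rw [b2 e2 (by simp), a1]⟩).trans (hs q hq p hp)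
      · exact hs x hx p hp
    · intro x hx
      rcases Finset.mem_insert.1 hx with rfl | hx
      · exact Relation.ReflTransGen.single ⟨e1, by simp, a2⟩
      · exact hs p hp x hx
  · rw [c2, c1]; simp [d]; abel

/-- the same along `q → z → p`. -/
theorem str_grow' {D : G.E → G.V × G.V} {S : Finset G.V} {F : Finset G.E} (hD : OrOn D F) (h : StrOn D S F)
    {z p q : G.V} {e1 e2 : G.E} (hp : p ∈ S) (hq : q ∈ S)
    (h1F : e1 ∉ F) (h2F : e2 ∉ F) (h12 : e1 ≠ e2)
    (h1 : G.ends e1 = s(z, p)) (h2 : G.ends e2 = s(z, q)) :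
    ∃ D', OrOn D' (insert e1 (insert e2 F)) ∧ StrOn D' (insert z S) (insert e1 (insert e2 F)) ∧
      bd D' (insert e1 (insert e2 F)) = d (q, p) + bd D F := by
  have := str_grow hD h hq hp h2F h1F h12.symm h2 h1
  rwa [Finset.insert_comm] at this

theorem str_tri {x y z : G.V} {e1 e2 e3 : G.E}
      (h1 : G.ends e1 = s(x, y)) (h2 : G.ends e2 = s(y, z)) (h3 : G.ends e3 = s(x, z))
      (h12 : e1 ≠ e2) (h13 : e1 ≠ e3) (h23 : e2 ≠ e3) :
    ∃ D, OrOn D {e1, e2, e3} ∧ StrOn D {x, y, z} {e1, e2, e3} ∧ bd D {e1, e2, e3} = 0 := by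
  have h0 : OrOn (fun _ => (x, x)) (∅ : Finset G.E) := by simp [OrOn]
  obtain ⟨D1, o1, a1, b1, c1⟩ := ext_or h0 (Finset.notMem_empty e3) (h3.trans Sym2.eq_swap)
  obtain ⟨D2, o2, a2, b2, c2⟩ := ext_or o1 (by simp [h23] : e2 ∉ insert e3 ∅) h2
  obtain ⟨D3, o3, a3, b3, c3⟩ := ext_or o2 (by simp [h12, h13] : e1 ∉ insert e2 (insert e3 ∅)) h1
  rw [insert_empty_eq] at *
  have s1 : Relation.ReflTransGen (fun x y => ∃ e ∈ ({e1, e2, e3} : Finset G.E), D3 e = (x, y)) x y :=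
    .single ⟨e1, by simp, a3⟩
  have s2 : Relation.ReflTransGen (fun x y => ∃ e ∈ ({e1, e2, e3} : Finset G.E), D3 e = (x, y)) y z :=
    .single ⟨e2, by simp, by rw [b3 e2 (by simp), a2]⟩
  have s3 : Relation.ReflTransGen (fun x y => ∃ e ∈ ({e1, e2, e3} : Finset G.E), D3 e = (x, y)) z x :=
    .single ⟨e3, by simp, by rw [b3 e3 (by simp), b2 e3 (by simp), a1]⟩
  refine ⟨D3, o3, ?_, ?_⟩
  · apply str_hub x
    · intro v hv
      simp only [Finset.mem_insert, Finset.mem_singleton] at hv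
      rcases hv with rfl | rfl | rfl
      · exact .refl
      · exact s2.trans s3
      · exact s3
    · intro v hv
      simp only [Finset.mem_insert, Finset.mem_singleton] at hv
      rcases hv with rfl | rfl | rfl
      · exact .refl
      · exact s1
      · exact s1.trans s2
  · rw [c3, c2, c1]; simp [d, bd]

theorem TT.str {S F} (h : TT G S F) : ∃ D, OrOn D F ∧ StrOn D S F := by
  induction h with
  | base x y z e1 e2 e3 hxy hxz hyz h1 h2 h3 h12 h13 h23 =>
    obtain ⟨D, a, b, -⟩ := str_tri h1 h2 h3 h12 h13 h23
    exact ⟨D, a, b⟩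
  | grow S F hT z p q hz hp hq hpq e he hee e1 e2 h1F h2F h12 h1 h2 ih =>
    obtain ⟨D, a, b⟩ := ih
    obtain ⟨D', a', b', -⟩ := str_grow a b hp hq h1F h2F h12 h1 h2
    exact ⟨D', a', b'⟩

/-- at a vertex `v` all outdegrees in `[1, deg - 1]` occur -/
def Flex (S : Finset G.V) (F : Finset G.E) (v : G.V) : Prop :=
  ∀ o : ℕ, 1 ≤ o → o + 1 ≤ deg F v → ∃ D, OrOn D F ∧ StrOn D S F ∧ bd D F v = 2 * (o : ZMod 3) - deg F v

theorem TT.flex {S F} (h : TT G S F) : ∀ v ∈ S, Flex S F v := by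
  induction h with
  | base x y z e1 e2 e3 hxy hxz hyz h1 h2 h3 h12 h13 h23 =>
    intro v hv o ho ho'
    have hT := TT.base x y z e1 e2 e3 hxy hxz hyz h1 h2 h3 h12 h13 h23
    have h2' := hT.deg_three (Finset.card_eq_three.2 ⟨x, y, z, hxy, hxz, hyz, rfl⟩) v hv
    rw [h2'] at ho' ⊢
    obtain rfl : o = 1 := by omega
    obtain ⟨D, a, b, c⟩ := str_tri h1 h2 h3 h12 h13 h23
    exact ⟨D, a, b, by rw [c]; simp⟩
  | grow S F hT z p q hz hp hq hpq e he hee e1 e2 h1F h2F h12 h1 h2 ih =>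
    intro v hv o ho ho'
    have hd := deg_grow h1F h2F h12 h1 h2 hpq v
    rw [hd] at ho' ⊢
    by_cases hvz : v = z
    · subst hvz
      have hz0 := deg_zero hT hz
      rw [hz0] at ho' ⊢
      simp at ho'
      obtain rfl : o = 1 := by omega
      obtain ⟨D, a, b⟩ := hT.str
      obtain ⟨D', a', b', c'⟩ := str_grow a b hp hq h1F h2F h12 h1 h2
      refine ⟨D', a', b', ?_⟩
      have hb : bd D F v = 0 := by
        simp only [bd, Finset.sum_apply]
        apply Finset.sum_eq_zero
        intro f hf
        have m1 : v ≠ (D f).1 := by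
          rintro h; exact hz (hT.ends_mem f hf v (by rw [a f hf, h]; simp))
        have m2 : v ≠ (D f).2 := by
          rintro h; exact hz (hT.ends_mem f hf v (by rw [a f hf, h]; simp))
        rw [← Prod.mk.eta (p := D f), d_apply]; simp [m1, m2]
      rw [c']
      simp [hb, d_apply, ne_of_ends h1, ne_of_ends h2]
    have hvS : v ∈ S := by simpa [hvz] using hv
    have h2l := hT.two_le v hvS
    rw [if_neg hvz] at ho' ⊢
    by_cases hvpq : v = p ∨ v = q
    · rw [if_pos hvpq] at ho' ⊢
      by_cases ho2 : o + 1 ≤ deg F v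
      · -- arc into v
        obtain ⟨D, a, b, c⟩ := ih v hvS o ho ho2
        rcases hvpq with rfl | rfl
        · obtain ⟨D', a', b', c'⟩ := str_grow' a b hp hq h1F h2F h12 h1 h2
          refine ⟨D', a', b', ?_⟩
          rw [c']; simp [d_apply, c, hpq]; ring
        · obtain ⟨D', a', b', c'⟩ := str_grow a b hp hq h1F h2F h12 h1 h2
          refine ⟨D', a', b', ?_⟩
          rw [c']; simp [d_apply, c, hpq.symm]; ring
      · obtain ⟨D, a, b, c⟩ := ih v hvS (o - 1) (by omega) (by omega)
        rw [Nat.cast_sub ho] at c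
        rcases hvpq with rfl | rfl
        · obtain ⟨D', a', b', c'⟩ := str_grow a b hp hq h1F h2F h12 h1 h2
          refine ⟨D', a', b', ?_⟩
          rw [c']; simp [d_apply, c, hpq]; ring
        · obtain ⟨D', a', b', c'⟩ := str_grow' a b hp hq h1F h2F h12 h1 h2
          refine ⟨D', a', b', ?_⟩
          rw [c']; simp [d_apply, c, hpq.symm]; ring
    · rw [if_neg hvpq] at ho' ⊢
      obtain ⟨D, a, b, c⟩ := ih v hvS o ho (by omega)
      obtain ⟨D', a', b', c'⟩ := str_grow a b hp hq h1F h2F h12 h1 h2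
      refine ⟨D', a', b', ?_⟩
      push Not at hvpq
      rw [c']; simp [d_apply, c, hvpq.1, hvpq.2]

theorem flex_insert {S : Finset G.V} {F : Finset G.E} {v : G.V} (h : Flex S F v) (h2 : 2 ≤ deg F v)
    {e : G.E} (he : e ∉ F) : Flex S (insert e F) v := by
  obtain ⟨x, y, hxy⟩ : ∃ x y, G.ends e = s(x, y) := by
    induction hh : G.ends e with
    | _ x y => exact ⟨x, y, rfl⟩
  intro o ho ho'
  have hne := ne_of_ends hxy
  rw [deg_insert he hxy] at ho' ⊢
  have sub : F ⊆ insert e F := Finset.subset_insert _ _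
  by_cases hv : v = x ∨ v = y
  · rw [if_pos hv] at ho' ⊢
    obtain ⟨w, hvw, hne⟩ : ∃ w, G.ends e = s(v, w) ∧ v ≠ w := by
      rcases hv with rfl | rfl
      · exact ⟨y, hxy, hne⟩
      · exact ⟨x, hxy.trans Sym2.eq_swap, hne.symm⟩
    by_cases ho2 : o + 1 ≤ deg F v
    · obtain ⟨D, a, b, c⟩ := h o ho ho2
      obtain ⟨D', a', -, b', c'⟩ := ext_or a he (hvw.trans Sym2.eq_swap)
      refine ⟨D', a', str_mono b sub b', ?_⟩
      rw [c']; simp [d_apply, c, hne]; ring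
    · obtain ⟨D, a, b, c⟩ := h (o - 1) (by omega) (by omega)
      rw [Nat.cast_sub ho] at c
      obtain ⟨D', a', -, b', c'⟩ := ext_or a he hvw
      refine ⟨D', a', str_mono b sub b', ?_⟩
      rw [c']; simp [d_apply, c, hne]; ring
  · rw [if_neg hv] at ho' ⊢
    obtain ⟨D, a, b, c⟩ := h o ho ho'
    obtain ⟨D', a', -, b', c'⟩ := ext_or a he hxy
    refine ⟨D', a', str_mono b sub b', ?_⟩
    push Not at hv
    rw [c']; simp [d_apply, c, hv.1, hv.2]

theorem deg_mono {A B : Finset G.E} (h : A ⊆ B) (v : G.V) : deg A v ≤ deg B v :=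
  Finset.card_le_card (Finset.filter_subset_filter _ h)

theorem flex_union {S : Finset G.V} {F : Finset G.E} {v : G.V} (h : Flex S F v) (h2 : 2 ≤ deg F v)
    (X : Finset G.E) : Flex S (X ∪ F) v := by
  induction X using Finset.induction_on with
  | empty => simpa using h
  | insert e X he ih =>
    rw [Finset.insert_union]
    by_cases h' : e ∈ X ∪ F
    · rwa [Finset.insert_eq_of_mem h']
    · exact flex_insert ih (h2.trans (deg_mono Finset.subset_union_right v)) h'

/-- `o` exists with `2 o ≡ n`. -/
theorem arith {n : ℕ} (h2 : 2 ≤ n) (h3 : n ≠ 3) : ∃ o : ℕ, 1 ≤ o ∧ o + 1 ≤ n ∧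
    2 * (o : ZMod 3) - (n : ZMod 3) = 0 := by
  have h3' : (3 : ZMod 3) = 0 := by decide
  obtain ⟨k, hk⟩ : ∃ k, n = 3 * k ∨ n = 3 * k + 1 ∨ n = 3 * k + 2 := ⟨n / 3, by omega⟩
  rcases hk with rfl | rfl | rfl
  · refine ⟨3, by omega, by omega, ?_⟩
    push_cast; linear_combination (2 - (k : ZMod 3)) * h3'
  · refine ⟨2, by omega, by omega, ?_⟩
    push_cast; linear_combination (1 - (k : ZMod 3)) * h3'
  · refine ⟨1, by omega, by omega, ?_⟩
    push_cast; linear_combination (- (k : ZMod 3)) * h3'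

/-- constant weight forces non-leaves to be monochromatic -/
theorem TT.mono {S F} (h : TT G S F) (c : G.V → ZMod 3) :
    (∀ D D', OrOn D F → StrOn D S F → OrOn D' F → StrOn D' S F → dot c (bd D F) = dot c (bd D' F)) →
    S.card ≠ 3 → ∃ k, (∃ a ∈ S, ∃ b ∈ S, a ≠ b ∧ c a = k ∧ c b = k) ∧ ∀ v ∈ S, deg F v ≠ 2 → c v = k := by
  induction h with
  | base x y z e1 e2 e3 hxy hxz hyz h1 h2 h3 h12 h13 h23 =>
    intro _ h
    exact absurd (Finset.card_eq_three.2 ⟨x, y, z, hxy, hxz, hyz, rfl⟩) h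
  | grow S F hT z p q hz hp hq hpq e he hee e1 e2 h1F h2F h12 h1 h2 ih =>
    intro hc _
    have hd := deg_grow h1F h2F h12 h1 h2 hpq
    have h3 : (3 : ZMod 3) = 0 := by decide
    have hcpq : c p = c q := by
      obtain ⟨D, a, b⟩ := hT.str
      obtain ⟨D', a', b', c'⟩ := str_grow a b hp hq h1F h2F h12 h1 h2
      obtain ⟨D'', a'', b'', c''⟩ := str_grow' a b hp hq h1F h2F h12 h1 h2
      have := hc D' D'' a' b' a'' b''
      rw [c', c'', dot_add, dot_add, dot_d, dot_d] at this
      linear_combination (c p - c q) * h3 - this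
    by_cases h3c : S.card = 3
    · refine ⟨c p, ⟨p, by simp [hp], q, by simp [hq], hpq, rfl, hcpq.symm⟩, ?_⟩
      intro v hv hdv
      rw [hd] at hdv
      by_cases hvz : v = z
      · subst hvz; exfalso; apply hdv; rw [deg_zero hT hz]; simp
      have hvS : v ∈ S := by simpa [hvz] using hv
      rw [hT.deg_three h3c v hvS, if_neg hvz] at hdv
      by_cases hvpq : v = p ∨ v = q
      · rcases hvpq with rfl | rfl
        · rfl
        · exact hcpq.symm
      · simp [hvpq] at hdv
    · obtain ⟨k, ⟨a, ha, b, hb, hab⟩, hk⟩ := ih (by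
        intro D D' a b a' b'
        obtain ⟨D1, a1, b1, c1⟩ := str_grow a b hp hq h1F h2F h12 h1 h2
        obtain ⟨D2, a2, b2, c2⟩ := str_grow a' b' hp hq h1F h2F h12 h1 h2
        have := hc D1 D2 a1 b1 a2 b2
        rw [c1, c2, dot_add, dot_add] at this
        exact add_left_cancel this) h3c
      refine ⟨k, ⟨a, by simp [ha], b, by simp [hb], hab⟩, ?_⟩
      have hpk : c p = k := by
        by_cases h2p : deg F p = 2
        · by_cases h2q : deg F q = 2
          · exact absurd (hT.adj_two e he p q hee h2p h2q) h3c
          · rw [hcpq]; exact hk q hq h2q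
        · exact hk p hp h2p
      intro v hv hdv
      rw [hd] at hdv
      by_cases hvz : v = z
      · subst hvz; exfalso; apply hdv; rw [deg_zero hT hz]; simp
      have hvS : v ∈ S := by simpa [hvz] using hv
      by_cases hvpq : v = p ∨ v = q
      · rcases hvpq with rfl | rfl
        · exact hpk
        · rw [← hcpq, hpk]
      · apply hk v hvS
        simpa [hvz, hvpq] using hdv

/-! main assembly -/

def Target (G : Multigraph) : Prop :=
  ∃ D : G.E → G.V × G.V, OrOn D Finset.univ ∧ StrOn D Finset.univ Finset.univ ∧ bd D Finset.univ = 0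

theorem step {F1 : Finset G.E} {D : G.E → G.V × G.V} (ho : OrOn D (Finset.univ \ F1))
    (hs : StrOn D Finset.univ (Finset.univ \ F1)) (hr : Rl F1 (-(bd D (Finset.univ \ F1)))) : Target G := by
  obtain ⟨D1, o1, b1⟩ := hr
  let D2 : G.E → G.V × G.V := fun e => if e ∈ F1 then D1 e else D e
  have e1 : ∀ e ∈ F1, D2 e = D1 e := fun e he => by simp [D2, he]
  have e2 : ∀ e ∈ Finset.univ \ F1, D2 e = D e := fun e he => by
    have : e ∉ F1 := by simpa using he
    simp [D2, this]
  refine ⟨D2, ?_, str_mono hs (Finset.subset_univ _) e2, ?_⟩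
  · intro e _
    by_cases he : e ∈ F1
    · rw [e1 e he]; exact o1 e he
    · have he' : e ∈ Finset.univ \ F1 := by simpa using he
      rw [e2 e he']; exact ho e he'
  · have hu : (Finset.univ : Finset G.E) = F1 ∪ (Finset.univ \ F1) := by
      rw [Finset.union_sdiff_of_subset (Finset.subset_univ _)]
    rw [hu, bd_union D2 Finset.disjoint_sdiff, bd_congr e1, bd_congr e2, b1]
    simp

theorem adm_neg_bd (D : G.E → G.V × G.V) (F : Finset G.E) : Adm Finset.univ (-(bd D F)) := by
  refine ⟨fun v hv => absurd (Finset.mem_univ v) hv, ?_⟩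
  simp [sum_bd]

theorem deg_univ (F1 : Finset G.E) (v : G.V) :
    deg Finset.univ v = deg F1 v + deg (Finset.univ \ F1) v := by
  rw [← deg_disj Finset.disjoint_sdiff, Finset.union_sdiff_of_subset (Finset.subset_univ _)]

theorem sub_compl {F1 F2 : Finset G.E} (hd : Disjoint F1 F2) : F2 ⊆ Finset.univ \ F1 := by
  intro e he
  simp only [Finset.mem_sdiff, Finset.mem_univ, true_and]
  exact fun h => Finset.disjoint_left.1 hd h he

theorem K1 {F1 F2 : Finset G.E} (h1 : TT G Finset.univ F1) (h2 : TT G Finset.univ F2)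
    (hd : Disjoint F1 F2) (hT : ¬ Target G) (v : G.V) (hv : deg F1 v = 2) : deg Finset.univ v = 5 := by
  by_contra h5
  apply hT
  have hsub := sub_compl hd
  have hfl : Flex Finset.univ (Finset.univ \ F1) v := by
    have := flex_union (h2.flex v (Finset.mem_univ v)) (h2.two_le v (Finset.mem_univ v)) (Finset.univ \ F1)
    rwa [Finset.union_eq_left.2 hsub] at this
  have hge := (h2.two_le v (Finset.mem_univ v)).trans (deg_mono hsub v)
  rw [deg_univ F1, hv] at h5
  obtain ⟨o, a1, a2, a3⟩ := arith hge (by omega)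
  obtain ⟨D, b1, b2, b3⟩ := hfl o a1 a2
  obtain ⟨c, -, -, hc⟩ := h1.good
  refine step b1 b2 (hc v (Finset.mem_univ v) hv _ (adm_neg_bd _ _) ?_)
  rw [Pi.neg_apply, b3, a3, neg_zero]

theorem K2 {F1 F2 : Finset G.E} (hd : Disjoint F1 F2) (hT : ¬ Target G) {c : G.V → ZMod 3}
    (hc : Good Finset.univ F1 c) : ∃ w : ZMod 3, ∀ D, OrOn D F2 → StrOn D Finset.univ F2 →
      dot c (bd D F2) = w := by
  have hD0 : ∀ e, ∃ p : G.V × G.V, G.ends e = s(p.1, p.2) := by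
    intro e
    induction hh : G.ends e with
    | _ x y => exact ⟨(x, y), rfl⟩
  choose D0 hD0 using hD0
  refine ⟨- dot c (bd D0 ((Finset.univ \ F1) \ F2)), ?_⟩
  intro D ho hs
  by_contra hne
  apply hT
  have hsub := sub_compl hd
  let D2 : G.E → G.V × G.V := fun e => if e ∈ F2 then D e else D0 e
  have e1 : ∀ e ∈ F2, D2 e = D e := fun e he => by simp [D2, he]
  have e2 : ∀ e ∈ (Finset.univ \ F1) \ F2, D2 e = D0 e := fun e he => by
    have : e ∉ F2 := (Finset.mem_sdiff.1 he).2
    simp [D2, this]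
  have hb : bd D2 (Finset.univ \ F1) = bd D F2 + bd D0 ((Finset.univ \ F1) \ F2) := by
    rw [← bd_congr e1, ← bd_congr e2, ← bd_union D2 Finset.disjoint_sdiff, Finset.union_sdiff_of_subset hsub]
  refine step (D := D2) ?_ (str_mono hs hsub e1) (hc _ (adm_neg_bd _ _) ?_)
  · intro e _
    by_cases he : e ∈ F2
    · rw [e1 e he]; exact ho e he
    · simp only [D2, he, if_false]; exact hD0 e
  · rw [hb, dot_neg, dot_add]
    intro h0
    apply hne
    linear_combination -h0

theorem handshake (F : Finset G.E) : Even (∑ v, deg F v) := by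
  induction F using Finset.induction_on with
  | empty => simp [deg_empty]
  | insert e F he ih =>
    obtain ⟨x, y, hxy⟩ : ∃ x y, G.ends e = s(x, y) := by
      induction hh : G.ends e with
      | _ x y => exact ⟨x, y, rfl⟩
    have hne := ne_of_ends hxy
    rw [Finset.sum_congr rfl (fun v _ => deg_insert he hxy v), Finset.sum_add_distrib]
    apply ih.add
    have : ∑ v : G.V, (if v = x ∨ v = y then 1 else 0) = 2 := by
      rw [← Finset.card_filter]
      have : (Finset.univ.filter (fun v => v = x ∨ v = y)) = {x, y} := by ext; simp
      rw [this, Finset.card_pair hne]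
    rw [this]; exact even_two

/-- `F` is `K4` minus the edge `xy`. -/
def Dia (p q x y : G.V) (F : Finset G.E) : Prop :=
  x ≠ y ∧ ∃ e0 a1 a2 a3 a4 : G.E, [e0, a1, a2, a3, a4].Nodup ∧ F = [e0, a1, a2, a3, a4].toFinset ∧
    G.ends e0 = s(p, q) ∧ G.ends a1 = s(p, x) ∧ G.ends a2 = s(q, x) ∧ G.ends a3 = s(p, y) ∧ G.ends a4 = s(q, y)

theorem Dia.swap1 {p q x y : G.V} {F : Finset G.E} (h : Dia p q x y F) : Dia q p x y F := by
  obtain ⟨hxy, e0, a1, a2, a3, a4, hn, hF, h0, h1, h2, h3, h4⟩ := h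
  refine ⟨hxy, e0, a2, a1, a4, a3, ?_, ?_, h0.trans Sym2.eq_swap, h2, h1, h4, h3⟩
  · simp only [List.nodup_cons, List.mem_cons, List.not_mem_nil, not_or] at hn ⊢; grind
  · rw [hF]; ext; simp; tauto

theorem Dia.swap2 {p q x y : G.V} {F : Finset G.E} (h : Dia p q x y F) : Dia p q y x F := by
  obtain ⟨hxy, e0, a1, a2, a3, a4, hn, hF, h0, h1, h2, h3, h4⟩ := h
  refine ⟨hxy.symm, e0, a3, a4, a1, a2, ?_, ?_, h0, h3, h4, h1, h2⟩
  · simp only [List.nodup_cons, List.mem_cons, List.not_mem_nil, not_or] at hn ⊢; grind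
  · rw [hF]; ext; simp; tauto

theorem Dia.deg_eq {p q x y : G.V} {F : Finset G.E} (h : Dia p q x y F) :
    deg F p = 3 ∧ deg F q = 3 ∧ deg F x = 2 ∧ deg F y = 2 := by
  obtain ⟨hxy, e0, a1, a2, a3, a4, hn, rfl, h0, h1, h2, h3, h4⟩ := h
  simp only [List.nodup_cons, List.mem_cons, List.not_mem_nil, not_or] at hn
  have n0 := ne_of_ends h0
  have n1 := ne_of_ends h1
  have n2 := ne_of_ends h2
  have n3 := ne_of_ends h3
  have n4 := ne_of_ends h4
  have key : ∀ v, deg [e0, a1, a2, a3, a4].toFinset v = 0 + (if v = q ∨ v = y then 1 else 0) +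
      (if v = p ∨ v = y then 1 else 0) + (if v = q ∨ v = x then 1 else 0) + (if v = p ∨ v = x then 1 else 0)
      + (if v = p ∨ v = q then 1 else 0) := by
    intro v
    simp only [List.toFinset_cons, List.toFinset_nil]
    rw [deg_insert (by simp; tauto) h0, deg_insert (by simp; tauto) h1, deg_insert (by simp; tauto) h2,
      deg_insert (by simp; tauto) h3, deg_insert (by simp) h4, deg_empty]
  refine ⟨?_, ?_, ?_, ?_⟩ <;> rw [key] <;>
    simp [n0, n1, n2, n3, n4, n0.symm, n1.symm, n2.symm, n3.symm, n4.symm, hxy, hxy.symm]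

theorem dia_grow {S : Finset G.V} {F : Finset G.E} {z p q w : G.V} {e f g e1 e2 : G.E} (hz : z ∉ S)
    (hS : S = {p, q, w}) (hF : F = [e, f, g].toFinset) (hn : [e, f, g].Nodup)
    (he : G.ends e = s(p, q)) (hf : G.ends f = s(p, w)) (hg : G.ends g = s(q, w))
    (h1F : e1 ∉ F) (h2F : e2 ∉ F) (h12 : e1 ≠ e2) (h1 : G.ends e1 = s(z, p)) (h2 : G.ends e2 = s(z, q)) :
    ∃ p q x y, insert z S = {p, q, x, y} ∧ Dia p q x y (insert e1 (insert e2 F)) := by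
  subst hS hF
  refine ⟨p, q, w, z, ?_, ?_, e, f, g, e1, e2, ?_, ?_, he, hf, hg, h1.trans Sym2.eq_swap, h2.trans Sym2.eq_swap⟩
  · ext; simp; tauto
  · rintro rfl; simp at hz
  · simp only [List.nodup_cons, List.mem_cons, List.not_mem_nil, not_or, List.mem_toFinset] at hn h1F h2F ⊢; grind
  · ext; simp; tauto

set_option maxHeartbeats 2000000 in
theorem TT.dia {S F} (h : TT G S F) (hc : S.card = 4) : ∃ p q x y, S = {p, q, x, y} ∧ Dia p q x y F := by
  cases h with
  | base x y z e1 e2 e3 hxy hxz hyz h1 h2 h3 h12 h13 h23 =>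
    rw [Finset.card_eq_three.2 ⟨x, y, z, hxy, hxz, hyz, rfl⟩] at hc; omega
  | grow S F hT z p q hz hp hq hpq e he hee e1 e2 h1F h2F h12 h1 h2 =>
    rw [Finset.card_insert_of_notMem hz] at hc
    cases hT with
    | grow S F hT z' p' q' hz' _ _ _ _ _ _ _ _ _ _ _ _ _ =>
      rw [Finset.card_insert_of_notMem hz'] at hc
      have := hT.three_le
      omega
    | base x y w f1 f2 f3 hxy hxz hyz g1 g2 g3 f12 f13 f23 =>
      simp only [Finset.mem_insert, Finset.mem_singleton] at he
      have g1' := g1.trans Sym2.eq_swap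
      have g2' := g2.trans Sym2.eq_swap
      have g3' := g3.trans Sym2.eq_swap
      have hnd : ∀ {a b c : G.E}, a ≠ b → a ≠ c → b ≠ c → [a, b, c].Nodup := by
        intro a b c; simp; tauto
      rcases he with rfl | rfl | rfl
      · have hh := hee
        rw [g1, Sym2.eq_iff] at hh
        rcases hh with ⟨rfl, rfl⟩ | ⟨rfl, rfl⟩
        · exact dia_grow hz rfl (f := f3) (g := f2) (by ext; simp; tauto) (hnd f13 f12 f23.symm) hee g3 g2 h1F h2F h12 h1 h2
        · exact dia_grow hz (w := w) (by ext; simp; tauto) (f := f2) (g := f3) (by ext; simp) (hnd f12 f13 f23) hee g2 g3 h1F h2F h12 h1 h2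
      · have hh := hee
        rw [g2, Sym2.eq_iff] at hh
        rcases hh with ⟨rfl, rfl⟩ | ⟨rfl, rfl⟩
        · exact dia_grow hz (w := x) (by ext; simp; tauto) (f := f1) (g := f3) (by ext; simp; tauto) (hnd f12.symm f23 f13) hee g1' g3' h1F h2F h12 h1 h2
        · exact dia_grow hz (w := x) (by ext; simp; tauto) (f := f3) (g := f1) (by ext; simp; tauto) (hnd f23 f12.symm f13.symm) hee g3' g1' h1F h2F h12 h1 h2
      · have hh := hee
        rw [g3, Sym2.eq_iff] at hh
        rcases hh with ⟨rfl, rfl⟩ | ⟨rfl, rfl⟩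
        · exact dia_grow hz (w := y) (by ext; simp; tauto) (f := f1) (g := f2) (by ext; simp; tauto) (hnd f13.symm f23.symm f12) hee g1 g2' h1F h2F h12 h1 h2
        · exact dia_grow hz (w := y) (by ext; simp; tauto) (f := f2) (g := f1) (by ext; simp; tauto) (hnd f23.symm f13.symm f12.symm) hee g2' g1 h1F h2F h12 h1 h2

theorem list_or (l : List (G.E × G.V × G.V)) (v0 : G.V) (hn : (l.map Prod.fst).Nodup)
    (hl : ∀ t ∈ l, G.ends t.1 = s(t.2.1, t.2.2)) :
    ∃ D, OrOn D (l.map Prod.fst).toFinset ∧ (∀ t ∈ l, D t.1 = t.2) ∧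
      bd D (l.map Prod.fst).toFinset = (l.map (fun t => d t.2)).sum := by
  induction l with
  | nil => exact ⟨fun _ => (v0, v0), by simp [OrOn], by simp, by simp [bd]⟩
  | cons t l ih =>
    rw [List.map_cons, List.nodup_cons] at hn
    obtain ⟨D, a, b, c⟩ := ih hn.2 (fun t ht => hl t (List.mem_cons_of_mem _ ht))
    obtain ⟨D', a', b', c', d'⟩ := ext_or a (by simpa using hn.1) (hl t List.mem_cons_self)
    refine ⟨D', by simpa using a', ?_, ?_⟩
    · intro r hr
      rcases List.mem_cons.1 hr with rfl | hr
      · exact b'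
      · rw [c' r.1 (by simp; exact ⟨_, _, hr⟩), b r hr]
    · rw [List.map_cons, List.toFinset_cons, d', c]; simp

theorem final {F1 F2 : Finset G.E} {u v a b : G.V} (h1 : Dia u v a b F1) (h2 : Dia a b u v F2)
    (hd : Disjoint F1 F2) (hF : F1 ∪ F2 = Finset.univ) (hV : ∀ w, w = u ∨ w = v ∨ w = a ∨ w = b) : Target G := by
  obtain ⟨gxy, f0, b1, b2, b3, b4, gn, rfl, g0, g1, g2, g3, g4⟩ := h2
  obtain ⟨hxy, e0, a1, a2, a3, a4, hn, rfl, h0, h1, h2, h3, h4⟩ := h1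
  have sw : ∀ {e : G.E} {x y : G.V}, G.ends e = s(x, y) → G.ends e = s(y, x) :=
    fun h => h.trans Sym2.eq_swap
  have hnn : ([e0, a1, a2, a3, a4] ++ [f0, b1, b2, b3, b4]).Nodup := by
    refine List.Nodup.append hn gn ?_
    exact List.disjoint_toFinset_iff_disjoint.1 hd
  obtain ⟨D, o1, o2, o3⟩ := list_or [(e0, v, u), (a1, a, u), (a2, a, v), (a3, b, u), (a4, b, v),
    (f0, a, b), (b1, u, a), (b2, b, u), (b3, a, v), (b4, b, v)] u (by simpa using hnn) (by
      intro t ht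
      simp only [List.mem_cons, List.not_mem_nil, or_false] at ht
      rcases ht with rfl | rfl | rfl | rfl | rfl | rfl | rfl | rfl | rfl | rfl
      exacts [sw h0, sw h1, sw h2, sw h3, sw h4, g0, sw g1, g2, g3, g4])
  have hu : (([(e0, v, u), (a1, a, u), (a2, a, v), (a3, b, u), (a4, b, v),
    (f0, a, b), (b1, u, a), (b2, b, u), (b3, a, v), (b4, b, v)] : List (G.E × G.V × G.V)).map Prod.fst).toFinset
      = Finset.univ := by
    rw [← hF, ← List.toFinset_append]; rfl
  rw [hu] at o1 o3
  have q1 : D e0 = (v, u) := o2 (e0, v, u) (by simp)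
  have q2 : D b1 = (u, a) := o2 (b1, u, a) (by simp)
  have q3 : D a2 = (a, v) := o2 (a2, a, v) (by simp)
  have q4 : D f0 = (a, b) := o2 (f0, a, b) (by simp)
  have q5 : D b2 = (b, u) := o2 (b2, b, u) (by simp)
  have q6 : D a1 = (a, u) := o2 (a1, a, u) (by simp)
  have S1 : Relation.ReflTransGen (fun x y => ∃ e ∈ (Finset.univ : Finset G.E), D e = (x, y)) v u :=
    .single ⟨_, by simp, q1⟩
  have S2 : Relation.ReflTransGen (fun x y => ∃ e ∈ (Finset.univ : Finset G.E), D e = (x, y)) u a :=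
    .single ⟨_, by simp, q2⟩
  have S3 : Relation.ReflTransGen (fun x y => ∃ e ∈ (Finset.univ : Finset G.E), D e = (x, y)) a v :=
    .single ⟨_, by simp, q3⟩
  have S4 : Relation.ReflTransGen (fun x y => ∃ e ∈ (Finset.univ : Finset G.E), D e = (x, y)) a b :=
    .single ⟨_, by simp, q4⟩
  have S5 : Relation.ReflTransGen (fun x y => ∃ e ∈ (Finset.univ : Finset G.E), D e = (x, y)) b u :=
    .single ⟨_, by simp, q5⟩
  have S6 : Relation.ReflTransGen (fun x y => ∃ e ∈ (Finset.univ : Finset G.E), D e = (x, y)) a u :=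
    .single ⟨_, by simp, q6⟩
  refine ⟨D, o1, str_hub u ?_ ?_, ?_⟩
  · intro w _
    rcases hV w with rfl | rfl | rfl | rfl
    exacts [.refl, S1, S6, S5]
  · intro w _
    rcases hV w with rfl | rfl | rfl | rfl
    exacts [.refl, S2.trans S3, S2, S2.trans S4]
  · rw [o3]
    have h3 : (3 : G.V → ZMod 3) = 0 := by
      funext w; exact (by decide : (3 : ZMod 3) = 0)
    simp only [List.map_cons, List.map_nil, List.sum_cons, List.sum_nil, d]
    linear_combination (Pi.single a 1 + Pi.single b 1 - Pi.single u 1 - Pi.single v 1 : G.V → ZMod 3) * h3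

theorem Dia.ne {p q x y : G.V} {F : Finset G.E} (h : Dia p q x y F) :
    p ≠ q ∧ p ≠ x ∧ q ≠ x ∧ p ≠ y ∧ q ≠ y ∧ x ≠ y := by
  obtain ⟨hxy, e0, a1, a2, a3, a4, hn, hF, h0, h1, h2, h3, h4⟩ := h
  exact ⟨ne_of_ends h0, ne_of_ends h1, ne_of_ends h2, ne_of_ends h3, ne_of_ends h4, hxy⟩

theorem match_aux {V : Type} {p q x y p' q' x' y' : V}
    (hV : ∀ w : V, w = p ∨ w = q ∨ w = x ∨ w = y)
    (m1 : p' ≠ q') (m2 : p' ≠ x') (m3 : q' ≠ x') (m4 : p' ≠ y') (m5 : q' ≠ y') (m6 : x' ≠ y')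
    (c : V → ZMod 3) (hc : c p' = c q')
    (n1 : c p ≠ c q) (n2 : c p ≠ c x) (n3 : c q ≠ c x) (n4 : c p ≠ c y) (n5 : c q ≠ c y) :
    ((p' = x ∧ q' = y) ∨ (p' = y ∧ q' = x)) ∧ ((x' = p ∧ y' = q) ∨ (x' = q ∧ y' = p)) := by
  have hcases : (p' = x ∧ q' = y) ∨ (p' = y ∧ q' = x) := by
    rcases hV p' with h | h | h | h <;> rcases hV q' with h' | h' | h' | h' <;>
      rw [h, h'] at hc m1 <;> first
        | exact absurd rfl m1
        | exact absurd hc ‹_›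
        | exact absurd hc.symm ‹_›
        | exact Or.inl ⟨h, h'⟩
        | exact Or.inr ⟨h, h'⟩
  refine ⟨hcases, ?_⟩
  have hx : ∀ w, p' ≠ w → q' ≠ w → w = p ∨ w = q := by
    intro w w1 w2
    rcases hV w with h | h | h | h
    · exact Or.inl h
    · exact Or.inr h
    · rcases hcases with ⟨a, b⟩ | ⟨a, b⟩
      · exact absurd (a.trans h.symm) w1
      · exact absurd (b.trans h.symm) w2
    · rcases hcases with ⟨a, b⟩ | ⟨a, b⟩
      · exact absurd (b.trans h.symm) w2
      · exact absurd (a.trans h.symm) w1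
  rcases hx x' m2 m3 with h | h <;> rcases hx y' m4 m5 with h' | h'
  · exact absurd (h.trans h'.symm) m6
  · exact Or.inl ⟨h, h'⟩
  · exact Or.inr ⟨h, h'⟩
  · exact absurd (h.trans h'.symm) m6

theorem target {F1 F2 : Finset G.E} (h1 : TT G Finset.univ F1) (h2 : TT G Finset.univ F2)
    (hd : Disjoint F1 F2) : Target G := by
  by_contra hT
  have k1 := K1 h1 h2 hd hT
  have k1' := K1 h2 h1 hd.symm hT
  have mu : ∀ v : G.V, v ∈ (Finset.univ : Finset G.V) := Finset.mem_univ
  by_cases h3 : (Finset.univ : Finset G.V).card = 3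
  · have hs := handshake (G := G) Finset.univ
    rw [Finset.sum_congr rfl (fun v _ => k1 v (h1.deg_three h3 v (mu v))), Finset.sum_const, h3] at hs
    revert hs; decide
  obtain ⟨c, hp, hg, -⟩ := h1.good
  obtain ⟨w, hw⟩ := K2 hd hT hg
  obtain ⟨k, hab, hk⟩ := h2.mono c (fun D D' a b a' b' => (hw D a b).trans (hw D' a' b').symm) h3
  have hsub := sub_compl hd
  have hle : ∀ v, deg F1 v + deg F2 v ≤ deg Finset.univ v := by
    intro v
    rw [deg_univ F1]
    exact Nat.add_le_add_left (deg_mono hsub v) _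
  obtain ⟨h4, -⟩ := h1.struct c k hp (by
    intro u _ hu
    have hu2 : deg F2 u = 2 := by
      by_contra h; exact hu (hk u (mu u) h)
    have := k1' u hu2
    have := hle u
    omega) hab
  obtain ⟨p, q, x, y, hS, hD⟩ := h1.dia h4
  obtain ⟨p', q', x', y', hS', hD'⟩ := h2.dia h4
  have hV : ∀ w : G.V, w = p ∨ w = q ∨ w = x ∨ w = y := by
    intro w; have := mu w; rw [hS] at this; simpa using this
  have cp' : c p' = k := hk p' (mu _) (by rw [hD'.deg_eq.1]; decide)
  have cq' : c q' = k := hk q' (mu _) (by rw [hD'.deg_eq.2.1]; decide)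
  obtain ⟨n1, n2, n3, n4, n5⟩ : c p ≠ c q ∧ c p ≠ c x ∧ c q ≠ c x ∧ c p ≠ c y ∧ c q ≠ c y := by
    obtain ⟨_, e0, a1, a2, a3, a4, hn, rfl, h0, h1, h2, h3, h4⟩ := hD
    exact ⟨hp e0 (by simp) _ _ h0, hp a1 (by simp) _ _ h1, hp a2 (by simp) _ _ h2,
      hp a3 (by simp) _ _ h3, hp a4 (by simp) _ _ h4⟩
  have hDD : Dia x y p q F2 := by
    obtain ⟨m1, m2, m3, m4, m5, m6⟩ := hD'.ne
    obtain ⟨ha, hb⟩ := match_aux hV m1 m2 m3 m4 m5 m6 c (cp'.trans cq'.symm) n1 n2 n3 n4 n5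
    rcases ha with ⟨rfl, rfl⟩ | ⟨rfl, rfl⟩ <;> rcases hb with ⟨rfl, rfl⟩ | ⟨rfl, rfl⟩
    exacts [hD', hD'.swap2, hD'.swap1, hD'.swap1.swap2]
  have hfive : ∀ v, deg F1 v + deg F2 v = deg Finset.univ v := by
    obtain ⟨d1, d2, d3, d4⟩ := hD.deg_eq
    obtain ⟨d5, d6, d7, d8⟩ := hDD.deg_eq
    intro v
    rcases hV v with rfl | rfl | rfl | rfl
    · rw [k1' _ d7, d1, d7]
    · rw [k1' _ d8, d2, d8]
    · rw [k1 _ d3, d3, d5]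
    · rw [k1 _ d4, d4, d6]
  have hF : F1 ∪ F2 = Finset.univ := by
    rw [Finset.eq_univ_iff_forall]
    intro e
    by_contra he
    obtain ⟨r, t, hrt⟩ : ∃ x y, G.ends e = s(x, y) := by
      induction hh : G.ends e with
      | _ x y => exact ⟨x, y, rfl⟩
    have a1 := deg_insert he hrt r
    have a2 := deg_mono (Finset.subset_univ (insert e (F1 ∪ F2))) r
    rw [deg_disj hd, hfive r] at a1
    simp at a1
    omega
  exact hT (final hD hDD hd hF hV)

end TTF

/-- Every graph containing two edge-disjoint spanning triangle-trees
has flow index strictly less than 3: there are integers `t ≥ 2s > 0` with `t/s < 3`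
such that `G` admits a circular `t/s`-flow. -/
theorem stmt_2 (G : Multigraph) (F1 F2 : Set G.E)
    (h1 : G.IsTriangleTree Set.univ F1) (h2 : G.IsTriangleTree Set.univ F2)
    (hdisj : Disjoint F1 F2) :
    ∃ t s : ℤ, 0 < s ∧ 2 * s ≤ t ∧ t < 3 * s ∧ G.HasCircularFlow t s := by
  have t1 : TTF.TT G Finset.univ F1.toFinset := by
    convert TTF.conv h1 using 1
    ext; simp
  have t2 : TTF.TT G Finset.univ F2.toFinset := by
    convert TTF.conv h2 using 1
    ext; simp
  obtain ⟨D, a, b, c⟩ := TTF.target t1 t2 (Set.disjoint_toFinset.2 hdisj)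
  exact TTF.flow_of_strong D a b c
end
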